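/- arXiv:1912.08183 — 7 statements merged into one kernel-verified Lean document; each statement's English description precedes it below -/
import Mathlib

section
/- Let 0 < δ < 1 and 1 < K₁ ≤ 4, and suppose the smooth function f₂ : [0, μ_max] → ℝ satisfies −K₁·δ ≤ f₂(0) ≤ −δ and |f₂^{(l)}(μ)| ≤ (K₁^l·δ^{l+1}/(l+1)²)·l! for all μ ∈ [0, μ_max] and all integers l ≥ 0. Then the functions f_n of the mean field flow hierarchy generated by f₂ are smooth and satisfy, with K = 4, the bounds |f_n^{(l)}(μ)| ≤ (K^{n+l−2}·δ^{l+1}/(l+1)²)·(n+l−2)!/(n−2)! for all μ ∈ [0, μ_max], all even n ≥ 4 and all integers l ≥ 0. -/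
/-- The sum over ordered pairs `(n₁, n₂)` of even integers with `n₁, n₂ ≥ 4` and
`n₁ + n₂ = n + 2` of `f n₁ μ * f n₂ μ`. -/
noncomputable def mfPairSum (f : ℕ → ℝ → ℝ) (n : ℕ) (μ : ℝ) : ℝ :=
  ∑ n₁ ∈ Finset.range (n + 3),
    if Even n₁ ∧ 4 ≤ n₁ ∧ n₁ + 2 ≤ n then f n₁ μ * f (n + 2 - n₁) μ else 0

/-- The mean field flow hierarchy on `[0, μmax]` generated by the smooth function `f 2`:
a family of smooth functions `f n : ℝ → ℝ` (indexed by even `n ≥ 2`) satisfying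
`f₄ = (1/3)·f₂·(f₂ − 1) + (1/3)·f₂′` and, for even `n ≥ 4`,
`f_{n+2} = (1/(n+1))·Σ f_{n₁} f_{n₂} + (1/(n+1))·f_n·(2 f₂ + 1 − 4/n) + (2/(n(n+1)))·f_n′`
on `[0, μmax]`. -/
def MeanFieldHierarchy (μmax : ℝ) (f : ℕ → ℝ → ℝ) : Prop :=
  (∀ n, ContDiff ℝ (⊤ : ℕ∞) (f n)) ∧
  (∀ μ ∈ Set.Icc (0 : ℝ) μmax,
      f 4 μ = (1 / 3) * f 2 μ * (f 2 μ - 1) + (1 / 3) * deriv (f 2) μ) ∧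
  (∀ n : ℕ, Even n → 4 ≤ n → ∀ μ ∈ Set.Icc (0 : ℝ) μmax,
      f (n + 2) μ =
        (1 / ((n : ℝ) + 1)) * mfPairSum f n μ
          + (1 / ((n : ℝ) + 1)) * f n μ * (2 * f 2 μ + 1 - 4 / (n : ℝ))
          + (2 / ((n : ℝ) * ((n : ℝ) + 1))) * deriv (f n) μ)

open scoped ContDiff

/-- The weight `r ^ l * ((p + l)! / p!) / (l + 1) ^ 2`, with the quotient of factorials written as
`l! * (p + l).choose l`. -/
noncomputable def derivWeight (r : ℝ) (p l : ℕ) : ℝ :=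
  r ^ l * (l.factorial * (p + l).choose l) / ((l : ℝ) + 1) ^ 2

/-- The function `h` is smooth and all its derivatives are bounded on `s` by `C` times
`derivWeight r p`. -/
def DerivBound (s : Set ℝ) (r C : ℝ) (p : ℕ) (h : ℝ → ℝ) : Prop :=
  ContDiff ℝ ∞ h ∧ ∀ l, ∀ x ∈ s, |iteratedDeriv l h x| ≤ C * derivWeight r p l

lemma derivWeight_nonneg {r : ℝ} (hr : 0 ≤ r) (p l : ℕ) : 0 ≤ derivWeight r p l := by
  unfold derivWeight; positivity

lemma derivWeight_mono {r : ℝ} (hr : 0 ≤ r) {p q : ℕ} (h : p ≤ q) (l : ℕ) :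
    derivWeight r p l ≤ derivWeight r q l := by
  unfold derivWeight
  gcongr

lemma derivWeight_succ_le {r : ℝ} (hr : 0 ≤ r) (p l : ℕ) :
    derivWeight r p (l + 1) ≤ r * (p + 1) * derivWeight r (p + 1) l := by
  have h := Nat.choose_succ_right_eq (p + (l + 1)) l
  rw [show p + (l + 1) - l = p + 1 by omega] at h
  have h' : ((p + (l + 1)).choose (l + 1) : ℝ) * (l + 1) = (p + (l + 1)).choose l * (p + 1) := by
    exact_mod_cast h
  have key : r * (p + 1) * derivWeight r (p + 1) l =
      r ^ (l + 1) * ((l + 1).factorial * (p + (l + 1)).choose (l + 1)) / ((l : ℝ) + 1) ^ 2 := by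
    unfold derivWeight
    rw [Nat.factorial_succ, show p + 1 + l = p + (l + 1) by ring]
    push_cast
    rw [← mul_div_assoc]
    congr 1
    linear_combination -(r ^ (l + 1) * l.factorial) * h'
  rw [key]
  unfold derivWeight
  push_cast
  gcongr
  linarith

lemma choose_mul_choose_le (p q i j : ℕ) :
    (p + i).choose i * (q + j).choose j ≤ (p + q + (i + j)).choose (i + j) := by
  rw [show p + q + (i + j) = (p + i) + (q + j) by ring, Nat.add_choose_eq (p + i)]
  have hmem : (i, j) ∈ Finset.HasAntidiagonal.antidiagonal (i + j) :=
    Finset.HasAntidiagonal.mem_antidiagonal.2 rfl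
  exact Finset.single_le_sum (f := fun ij : ℕ × ℕ => (p + i).choose ij.1 * (q + j).choose ij.2)
    (fun _ _ => Nat.zero_le _) hmem

lemma sum_range_inv_sq_le (m : ℕ) :
    ∑ i ∈ Finset.range (m + 1), 1 / ((i : ℝ) + 1) ^ 2 ≤ 2 - 1 / ((m : ℝ) + 1) := by
  induction m with
  | zero => norm_num
  | succ m ih =>
    rw [Finset.sum_range_succ]
    have h : 1 / (((m + 1 : ℕ) : ℝ) + 1) ^ 2 ≤ 1 / ((m : ℝ) + 1) - 1 / (((m + 1 : ℕ) : ℝ) + 1) := by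
      push_cast
      rw [div_sub_div _ _ (by positivity) (by positivity), div_le_div_iff₀ (by positivity)
        (by positivity)]
      nlinarith [(Nat.cast_nonneg m : (0 : ℝ) ≤ m)]
    linarith

lemma sum_range_inv_sq_mul_inv_sq_le (l : ℕ) :
    ∑ i ∈ Finset.range (l + 1), 1 / (((i : ℝ) + 1) ^ 2 * (((l - i : ℕ) : ℝ) + 1) ^ 2) ≤
      8 / ((l : ℝ) + 1) ^ 2 := by
  have hterm : ∀ i ∈ Finset.range (l + 1),
      1 / (((i : ℝ) + 1) ^ 2 * (((l - i : ℕ) : ℝ) + 1) ^ 2) ≤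
        2 / ((l : ℝ) + 1) ^ 2 *
          (1 / ((i : ℝ) + 1) ^ 2 + 1 / (((l - i : ℕ) : ℝ) + 1) ^ 2) := by
    intro i hi
    obtain ⟨j, rfl⟩ := Nat.exists_eq_add_of_le (Nat.lt_succ_iff.1 (Finset.mem_range.1 hi))
    rw [Nat.add_sub_cancel_left, div_add_div _ _ (by positivity) (by positivity),
      div_mul_div_comm, div_le_div_iff₀ (by positivity) (by positivity)]
    have h : (((i + j : ℕ) : ℝ) + 1) ^ 2 ≤ 2 * (((i : ℝ) + 1) ^ 2 + ((j : ℝ) + 1) ^ 2) := by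
      push_cast
      nlinarith [(Nat.cast_nonneg i : (0 : ℝ) ≤ i), (Nat.cast_nonneg j : (0 : ℝ) ≤ j),
        sq_nonneg ((i : ℝ) - j)]
    have h0 : 0 ≤ ((i : ℝ) + 1) ^ 2 * ((j : ℝ) + 1) ^ 2 := by positivity
    nlinarith [mul_le_mul_of_nonneg_right h h0]
  refine (Finset.sum_le_sum hterm).trans ?_
  have hle : ∑ i ∈ Finset.range (l + 1), 1 / ((i : ℝ) + 1) ^ 2 ≤ 2 :=
    (sum_range_inv_sq_le l).trans (sub_le_self _ (by positivity))
  have hrefl := Finset.sum_range_reflect (fun i : ℕ => 1 / ((i : ℝ) + 1) ^ 2) (l + 1)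
  simp only [Nat.add_sub_cancel] at hrefl
  rw [← Finset.mul_sum, Finset.sum_add_distrib, hrefl]
  calc _ ≤ 2 / ((l : ℝ) + 1) ^ 2 * (2 + 2) := by gcongr
    _ = _ := by ring

lemma sum_choose_mul_derivWeight_le {r : ℝ} (hr : 0 ≤ r) (p q l : ℕ) :
    ∑ i ∈ Finset.range (l + 1), (l.choose i : ℝ) * derivWeight r p i * derivWeight r q (l - i) ≤
      8 * derivWeight r (p + q) l := by
  have hterm : ∀ i ∈ Finset.range (l + 1),
      (l.choose i : ℝ) * derivWeight r p i * derivWeight r q (l - i) ≤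
        r ^ l * (l.factorial * (p + q + l).choose l) *
          (1 / (((i : ℝ) + 1) ^ 2 * (((l - i : ℕ) : ℝ) + 1) ^ 2)) := by
    intro i hi
    have hil : i ≤ l := Nat.lt_succ_iff.1 (Finset.mem_range.1 hi)
    have hfac : (l.choose i : ℝ) * i.factorial * (l - i).factorial = l.factorial := by
      exact_mod_cast Nat.choose_mul_factorial_mul_factorial hil
    have hpow : r ^ i * r ^ (l - i) = r ^ l := by rw [← pow_add, Nat.add_sub_cancel' hil]
    have hch : ((p + i).choose i : ℝ) * (q + (l - i)).choose (l - i) ≤ (p + q + l).choose l := by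
      have := choose_mul_choose_le p q i (l - i)
      rw [Nat.add_sub_cancel' hil] at this
      exact_mod_cast this
    calc _ = r ^ l * (l.factorial *
            (((p + i).choose i : ℝ) * (q + (l - i)).choose (l - i))) *
          (1 / (((i : ℝ) + 1) ^ 2 * (((l - i : ℕ) : ℝ) + 1) ^ 2)) := by
          unfold derivWeight
          rw [← hfac, ← hpow]
          field_simp
      _ ≤ _ := by gcongr
  refine (Finset.sum_le_sum hterm).trans ?_
  rw [← Finset.mul_sum]
  refine (mul_le_mul_of_nonneg_left (sum_range_inv_sq_mul_inv_sq_le l) (by positivity)).trans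
    (le_of_eq ?_)
  unfold derivWeight
  ring

namespace DerivBound

variable {s : Set ℝ} {r C D : ℝ} {p q : ℕ} {g h : ℝ → ℝ}

lemma mono (hr : 0 ≤ r) (hD : 0 ≤ D) (hCD : C ≤ D) (hpq : p ≤ q) (hh : DerivBound s r C p h) :
    DerivBound s r D q h := by
  refine ⟨hh.1, fun l x hx => (hh.2 l x hx).trans ?_⟩
  exact mul_le_mul hCD (derivWeight_mono hr hpq l) (derivWeight_nonneg hr p l) hD

lemma congr (hs : UniqueDiffOn ℝ s) (hg : ContDiff ℝ ∞ g) (hgh : Set.EqOn g h s)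
    (hh : DerivBound s r C p h) : DerivBound s r C p g := by
  refine ⟨hg, fun l x hx => ?_⟩
  have hl : ((l : ℕ∞) : WithTop ℕ∞) ≤ ∞ := by exact_mod_cast le_top
  have key := iteratedDerivWithin_congr (n := l) hgh hx
  rw [iteratedDerivWithin_eq_iteratedDeriv hs (hg.of_le hl).contDiffAt hx,
    iteratedDerivWithin_eq_iteratedDeriv hs (hh.1.of_le hl).contDiffAt hx] at key
  rw [key]
  exact hh.2 l x hx

lemma add (hg : DerivBound s r C p g) (hh : DerivBound s r D p h) :
    DerivBound s r (C + D) p (fun x => g x + h x) := by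
  refine ⟨hg.1.add hh.1, fun l x hx => ?_⟩
  have hl : ((l : ℕ∞) : WithTop ℕ∞) ≤ ∞ := by exact_mod_cast le_top
  have := iteratedDeriv_add (hg.1.of_le hl).contDiffAt (hh.1.of_le hl).contDiffAt (x := x)
  rw [show (fun x => g x + h x) = g + h from rfl, this, add_mul]
  exact (abs_add_le _ _).trans (add_le_add (hg.2 l x hx) (hh.2 l x hx))

lemma const_mul (c : ℝ) (hh : DerivBound s r C p h) :
    DerivBound s r (|c| * C) p (fun x => c * h x) := by
  refine ⟨contDiff_const.mul hh.1, fun l x hx => ?_⟩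
  rw [iteratedDeriv_const_mul_field, abs_mul, mul_assoc]
  exact mul_le_mul_of_nonneg_left (hh.2 l x hx) (abs_nonneg c)

lemma mul (hr : 0 ≤ r) (hC : 0 ≤ C) (hD : 0 ≤ D) (hg : DerivBound s r C p g)
    (hh : DerivBound s r D q h) :
    DerivBound s r (8 * C * D) (p + q) (fun x => g x * h x) := by
  refine ⟨hg.1.mul hh.1, fun l x hx => ?_⟩
  have hl : ((l : ℕ∞) : WithTop ℕ∞) ≤ ∞ := by exact_mod_cast le_top
  have := iteratedDeriv_mul (hg.1.of_le hl).contDiffAt (hh.1.of_le hl).contDiffAt (x := x)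
  rw [show (fun x => g x * h x) = g * h from rfl, this]
  calc _ ≤ ∑ i ∈ Finset.range (l + 1),
        |(l.choose i : ℝ) * iteratedDeriv i g x * iteratedDeriv (l - i) h x| :=
        Finset.abs_sum_le_sum_abs _ _
    _ ≤ ∑ i ∈ Finset.range (l + 1),
        C * D * ((l.choose i : ℝ) * derivWeight r p i * derivWeight r q (l - i)) := by
        refine Finset.sum_le_sum fun i _ => ?_
        rw [mul_assoc, abs_mul, abs_mul, Nat.abs_cast]
        calc _ ≤ (l.choose i : ℝ) * ((C * derivWeight r p i) * (D * derivWeight r q (l - i))) := by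
              refine mul_le_mul_of_nonneg_left ?_ (Nat.cast_nonneg _)
              exact mul_le_mul (hg.2 i x hx) (hh.2 _ x hx) (abs_nonneg _)
                (mul_nonneg hC (derivWeight_nonneg hr p i))
          _ = _ := by ring
    _ ≤ C * D * (8 * derivWeight r (p + q) l) := by
        rw [← Finset.mul_sum]
        exact mul_le_mul_of_nonneg_left (sum_choose_mul_derivWeight_le hr p q l)
          (mul_nonneg hC hD)
    _ = _ := by ring

lemma deriv (hr : 0 ≤ r) (hC : 0 ≤ C) (hh : DerivBound s r C p h) :
    DerivBound s r (C * (r * (p + 1))) (p + 1) (deriv h) := by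
  refine ⟨(contDiff_infty_iff_deriv.1 hh.1).2, fun l x hx => ?_⟩
  rw [← iteratedDeriv_succ', mul_assoc]
  exact (hh.2 (l + 1) x hx).trans (mul_le_mul_of_nonneg_left (derivWeight_succ_le hr p l) hC)

lemma sum {ι : Type*} (t : Finset ι) {F : ι → ℝ → ℝ}
    (hF : ∀ i ∈ t, DerivBound s r C p (F i)) :
    DerivBound s r (t.card * C) p (fun x => ∑ i ∈ t, F i x) := by
  refine ⟨ContDiff.sum fun i hi => (hF i hi).1, fun l x hx => ?_⟩
  have hl : ((l : ℕ∞) : WithTop ℕ∞) ≤ ∞ := by exact_mod_cast le_top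
  rw [iteratedDeriv_fun_sum fun i hi => ((hF i hi).1.of_le hl).contDiffAt, mul_assoc,
    ← nsmul_eq_mul]
  exact (Finset.abs_sum_le_sum_abs _ _).trans
    (Finset.sum_le_card_nsmul _ _ _ fun i hi => (hF i hi).2 l x hx)

end DerivBound

lemma derivBound_mfPairSum {s : Set ℝ} {r δ : ℝ} (hr : 0 ≤ r) (hδ : 0 ≤ δ) {f : ℕ → ℝ → ℝ}
    {n : ℕ} (hn : Even n)
    (hf : ∀ m, Even m → 4 ≤ m → m < n → DerivBound s r (4 ^ (m - 2) * δ) (m - 2) (f m)) :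
    DerivBound s r ((n + 1) * (8 * 4 ^ (n - 2) * δ ^ 2)) (n - 2) (mfPairSum f n) := by
  have hsum : mfPairSum f n = fun x => ∑ m ∈ Finset.range (n + 3) with
      Even m ∧ 4 ≤ m ∧ m + 2 ≤ n, f m x * f (n + 2 - m) x := by
    ext x
    rw [mfPairSum, Finset.sum_filter]
  rw [hsum]
  refine (DerivBound.sum (C := 8 * 4 ^ (n - 2) * δ ^ 2) (p := n - 2) _ fun m hm => ?_).mono hr
    (by positivity) ?_ le_rfl
  · obtain ⟨-, hme, hm4, hmn⟩ := Finset.mem_filter.1 hm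
    have h1 := hf m hme hm4 (by omega)
    have h2 := hf (n + 2 - m) (by grind) (by omega) (by omega)
    convert h1.mul hr (by positivity) (by positivity) h2 using 1
    · rw [show n - 2 = (m - 2) + (n + 2 - m - 2) by omega, pow_add]
      ring
    · omega
  · refine mul_le_mul_of_nonneg_right ?_ (by positivity)
    have : ((Finset.range (n + 3)).filter fun m => Even m ∧ 4 ≤ m ∧ m + 2 ≤ n) ⊆
        Finset.range (n + 1) := by
      intro m hm
      have := (Finset.mem_filter.1 hm).2
      exact Finset.mem_range.2 (by omega)
    have hcard := Finset.card_le_card this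
    rw [Finset.card_range] at hcard
    exact_mod_cast hcard

lemma derivBound_hierarchy {μmax δ : ℝ} (hμmax : 0 < μmax) (hδ0 : 0 < δ) (hδ1 : δ < 1)
    {f : ℕ → ℝ → ℝ} (hf : MeanFieldHierarchy μmax f)
    (h2 : DerivBound (Set.Icc 0 μmax) (4 * δ) δ 0 (f 2)) {n : ℕ} (hn : Even n) (hn4 : 4 ≤ n) :
    DerivBound (Set.Icc 0 μmax) (4 * δ) (4 ^ (n - 2) * δ) (n - 2) (f n) := by
  obtain ⟨hsmooth, hf4, hrec⟩ := hf
  have hr : 0 ≤ 4 * δ := by positivity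
  have hs : UniqueDiffOn ℝ (Set.Icc 0 μmax) := uniqueDiffOn_Icc hμmax
  have hδδ : δ ^ 2 ≤ δ := by nlinarith
  induction n using Nat.strong_induction_on with
  | _ n ih =>
  rcases hn4.eq_or_lt with rfl | hlt
  · have h22 := ((h2.mul hr hδ0.le hδ0.le h2).const_mul (1 / 3)).mono hr (D := 8 / 3 * δ ^ 2)
      (q := 2) (by positivity) (by rw [abs_of_pos (by norm_num)]; exact le_of_eq (by ring))
      (by norm_num)
    have h2' := (h2.const_mul (-1 / 3)).mono hr (D := 1 / 3 * δ) (q := 2)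
      (by positivity) (by rw [abs_of_neg (by norm_num)]; exact le_of_eq (by ring)) (by norm_num)
    have h2d := ((h2.deriv hr hδ0.le).const_mul (1 / 3)).mono hr (D := 4 / 3 * δ ^ 2)
      (q := 2) (by positivity)
      (by rw [abs_of_pos (by norm_num)]; push_cast; exact le_of_eq (by ring)) (by norm_num)
    refine (((h22.add h2').add h2d).congr hs (hsmooth 4) fun x hx => ?_).mono hr (by positivity) ?_
      le_rfl
    · rw [hf4 x hx]
      ring
    · norm_num
      linarith
  · obtain ⟨m, rfl⟩ : ∃ m, n = m + 2 := ⟨n - 2, by omega⟩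
    have hme : Even m := by grind
    have hm4 : 4 ≤ m := by grind
    have hm : (4 : ℝ) ≤ m := by exact_mod_cast hm4
    have hfm := ih m (by omega) hme hm4
    have hpow : (4 : ℝ) ^ (m + 2 - 2) = 16 * 4 ^ (m - 2) := by
      rw [show m + 2 - 2 = (m - 2) + 2 by omega, pow_add]
      ring
    set A : ℝ := 4 ^ (m - 2) with hA
    have hA0 : 0 < A := by positivity
    have hmle : m - 2 ≤ m := Nat.sub_le _ _
    have hA1 := ((derivBound_mfPairSum hr hδ0.le hme fun k hk hk4 hkm =>
      ih k (by omega) hk hk4).const_mul (1 / ((m : ℝ) + 1))).mono hr (D := 8 * (A * δ))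
      (q := m) (by positivity) (by
        rw [abs_of_pos (by positivity), ← hA]
        calc _ = 8 * A * δ ^ 2 := by field_simp
          _ ≤ 8 * A * δ := by gcongr
          _ = _ := by ring) hmle
    have hB := ((hfm.mul hr (by positivity) hδ0.le h2).const_mul (2 / ((m : ℝ) + 1))).mono hr
      (D := 4 * (A * δ)) (q := m) (by positivity) (by
        rw [abs_of_pos (by positivity)]
        have : 2 / ((m : ℝ) + 1) ≤ 1 / 2 := by
          rw [div_le_div_iff₀ (by positivity) (by positivity)]
          linarith
        calc _ ≤ 1 / 2 * (8 * (A * δ) * δ) := by gcongr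
          _ = 4 * A * δ ^ 2 := by ring
          _ ≤ 4 * A * δ := by gcongr
          _ = _ := by ring) hmle
    have hC := (hfm.const_mul (1 / ((m : ℝ) + 1) * (1 - 4 / m))).mono hr
      (D := A * δ) (q := m) (by positivity) (by
        have h1 : 4 / (m : ℝ) ≤ 1 := by rwa [div_le_one (by positivity)]
        have h2 : 0 ≤ 4 / (m : ℝ) := by positivity
        have h3 : 1 / ((m : ℝ) + 1) ≤ 1 := by
          rw [div_le_one (by positivity)]
          linarith
        rw [abs_of_nonneg (mul_nonneg (by positivity) (by linarith))]
        calc _ ≤ 1 * 1 * (A * δ) := by gcongr; linarith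
          _ = _ := by ring) hmle
    have hD := ((hfm.deriv hr (by positivity)).const_mul (2 / ((m : ℝ) * (m + 1)))).mono hr
      (D := 2 * (A * δ)) (q := m) (by positivity) (by
        rw [abs_of_pos (by positivity)]
        have hcast : ((m - 2 : ℕ) : ℝ) + 1 ≤ m := by
          exact_mod_cast (by omega : m - 2 + 1 ≤ m)
        have : 8 / ((m : ℝ) + 1) ≤ 2 := by
          rw [div_le_iff₀ (by positivity)]
          linarith
        calc _ ≤ 2 / ((m : ℝ) * (m + 1)) * (A * δ * (4 * δ * m)) := by gcongr
          _ = 8 / ((m : ℝ) + 1) * (A * δ ^ 2) := by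
            field_simp
            ring
          _ ≤ 2 * (A * δ) := by gcongr) (by omega)
    refine ((((hA1.add hB).add hC).add hD).congr hs (hsmooth (m + 2)) fun x hx => ?_).mono hr
      (by positivity) ?_ le_rfl
    · rw [hrec m hme hm4 x hx]
      field_simp
      ring
    · rw [hpow]
      nlinarith [mul_pos hA0 hδ0]

/-- bounds on the mean field hierarchy generated by a small negative `f₂`,
with `K = 4`. -/
theorem stmt0 (μmax δ K₁ : ℝ) (hμmax : 0 < μmax)
    (hδ0 : 0 < δ) (hδ1 : δ < 1) (hK₁1 : 1 < K₁) (hK₁4 : K₁ ≤ 4)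
    (f : ℕ → ℝ → ℝ) (hf : MeanFieldHierarchy μmax f)
    (hinit : -K₁ * δ ≤ f 2 0 ∧ f 2 0 ≤ -δ)
    (hbd : ∀ l : ℕ, ∀ μ ∈ Set.Icc (0 : ℝ) μmax,
      |iteratedDeriv l (f 2) μ| ≤
        K₁ ^ l * δ ^ (l + 1) / ((l : ℝ) + 1) ^ 2 * l.factorial) :
    ∀ n l : ℕ, Even n → 4 ≤ n → ∀ μ ∈ Set.Icc (0 : ℝ) μmax,
      |iteratedDeriv l (f n) μ| ≤
        (4 : ℝ) ^ (n + l - 2) * δ ^ (l + 1) / ((l : ℝ) + 1) ^ 2 *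
          (((n + l - 2).factorial : ℝ) / ((n - 2).factorial : ℝ)) := by
  intro n l hn hn4 μ hμ
  have h2 : DerivBound (Set.Icc 0 μmax) (4 * δ) δ 0 (f 2) := by
    refine ⟨hf.1 2, fun l x hx => (hbd l x hx).trans ?_⟩
    calc _ ≤ (4 : ℝ) ^ l * δ ^ (l + 1) / ((l : ℝ) + 1) ^ 2 * l.factorial := by gcongr
      _ = _ := by
        rw [derivWeight, Nat.zero_add, Nat.choose_self, Nat.cast_one]
        ring
  refine ((derivBound_hierarchy hμmax hδ0 hδ1 hf h2 hn hn4).2 l μ hμ).trans (le_of_eq ?_)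
  obtain ⟨p, rfl⟩ : ∃ p, n = p + 2 := ⟨n - 2, by omega⟩
  rw [show p + 2 + l - 2 = p + l by omega, Nat.add_sub_cancel, derivWeight,
    ← Nat.add_choose_mul_factorial_mul_factorial p l]
  push_cast
  field_simp
  ring
end

section
/- Let 0 < δ < 1/2 and 0 < β < 1/2. For each μ_max > 0 set δ_{μ_max}(μ) := δ/(1 + (μ_max − μ)·β·δ) for μ ∈ [0, μ_max], take f₂ := −δ_{μ_max}, and let (f_n^{(μ_max)}) be the mean field flow hierarchy generated by f₂ on [0, μ_max]. Then: (i) δ_{μ_max} is smooth, satisfies δ_{μ_max}′ = β·δ_{μ_max}² and δ_{μ_max}(μ_max) = δ, so f₂^{(μ_max)}(μ_max) = −δ < 0, and f₄^{(μ_max)}(μ_max) > 0; (ii) for every even n ≥ 2 the limit lim_{μ_max → ∞} f_n^{(μ_max)}(μ_max) exists, and in particular lim_{μ_max → ∞} (f₂^{(μ_max)})^{(l)}(μ_max) = −β^l·l!·δ^{l+1} for every l ≥ 0; (iii) for every even n ≥ 2 and every integer l ≥ 0, lim_{μ_max → ∞} (f_n^{(μ_max)})^{(l)}(0) = 0 (ultraviolet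 asymptotic freedom). -/
open Polynomial in
/-- The derivation of `ℝ[X]` corresponding to `d/dμ` when `X` stands for a solution of
`d' = β * d ^ 2`. -/
noncomputable def flowDerivative (β : ℝ) (P : ℝ[X]) : ℝ[X] :=
  C β * X ^ 2 * derivative P

/-- The solution `δ / (1 + (m - μ) * β * δ)` of `d' = β * d ^ 2` with `d m = δ`. -/
noncomputable def runningCoupling (δ β m μ : ℝ) : ℝ :=
  δ / (1 + (m - μ) * β * δ)

section

open Polynomial Set Filter Topology

variable {δ β m μ : ℝ}

lemma flowDerivative_eval_zero (P : ℝ[X]) : (flowDerivative β P).eval 0 = 0 := by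
  simp [flowDerivative]

lemma flowDerivative_iterate_eval_zero {P : ℝ[X]} (hP : P.eval 0 = 0) (l : ℕ) :
    ((flowDerivative β)^[l] P).eval 0 = 0 := by
  cases l with
  | zero => simpa using hP
  | succ l => rw [Function.iterate_succ_apply']; exact flowDerivative_eval_zero _

lemma flowDerivative_iterate_neg_X (l : ℕ) :
    (flowDerivative β)^[l] (-X) = C (-(β ^ l * (l.factorial : ℝ))) * X ^ (l + 1) := by
  induction l with
  | zero => simp
  | succ l ih =>
    rw [Function.iterate_succ_apply', ih, flowDerivative, derivative_C_mul_X_pow,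
      Nat.factorial_succ]
    simp only [C_mul, C_neg, Nat.cast_mul, Nat.cast_add, Nat.cast_one, C_pow,
      add_tsub_cancel_right]
    ring

lemma runningCoupling_self : runningCoupling δ β m m = δ := by
  simp [runningCoupling]

lemma runningCoupling_denom_pos (hδ : 0 < δ) (hβ : 0 < β) (hμ : μ ≤ m) :
    0 < 1 + (m - μ) * β * δ := by
  have : 0 ≤ m - μ := sub_nonneg.2 hμ
  positivity

lemma hasDerivAt_runningCoupling (hδ : 0 < δ) (hβ : 0 < β) (hμ : μ ≤ m) :
    HasDerivAt (runningCoupling δ β m) (β * runningCoupling δ β m μ ^ 2) μ := by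
  have h := (runningCoupling_denom_pos hδ hβ hμ).ne'
  have hden : HasDerivAt (fun x => 1 + (m - x) * β * δ) (-1 * β * δ) μ :=
    ((((hasDerivAt_id μ).const_sub m).mul_const β).mul_const δ).const_add 1
  refine ((hasDerivAt_const μ δ).fun_div hden h).congr_deriv ?_
  rw [runningCoupling]
  field_simp
  ring

lemma contDiffOn_runningCoupling (hδ : 0 < δ) (hβ : 0 < β) :
    ContDiffOn ℝ (⊤ : ℕ∞) (runningCoupling δ β m) (Icc 0 m) := by
  refine ContDiffOn.div contDiffOn_const (by fun_prop) fun x hx => ?_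
  exact (runningCoupling_denom_pos hδ hβ hx.2).ne'

lemma tendsto_runningCoupling_zero (hδ : 0 < δ) (hβ : 0 < β) :
    Tendsto (fun m => runningCoupling δ β m 0) atTop (𝓝 0) := by
  refine Tendsto.div_atTop tendsto_const_nhds (tendsto_atTop_add_const_left _ _ ?_)
  simp only [sub_zero, mul_assoc]
  exact tendsto_id.atTop_mul_const (mul_pos hβ hδ)

lemma deriv_eq_flowDerivative_eval (hδ : 0 < δ) (hβ : 0 < β) (hm : 0 < m) {f : ℝ → ℝ}
    (hf : Differentiable ℝ f) {P : ℝ[X]}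
    (h : ∀ μ ∈ Icc 0 m, f μ = P.eval (runningCoupling δ β m μ)) (hμ : μ ∈ Icc 0 m) :
    deriv f μ = (flowDerivative β P).eval (runningCoupling δ β m μ) := by
  have hu := uniqueDiffOn_Icc hm μ hμ
  have hP := ((P.hasDerivAt _).comp μ
    (hasDerivAt_runningCoupling hδ hβ hμ.2)).hasDerivWithinAt (s := Icc 0 m)
  rw [← (hf μ).derivWithin hu, (hP.congr h (h μ hμ)).derivWithin hu]
  simp only [flowDerivative, eval_mul, eval_C, eval_pow, eval_X]
  ring

lemma iteratedDeriv_eq_flowDerivative_eval (hδ : 0 < δ) (hβ : 0 < β) (hm : 0 < m) {f : ℝ → ℝ}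
    (hf : ContDiff ℝ (⊤ : ℕ∞) f) {P : ℝ[X]}
    (h : ∀ μ ∈ Icc 0 m, f μ = P.eval (runningCoupling δ β m μ)) (l : ℕ) :
    ∀ μ ∈ Icc 0 m, iteratedDeriv l f μ =
      ((flowDerivative β)^[l] P).eval (runningCoupling δ β m μ) := by
  induction l with
  | zero => simpa using h
  | succ l ih =>
    intro μ hμ
    rw [iteratedDeriv_succ, Function.iterate_succ_apply']
    refine deriv_eq_flowDerivative_eval hδ hβ hm (hf.differentiable_iteratedDeriv l ?_) ih hμ
    exact_mod_cast ENat.natCast_lt_top l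

/-- Every member of the hierarchy is a universal polynomial without constant term in the
running coupling. -/
lemma MeanFieldHierarchy.exists_polynomial (hδ : 0 < δ) (hβ : 0 < β) {F : ℝ → ℕ → ℝ → ℝ}
    (hF : ∀ m > (0 : ℝ), MeanFieldHierarchy m (F m) ∧
      ∀ μ ∈ Icc (0 : ℝ) m, F m 2 μ = -runningCoupling δ β m μ)
    {n : ℕ} (hn : Even n) (h2 : 2 ≤ n) :
    ∃ P : ℝ[X], P.eval 0 = 0 ∧
      ∀ m > 0, ∀ μ ∈ Icc 0 m, F m n μ = P.eval (runningCoupling δ β m μ) := by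
  induction n using Nat.strong_induction_on with
  | _ n ih =>
  have hdiff : ∀ m > 0, ∀ k, Differentiable ℝ (F m k) := fun m hm k =>
    ((hF m hm).1.1 k).differentiable (by simp)
  have hX : ∀ m > 0, ∀ μ ∈ Icc 0 m,
      F m 2 μ = (-X : ℝ[X]).eval (runningCoupling δ β m μ) := by
    intro m hm μ hμ
    simpa using (hF m hm).2 μ hμ
  obtain rfl | rfl | ⟨k, rfl, hk, hk4⟩ : n = 2 ∨ n = 4 ∨ ∃ k, n = k + 2 ∧ Even k ∧ 4 ≤ k := by
    obtain ⟨j, rfl⟩ := hn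
    by_cases h : j ≤ 2
    · omega
    · exact .inr (.inr ⟨j + j - 2, by omega, ⟨j - 1, by omega⟩, by omega⟩)
  · exact ⟨-X, by simp, hX⟩
  · refine ⟨C (1 / 3) * -X * (-X - 1) + C (1 / 3) * flowDerivative β (-X),
      by simp [flowDerivative_eval_zero], fun m hm μ hμ => ?_⟩
    rw [(hF m hm).1.2.1 μ hμ,
      deriv_eq_flowDerivative_eval hδ hβ hm (hdiff m hm 2) (hX m hm) hμ, hX m hm μ hμ]
    simp
  · have hex : ∀ j, ∃ P : ℝ[X], j < k + 2 → Even j → 2 ≤ j → P.eval 0 = 0 ∧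
        ∀ m > 0, ∀ μ ∈ Icc 0 m, F m j μ = P.eval (runningCoupling δ β m μ) := by
      intro j
      by_cases h : j < k + 2 ∧ Even j ∧ 2 ≤ j
      · obtain ⟨P, hP⟩ := ih j h.1 h.2.1 h.2.2
        exact ⟨P, fun _ _ _ => hP⟩
      · exact ⟨0, fun h1 h2 h3 => absurd ⟨h1, h2, h3⟩ h⟩
    choose P hP using hex
    have hPk := hP k (by omega) hk (by omega)
    refine ⟨C (1 / ((k : ℝ) + 1)) * ∑ j ∈ Finset.range (k + 3),
          (if Even j ∧ 4 ≤ j ∧ j + 2 ≤ k then P j * P (k + 2 - j) else 0)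
        + C (1 / ((k : ℝ) + 1)) * P k * (2 * -X + 1 - C (4 / (k : ℝ)))
        + C (2 / ((k : ℝ) * ((k : ℝ) + 1))) * flowDerivative β (P k), ?_, fun m hm μ hμ => ?_⟩
    · have hsum : ∀ j ∈ Finset.range (k + 3),
          (if Even j ∧ 4 ≤ j ∧ j + 2 ≤ k then P j * P (k + 2 - j) else 0).eval 0 = 0 := by
        intro j _
        split_ifs with hj
        · simp [(hP j (by omega) hj.1 (by omega)).1]
        · simp
      simp only [eval_add, eval_mul, eval_finsetSum, Finset.sum_eq_zero hsum, hPk.1,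
        flowDerivative_eval_zero]
      simp
    · have hsum : mfPairSum (F m) k μ = (∑ j ∈ Finset.range (k + 3),
          (if Even j ∧ 4 ≤ j ∧ j + 2 ≤ k then P j * P (k + 2 - j) else 0)).eval
            (runningCoupling δ β m μ) := by
        rw [mfPairSum, eval_finsetSum]
        refine Finset.sum_congr rfl fun j _ => ?_
        split_ifs with hj
        · have heven : Even (k + 2 - j) :=
            (Nat.even_sub (by omega)).2 (iff_of_true (hk.add even_two) hj.1)
          rw [eval_mul, (hP j (by omega) hj.1 (by omega)).2 m hm μ hμ,
            (hP (k + 2 - j) (by omega) heven (by omega)).2 m hm μ hμ]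
        · simp
      rw [(hF m hm).1.2.2 k hk hk4 μ hμ, hsum,
        deriv_eq_flowDerivative_eval hδ hβ hm (hdiff m hm k) (hPk.2 m hm) hμ,
        hPk.2 m hm μ hμ, hX m hm μ hμ]
      simp

end

/-- asymptotically free solutions of the mean field flow equations with
`f₂(μ) = −δ/(1 + (μ_max − μ)·β·δ)`. -/
theorem stmt1 (δ β : ℝ) (hδ0 : 0 < δ) (hδ : δ < 1 / 2) (hβ0 : 0 < β) (hβ : β < 1 / 2)
    (F : ℝ → ℕ → ℝ → ℝ)
    (hF : ∀ μmax > (0 : ℝ), MeanFieldHierarchy μmax (F μmax) ∧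
      ∀ μ ∈ Set.Icc (0 : ℝ) μmax,
        F μmax 2 μ = -(δ / (1 + (μmax - μ) * β * δ))) :
    -- (i)
    (∀ μmax > (0 : ℝ),
        ContDiffOn ℝ (⊤ : ℕ∞) (fun μ => δ / (1 + (μmax - μ) * β * δ)) (Set.Icc 0 μmax) ∧
        (∀ μ ∈ Set.Icc (0 : ℝ) μmax,
            deriv (fun μ' => δ / (1 + (μmax - μ') * β * δ)) μ
              = β * (δ / (1 + (μmax - μ) * β * δ)) ^ 2) ∧
        δ / (1 + (μmax - μmax) * β * δ) = δ ∧
        F μmax 2 μmax = -δ ∧ -δ < 0 ∧ 0 < F μmax 4 μmax) ∧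
    -- (ii)
    (∀ n : ℕ, Even n → 2 ≤ n →
        ∃ L : ℝ, Filter.Tendsto (fun μmax => F μmax n μmax) Filter.atTop (nhds L)) ∧
    (∀ l : ℕ, Filter.Tendsto (fun μmax => iteratedDeriv l (F μmax 2) μmax)
        Filter.atTop (nhds (-(β ^ l * (l.factorial : ℝ) * δ ^ (l + 1))))) ∧
    -- (iii)
    (∀ n : ℕ, Even n → 2 ≤ n → ∀ l : ℕ,
        Filter.Tendsto (fun μmax => iteratedDeriv l (F μmax n) 0)
          Filter.atTop (nhds 0)) := by
  have hzero : ∀ m > (0 : ℝ), (0 : ℝ) ∈ Set.Icc 0 m := fun m hm => ⟨le_rfl, hm.le⟩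
  have hself : ∀ m > (0 : ℝ), m ∈ Set.Icc 0 m := fun m hm => ⟨hm.le, le_rfl⟩
  have hX : ∀ m > 0, ∀ μ ∈ Set.Icc 0 m,
      F m 2 μ = (-Polynomial.X : Polynomial ℝ).eval (runningCoupling δ β m μ) := by
    intro m hm μ hμ
    simpa [runningCoupling] using (hF m hm).2 μ hμ
  refine ⟨fun m hm => ⟨contDiffOn_runningCoupling hδ0 hβ0,
    fun μ hμ => (hasDerivAt_runningCoupling hδ0 hβ0 hμ.2).deriv, runningCoupling_self,
    ?_, neg_lt_zero.2 hδ0, ?_⟩, fun n hn h2 => ?_, fun l => ?_, fun n hn h2 l => ?_⟩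
  · simpa using (hF m hm).2 m (hself m hm)
  · have hdiff : Differentiable ℝ (F m 2) := ((hF m hm).1.1 2).differentiable (by simp)
    rw [(hF m hm).1.2.1 m (hself m hm),
      deriv_eq_flowDerivative_eval hδ0 hβ0 hm hdiff (hX m hm) (hself m hm),
      hX m hm m (hself m hm), runningCoupling_self]
    simp only [flowDerivative, Polynomial.eval_neg, Polynomial.eval_X, Polynomial.derivative_neg,
      Polynomial.derivative_X, Polynomial.eval_mul, Polynomial.eval_C, Polynomial.eval_pow,
      Polynomial.eval_one]
    nlinarith [mul_pos (pow_pos hδ0 2) (show 0 < 1 - β by linarith)]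
  · obtain ⟨P, -, hP⟩ := MeanFieldHierarchy.exists_polynomial hδ0 hβ0 hF hn h2
    refine ⟨P.eval δ, tendsto_const_nhds.congr' ?_⟩
    filter_upwards [Filter.eventually_gt_atTop 0] with m hm
    rw [hP m hm m (hself m hm), runningCoupling_self]
  · refine tendsto_const_nhds.congr' ?_
    filter_upwards [Filter.eventually_gt_atTop 0] with m hm
    rw [iteratedDeriv_eq_flowDerivative_eval hδ0 hβ0 hm ((hF m hm).1.1 2) (hX m hm) l m
      (hself m hm), flowDerivative_iterate_neg_X, runningCoupling_self]
    simp
  · obtain ⟨P, hP0, hP⟩ := MeanFieldHierarchy.exists_polynomial hδ0 hβ0 hF hn h2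
    have hlim := (((flowDerivative β)^[l] P).continuous.tendsto 0).comp
      (tendsto_runningCoupling_zero hδ0 hβ0)
    rw [flowDerivative_iterate_eval_zero hP0] at hlim
    refine hlim.congr' ?_
    filter_upwards [Filter.eventually_gt_atTop 0] with m hm
    exact (iteratedDeriv_eq_flowDerivative_eval hδ0 hβ0 hm ((hF m hm).1.1 n) (hP m hm) l 0
      (hzero m hm)).symm
end

section
/- Let 0 < β < 1 and let δ : [0, μ_max] → ℝ be smooth with δ′ = β·δ² and 0 < δ(μ) < 1 for all μ ∈ [0, μ_max]. Take f₂ := 1 + δ. Then the functions f_n of the mean field flow hierarchy generated by f₂ satisfy, with K = 4, the bounds 0 < f_n^{(l)}(μ) ≤ δ(μ)·(K^{n+l−2}/(l+1)²)·(n+l−2)!/(n−2)! for all μ ∈ [0, μ_max], all even n ≥ 4 and all integers l ≥ 0; in particular all derivatives of all f_n with n ≥ 4 are strictly positive. -/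
open Polynomial in
/-- A real polynomial with nonnegative coefficients, zero constant term, degree at most `d`, and
positive value at most `c` at `1`. -/
structure PosPoly (d : ℕ) (c : ℝ) (q : ℝ[X]) : Prop where
  natDegree_le : q.natDegree ≤ d
  coeff_zero : q.coeff 0 = 0
  coeff_nonneg : ∀ k, 0 ≤ q.coeff k
  eval_pos : 0 < q.eval 1
  eval_le : q.eval 1 ≤ c

open Polynomial in
/-- The derivation `β X² d/dX`, which represents `d/dμ` on polynomials in a solution of
`δ′ = β δ²`. -/
noncomputable def riccatiDeriv (β : ℝ) (q : ℝ[X]) : ℝ[X] :=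
  C β * (X ^ 2 * derivative q)

section PolynomialLemmas

open Polynomial

theorem coeff_nonneg_mul {p q : ℝ[X]} (hp : ∀ k, 0 ≤ p.coeff k) (hq : ∀ k, 0 ≤ q.coeff k)
    (k : ℕ) : 0 ≤ (p * q).coeff k := by
  rw [coeff_mul]
  exact Finset.sum_nonneg fun x _ => mul_nonneg (hp _) (hq _)

theorem coeff_nonneg_C_mul {p : ℝ[X]} {a : ℝ} (ha : 0 ≤ a) (hp : ∀ k, 0 ≤ p.coeff k)
    (k : ℕ) : 0 ≤ (C a * p).coeff k := by
  rw [coeff_C_mul]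
  exact mul_nonneg ha (hp k)

theorem coeff_nonneg_X_pow_mul {p : ℝ[X]} (m : ℕ) (hp : ∀ k, 0 ≤ p.coeff k)
    (k : ℕ) : 0 ≤ (X ^ m * p).coeff k := by
  rw [coeff_X_pow_mul']
  split_ifs
  · exact hp _
  · exact le_rfl

theorem eval_derivative_one_eq_sum {q : ℝ[X]} {d : ℕ} (hd : q.natDegree ≤ d) :
    (derivative q).eval 1 = ∑ i ∈ Finset.range (d + 1), q.coeff i * i := by
  rw [derivative_eval, sum_over_range' _ _ (d + 1) (by omega)]
  · simp
  · simp

theorem eval_one_eq_sum {q : ℝ[X]} {d : ℕ} (hd : q.natDegree ≤ d) :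
    q.eval 1 = ∑ i ∈ Finset.range (d + 1), q.coeff i := by
  rw [eval_eq_sum_range' (n := d + 1) (by omega)]
  simp

namespace PosPoly

variable {d : ℕ} {c : ℝ} {q : ℝ[X]}

theorem eval_derivative_le (h : PosPoly d c q) : (derivative q).eval 1 ≤ d * c := by
  refine le_trans ?_ (mul_le_mul_of_nonneg_left h.eval_le (Nat.cast_nonneg d))
  rw [eval_derivative_one_eq_sum h.natDegree_le, eval_one_eq_sum h.natDegree_le, Finset.mul_sum]
  refine Finset.sum_le_sum fun i hi => ?_
  rw [mul_comm]
  have : (i : ℝ) ≤ d := by exact_mod_cast Nat.lt_succ_iff.mp (Finset.mem_range.mp hi)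
  exact mul_le_mul_of_nonneg_right this (h.coeff_nonneg i)

theorem eval_one_le_eval_derivative (h : PosPoly d c q) :
    q.eval 1 ≤ (derivative q).eval 1 := by
  rw [eval_derivative_one_eq_sum h.natDegree_le, eval_one_eq_sum h.natDegree_le]
  refine Finset.sum_le_sum fun i _ => ?_
  rcases Nat.eq_zero_or_pos i with rfl | hi
  · simp [h.coeff_zero]
  · have : (1 : ℝ) ≤ i := by exact_mod_cast hi
    exact le_mul_of_one_le_right (h.coeff_nonneg i) this

theorem eval_le_mul (h : PosPoly d c q) {x : ℝ} (hx0 : 0 ≤ x) (hx1 : x ≤ 1) :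
    q.eval x ≤ x * c := by
  refine le_trans ?_ (mul_le_mul_of_nonneg_left h.eval_le hx0)
  rw [eval_one_eq_sum h.natDegree_le, Finset.mul_sum,
    eval_eq_sum_range' (n := d + 1) (Nat.lt_succ_of_le h.natDegree_le)]
  refine Finset.sum_le_sum fun i _ => ?_
  rcases Nat.eq_zero_or_pos i with rfl | hi
  · simp [h.coeff_zero]
  · rw [mul_comm]
    exact mul_le_mul_of_nonneg_right (pow_le_of_le_one hx0 hx1 hi.ne') (h.coeff_nonneg i)

theorem eval_pos_of_pos (h : PosPoly d c q) {x : ℝ} (hx0 : 0 < x) (hx1 : x ≤ 1) :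
    0 < q.eval x := by
  refine lt_of_lt_of_le (mul_pos (pow_pos hx0 d) h.eval_pos) ?_
  rw [eval_one_eq_sum h.natDegree_le, Finset.mul_sum,
    eval_eq_sum_range' (n := d + 1) (Nat.lt_succ_of_le h.natDegree_le)]
  refine Finset.sum_le_sum fun i hi => ?_
  rw [mul_comm]
  exact mul_le_mul_of_nonneg_left
    (pow_le_pow_of_le_one hx0.le hx1 (Nat.lt_succ_iff.mp (Finset.mem_range.mp hi)))
    (h.coeff_nonneg i)

theorem riccatiDeriv {β : ℝ} (hβ0 : 0 < β) (hβ1 : β ≤ 1) (h : PosPoly d c q) :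
    PosPoly (d + 1) (d * c) (riccatiDeriv β q) where
  natDegree_le := by
    rcases Nat.eq_zero_or_pos d with rfl | hd
    · have h0 : q = 0 := by
        rw [eq_C_of_natDegree_le_zero h.natDegree_le, h.coeff_zero, C_0]
      simp [_root_.riccatiDeriv, h0]
    · have h1 := natDegree_C_mul_le β (X ^ 2 * derivative q)
      have h2 := natDegree_mul_le (p := (X : ℝ[X]) ^ 2) (q := derivative q)
      have h3 := natDegree_derivative_le q
      have h4 := h.natDegree_le
      rw [natDegree_X_pow] at h2
      unfold _root_.riccatiDeriv
      omega
  coeff_zero := by simp [_root_.riccatiDeriv]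
  coeff_nonneg := by
    refine coeff_nonneg_C_mul hβ0.le (coeff_nonneg_X_pow_mul 2 fun k => ?_)
    rw [coeff_derivative]
    have := h.coeff_nonneg (k + 1)
    positivity
  eval_pos := by
    have := h.eval_pos.trans_le h.eval_one_le_eval_derivative
    simpa [_root_.riccatiDeriv] using mul_pos hβ0 this
  eval_le := by
    have h1 := h.eval_pos.trans_le h.eval_one_le_eval_derivative
    have : β * (derivative q).eval 1 ≤ (derivative q).eval 1 := mul_le_of_le_one_left h1.le hβ1
    simpa [_root_.riccatiDeriv] using this.trans h.eval_derivative_le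

theorem iterate_riccatiDeriv {β : ℝ} (hβ0 : 0 < β) (hβ1 : β ≤ 1) (h : PosPoly d c q) (l : ℕ) :
    PosPoly (d + l) (c * d.ascFactorial l) ((_root_.riccatiDeriv β)^[l] q) := by
  induction l with
  | zero => simpa using h
  | succ l ih =>
    rw [Function.iterate_succ_apply', Nat.ascFactorial_succ]
    convert ih.riccatiDeriv hβ0 hβ1 using 1 <;> push_cast <;> ring

end PosPoly

theorem deriv_eq_of_eqOn_Icc {a b : ℝ} (hab : a < b) {g h : ℝ → ℝ} {h' x : ℝ}
    (hx : x ∈ Set.Icc a b) (hg : DifferentiableAt ℝ g x) (hh : HasDerivAt h h' x)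
    (heq : Set.EqOn g h (Set.Icc a b)) : deriv g x = h' := by
  have hu : UniqueDiffWithinAt ℝ (Set.Icc a b) x := uniqueDiffOn_Icc hab x hx
  rw [← hg.derivWithin hu, derivWithin_congr heq (heq hx)]
  exact hh.hasDerivWithinAt.derivWithin hu

variable {μmax β : ℝ} {δ : ℝ → ℝ}

theorem deriv_eq_eval_riccatiDeriv (hμmax : 0 < μmax) (hδ : Differentiable ℝ δ)
    (hode : ∀ μ ∈ Set.Icc (0 : ℝ) μmax, deriv δ μ = β * δ μ ^ 2)
    {g : ℝ → ℝ} (hg : Differentiable ℝ g) {q : ℝ[X]}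
    (heq : ∀ μ ∈ Set.Icc (0 : ℝ) μmax, g μ = q.eval (δ μ)) :
    ∀ μ ∈ Set.Icc (0 : ℝ) μmax, deriv g μ = (riccatiDeriv β q).eval (δ μ) := by
  intro μ hμ
  have hd := (q.hasDerivAt (δ μ)).comp μ (hδ μ).hasDerivAt
  rw [deriv_eq_of_eqOn_Icc hμmax hμ (hg μ) hd heq, hode μ hμ]
  simp only [riccatiDeriv, eval_mul, eval_C, eval_pow, eval_X]
  ring

theorem iteratedDeriv_eq_eval_riccatiDeriv (hμmax : 0 < μmax) (hδ : Differentiable ℝ δ)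
    (hode : ∀ μ ∈ Set.Icc (0 : ℝ) μmax, deriv δ μ = β * δ μ ^ 2)
    {g : ℝ → ℝ} (hg : ContDiff ℝ (⊤ : ℕ∞) g) {q : ℝ[X]}
    (heq : ∀ μ ∈ Set.Icc (0 : ℝ) μmax, g μ = q.eval (δ μ)) (l : ℕ) :
    ∀ μ ∈ Set.Icc (0 : ℝ) μmax,
      iteratedDeriv l g μ = ((riccatiDeriv β)^[l] q).eval (δ μ) := by
  induction l with
  | zero => simpa using heq
  | succ l ih =>
    rw [iteratedDeriv_succ, Function.iterate_succ_apply']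
    refine deriv_eq_eval_riccatiDeriv hμmax hδ hode ?_ ih
    exact hg.differentiable_iteratedDeriv l (by exact_mod_cast WithTop.coe_lt_top _)

/-- Each member of the hierarchy beyond `f 2` is a polynomial in `δ`. -/
theorem exists_posPoly_of_meanFieldHierarchy (hμmax : 0 < μmax) (hβ0 : 0 < β) (hβ1 : β < 1)
    (hδ : Differentiable ℝ δ)
    (hode : ∀ μ ∈ Set.Icc (0 : ℝ) μmax, deriv δ μ = β * δ μ ^ 2)
    {f : ℕ → ℝ → ℝ} (hf : MeanFieldHierarchy μmax f) (hf2 : f 2 = fun μ => 1 + δ μ) (n : ℕ) :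
    Even n → 4 ≤ n → ∃ q : ℝ[X], PosPoly (n - 1) (4 ^ (n - 2)) q ∧
      ∀ μ ∈ Set.Icc (0 : ℝ) μmax, f n μ = q.eval (δ μ) := by
  obtain ⟨hsmooth, hf4, hrec⟩ := hf
  induction n using Nat.strong_induction_on with
  | _ m ih =>
  intro hm_even hm4
  rcases hm4.eq_or_lt with rfl | hm4
  · refine ⟨C (1 / 3) * X + C ((1 + β) / 3) * X ^ 2, ⟨?_, ?_, ?_, ?_, ?_⟩, ?_⟩
    · refine le_trans (b := 2) ?_ (by norm_num)
      compute_degree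
    · simp
    · intro k
      have : 0 ≤ (1 + β) / 3 := by positivity
      simp only [coeff_add, coeff_C_mul, coeff_X, coeff_X_pow]
      split_ifs <;> linarith
    · simp only [eval_add, eval_mul, eval_C, eval_X, eval_pow]
      linarith
    · simp only [eval_add, eval_mul, eval_C, eval_X, eval_pow]
      norm_num
      linarith
    · intro μ hμ
      rw [hf4 μ hμ, hf2, deriv_const_add, hode μ hμ]
      simp only [eval_add, eval_mul, eval_C, eval_X, eval_pow]
      ring
  · obtain ⟨n, rfl⟩ : ∃ n, m = n + 2 := ⟨m - 2, by omega⟩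
    have hn_even : Even n := by simpa [Nat.even_add] using hm_even
    have hn4 : 4 ≤ n := by
      obtain ⟨k, rfl⟩ := hn_even
      omega
    choose! q hq hqf using ih
    have hQ := hq n (by omega) hn_even hn4
    have hQf := hqf n (by omega) hn_even hn4
    have hpair : ∀ k, Even k ∧ 4 ≤ k ∧ k + 2 ≤ n →
        (k < n + 2 ∧ Even k ∧ 4 ≤ k) ∧
        (n + 2 - k < n + 2 ∧ Even (n + 2 - k) ∧ 4 ≤ n + 2 - k) := by
      rintro k ⟨hk, hk4, hkn⟩
      exact ⟨⟨by omega, hk, hk4⟩, by omega, hm_even.tsub hk, by omega⟩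
    set S : ℝ[X] := ∑ k ∈ Finset.range (n + 3),
      if Even k ∧ 4 ≤ k ∧ k + 2 ≤ n then q k * q (n + 2 - k) else 0 with hS
    have hS_deg : S.natDegree ≤ n + 1 := by
      refine natDegree_sum_le_of_forall_le _ _ fun k _ => ?_
      split_ifs with hk
      · obtain ⟨⟨h1, h2, h3⟩, h4, h5, h6⟩ := hpair k hk
        have h7 := (hq k h1 h2 h3).natDegree_le
        have h8 := (hq _ h4 h5 h6).natDegree_le
        have h9 := natDegree_mul_le (p := q k) (q := q (n + 2 - k))
        omega
      · simp
    have hS_zero : S.coeff 0 = 0 := by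
      rw [hS, finsetSum_coeff]
      refine Finset.sum_eq_zero fun k _ => ?_
      split_ifs with hk
      · obtain ⟨⟨h1, h2, h3⟩, -⟩ := hpair k hk
        rw [mul_coeff_zero, (hq k h1 h2 h3).coeff_zero, zero_mul]
      · simp
    have hS_nonneg : ∀ j, 0 ≤ S.coeff j := by
      intro j
      rw [hS, finsetSum_coeff]
      refine Finset.sum_nonneg fun k _ => ?_
      split_ifs with hk
      · obtain ⟨⟨h1, h2, h3⟩, h4, h5, h6⟩ := hpair k hk
        exact coeff_nonneg_mul (hq k h1 h2 h3).coeff_nonneg (hq _ h4 h5 h6).coeff_nonneg j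
      · simp
    have hS_eval_nonneg : 0 ≤ S.eval 1 := by
      rw [eval_one_eq_sum le_rfl]
      exact Finset.sum_nonneg fun i _ => hS_nonneg i
    have hS_eval_le : S.eval 1 ≤ (n + 3) * 4 ^ (n - 2) := by
      rw [hS, eval_finsetSum]
      refine (Finset.sum_le_card_nsmul _ _ ((4 : ℝ) ^ (n - 2)) fun k _ => ?_).trans ?_
      · split_ifs with hk
        · obtain ⟨⟨h1, h2, h3⟩, h4, h5, h6⟩ := hpair k hk
          have hexp : n - 2 = (k - 2) + (n + 2 - k - 2) := by omega
          rw [eval_mul, hexp, pow_add]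
          exact mul_le_mul (hq k h1 h2 h3).eval_le (hq _ h4 h5 h6).eval_le
            (hq _ h4 h5 h6).eval_pos.le (by positivity)
        · simp
      · simp
    have hS_eval : ∀ μ ∈ Set.Icc (0 : ℝ) μmax, mfPairSum f n μ = S.eval (δ μ) := by
      intro μ hμ
      rw [hS, eval_finsetSum, mfPairSum]
      refine Finset.sum_congr rfl fun k _ => ?_
      split_ifs with hk
      · obtain ⟨⟨h1, h2, h3⟩, h4, h5, h6⟩ := hpair k hk
        rw [eval_mul, hqf k h1 h2 h3 μ hμ, hqf _ h4 h5 h6 μ hμ]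
      · simp
    have hD := hQ.riccatiDeriv hβ0 hβ1.le
    have hDf := deriv_eq_eval_riccatiDeriv hμmax hδ hode
      ((hsmooth n).differentiable (by simp)) hQf
    have hn0 : (4 : ℝ) ≤ n := by exact_mod_cast hn4
    have hn1 : (0 : ℝ) < n + 1 := by linarith
    have hfrac : 4 / (n : ℝ) ≤ 1 := by rw [div_le_one (by linarith)]; exact hn0
    have hfrac0 : 0 ≤ 4 / (n : ℝ) := by positivity
    have ha : 0 < 1 / ((n : ℝ) + 1) := by positivity
    have hb : 0 < 1 / ((n : ℝ) + 1) * (3 - 4 / n) := mul_pos ha (by linarith)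
    have hc : 0 < 2 / ((n : ℝ) + 1) := by positivity
    have hd : 0 < 2 / ((n : ℝ) * (n + 1)) := by positivity
    have hA := hQ.eval_le
    have hA0 := hQ.eval_pos
    have hB := hD.eval_le
    have hB0 := hD.eval_pos
    refine ⟨C (1 / ((n : ℝ) + 1)) * S + C (1 / ((n : ℝ) + 1) * (3 - 4 / n)) * q n
      + C (2 / ((n : ℝ) + 1)) * (X ^ 1 * q n)
      + C (2 / ((n : ℝ) * (n + 1))) * riccatiDeriv β (q n), ⟨?_, ?_, ?_, ?_, ?_⟩, ?_⟩
    · have h1 := hQ.natDegree_le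
      have h2 := hD.natDegree_le
      have h3 := natDegree_mul_le (p := (X : ℝ[X]) ^ 1) (q := q n)
      rw [natDegree_X_pow] at h3
      refine natDegree_add_le_of_degree_le (natDegree_add_le_of_degree_le
        (natDegree_add_le_of_degree_le ?_ ?_) ?_) ?_ <;>
      refine (natDegree_C_mul_le _ _).trans ?_ <;> omega
    · simp [hS_zero, hQ.coeff_zero, hD.coeff_zero]
    · intro k
      simp only [coeff_add]
      have h1 := coeff_nonneg_C_mul ha.le hS_nonneg k
      have h2 := coeff_nonneg_C_mul hb.le hQ.coeff_nonneg k
      have h3 := coeff_nonneg_C_mul hc.le (coeff_nonneg_X_pow_mul 1 hQ.coeff_nonneg) k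
      have h4 := coeff_nonneg_C_mul hd.le hD.coeff_nonneg k
      linarith
    · simp only [eval_add, eval_mul, eval_C, eval_pow, eval_X, one_pow, one_mul]
      have h1 := mul_nonneg ha.le hS_eval_nonneg
      have h2 := mul_pos hb hA0
      have h3 := mul_pos hc hA0
      have h4 := mul_pos hd hB0
      linarith
    · simp only [eval_add, eval_mul, eval_C, eval_pow, eval_X, one_pow, one_mul]
      have hexp : n + 2 - 2 = (n - 2) + 2 := by omega
      rw [hexp, pow_add]
      set P : ℝ := 4 ^ (n - 2)
      have hP : 0 < P := by positivity
      have hB' : (riccatiDeriv β (q n)).eval 1 ≤ n * P := by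
        refine hB.trans (mul_le_mul_of_nonneg_right ?_ hP.le)
        exact_mod_cast Nat.sub_le n 1
      have h1 := mul_le_mul_of_nonneg_left hS_eval_le ha.le
      have h2 : 1 / ((n : ℝ) + 1) * (3 - 4 / n) * (q n).eval 1 ≤ 1 / ((n : ℝ) + 1) * 3 * P := by
        refine mul_le_mul (mul_le_mul_of_nonneg_left (by linarith) ha.le) hA hA0.le (by positivity)
      have h3 := mul_le_mul_of_nonneg_left hA hc.le
      have h4 := mul_le_mul_of_nonneg_left hB' hd.le
      have h5 : 1 / ((n : ℝ) + 1) * ((n + 3) * P) + 1 / ((n : ℝ) + 1) * 3 * P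
          + 2 / ((n : ℝ) + 1) * P + 2 / ((n : ℝ) * (n + 1)) * (n * P)
          = (n + 10) / (n + 1) * P := by
        field_simp
        ring
      have h6 : ((n : ℝ) + 10) / (n + 1) ≤ 4 ^ 2 := by
        rw [div_le_iff₀ hn1]
        linarith
      have h7 := mul_le_mul_of_nonneg_right h6 hP.le
      linarith
    · intro μ hμ
      rw [hrec n hn_even hn4 μ hμ, hS_eval μ hμ, hQf μ hμ, hDf μ hμ, hf2]
      simp only [eval_add, eval_mul, eval_C, eval_pow, eval_X]
      ring

end PolynomialLemmas

/-- positivity and bounds (with `K = 4`) for the mean field hierarchy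
generated by `f₂ = 1 + δ` with `δ′ = β·δ²` and `0 < δ < 1`. -/
theorem stmt2 (μmax β : ℝ) (hμmax : 0 < μmax) (hβ0 : 0 < β) (hβ1 : β < 1)
    (δ : ℝ → ℝ) (hδsmooth : ContDiff ℝ (⊤ : ℕ∞) δ)
    (hδode : ∀ μ ∈ Set.Icc (0 : ℝ) μmax, deriv δ μ = β * δ μ ^ 2)
    (hδrange : ∀ μ ∈ Set.Icc (0 : ℝ) μmax, 0 < δ μ ∧ δ μ < 1)
    (f : ℕ → ℝ → ℝ) (hf : MeanFieldHierarchy μmax f)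
    (hf2 : f 2 = fun μ => 1 + δ μ) :
    ∀ n l : ℕ, Even n → 4 ≤ n → ∀ μ ∈ Set.Icc (0 : ℝ) μmax,
      0 < iteratedDeriv l (f n) μ ∧
      iteratedDeriv l (f n) μ ≤
        δ μ * ((4 : ℝ) ^ (n + l - 2) / ((l : ℝ) + 1) ^ 2) *
          (((n + l - 2).factorial : ℝ) / ((n - 2).factorial : ℝ)) := by
  intro n l hn hn4 μ hμ
  have hδ : Differentiable ℝ δ := hδsmooth.differentiable (by simp)
  obtain ⟨q, hq, hqf⟩ :=
    exists_posPoly_of_meanFieldHierarchy hμmax hβ0 hβ1 hδ hδode hf hf2 n hn hn4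
  obtain ⟨hδ0, hδ1⟩ := hδrange μ hμ
  have hql := hq.iterate_riccatiDeriv hβ0 hβ1.le l
  rw [iteratedDeriv_eq_eval_riccatiDeriv hμmax hδ hδode (hf.1 n) hqf l μ hμ]
  refine ⟨hql.eval_pos_of_pos hδ0 hδ1.le, (hql.eval_le_mul hδ0.le hδ1.le).trans ?_⟩
  obtain ⟨N, rfl⟩ : ∃ N, n = N + 2 := ⟨n - 2, by omega⟩
  have e1 : N + 2 + l - 2 = N + l := by omega
  have e2 : N + 2 - 1 = N + 1 := by omega
  rw [e1, e2, Nat.add_sub_cancel, ← Nat.factorial_mul_ascFactorial, Nat.cast_mul,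
    mul_div_cancel_left₀ _ (by exact_mod_cast N.factorial_ne_zero), mul_assoc]
  have hpow : (4 : ℝ) ^ N ≤ 4 ^ (N + l) / ((l : ℝ) + 1) ^ 2 := by
    rw [le_div_iff₀ (by positivity), pow_add]
    have h : (l : ℝ) + 1 ≤ 2 ^ l := by exact_mod_cast Nat.lt_two_pow_self
    have h4 : (4 : ℝ) ^ l = (2 ^ l) ^ 2 := by rw [← pow_mul, mul_comm, pow_mul]; norm_num
    rw [h4]
    gcongr
  gcongr
end

section
/- There exists ε₀ > 0 such that for every 0 < ε ≤ ε₀ there exists ε′ with 0 < ε′ ≤ ε with the following property: if real numbers a(n,l), for even n ≥ 2 and integers l ≥ 0, satisfy the sine-resummed mean field recursion, and if |a(2,l)| ≤ B(2)·((2+l)!/2!)·(ε′)^{l+1} for all l ≥ 0, then |a(n,l)| ≤ B(n)·((n+l)!/n!)·ε^{l+1} for all even n ≥ 2 and all l ≥ 0. -/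
noncomputable section

/-- `c = 1/(16π²)`. -/
def mfc : ℝ := 1 / (16 * Real.pi ^ 2)

/-- Exponent entering the weight `B(n)`: `1/4` for the primes 2 and 3, `1/2` for 5,
and `9/8` for every prime `p ≥ 7`. -/
def Bexp (p : ℕ) : ℝ := if p ≤ 3 then 1 / 4 else if p = 5 then 1 / 2 else 9 / 8

/-- The weight `B(n) = 2^{−p₂(n)/4}·3^{−p₃(n)/4}·5^{−p₅(n)/2}·∏_{p ≥ 7} p^{−(9/8)p_p(n)}`,
defined through the prime factorization of `n`. -/
def Bweight (n : ℕ) : ℝ :=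
  n.factorization.prod fun p k => (p : ℝ) ^ (-(Bexp p * (k : ℝ)))

/-- Sum over pairs `(ν, n′)` with `ν ≥ 1`, `n′` even positive and `(1+2ν)·n′ = N`. -/
def divSum1 (N : ℕ) (g : ℕ → ℕ → ℝ) : ℝ :=
  ∑ ν ∈ Finset.range (N + 1), ∑ n' ∈ Finset.range (N + 1),
    if 1 ≤ ν ∧ Even n' ∧ 2 ≤ n' ∧ (1 + 2 * ν) * n' = N then g ν n' else 0

/-- Sum over pairs `(ν, n′)` with `ν ≥ 0`, `n′` even positive and `(1+2ν)·n′ = N`. -/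
def divSum0 (N : ℕ) (g : ℕ → ℕ → ℝ) : ℝ :=
  ∑ ν ∈ Finset.range (N + 1), ∑ n' ∈ Finset.range (N + 1),
    if Even n' ∧ 2 ≤ n' ∧ (1 + 2 * ν) * n' = N then g ν n' else 0

/-- The sine-resummed mean field recursion for the numbers `a(n,l)`
(`n` even `≥ 2`, `l ≥ 0`). -/
def SineMFRecursion (a : ℕ → ℕ → ℝ) : Prop :=
  (∀ l : ℕ, a 4 l = (1 / (3 * mfc)) *
      ((∑ j ∈ Finset.range (l + 1), (l.choose j : ℝ) * a 2 j * a 2 (l - j))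
        - a 2 l + a 2 (l + 1))) ∧
  (∀ n l : ℕ, Even n → 4 ≤ n →
    a (n + 2) l =
      (1 / ((n : ℝ) + 1)) * divSum1 (n + 2) (fun ν n' =>
        ((n' : ℝ) - 1) * ((-1 : ℝ) ^ (ν - 1) / ((2 * ν).factorial : ℝ)) * a n' l)
      + (1 / ((n : ℝ) + 1)) * divSum1 (n + 2) (fun ν n' =>
        (n' : ℝ) * ((-1 : ℝ) ^ (ν - 1) / ((2 * ν - 1).factorial : ℝ)) * a n' l)
      + (1 / (((n : ℝ) + 1) * mfc)) *
        (∑ n₁ ∈ Finset.range (n + 1),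
          if Even n₁ ∧ 2 ≤ n₁ then
            divSum0 n₁ (fun ν₁ n' =>
              divSum0 (n + 2 - n₁) (fun ν₂ n'' =>
                ∑ l₁ ∈ Finset.range (l + 1),
                  (l.choose l₁ : ℝ) * (-1 : ℝ) ^ (ν₁ + ν₂) *
                    ((1 + 2 * (ν₁ : ℝ)) * (1 + 2 * (ν₂ : ℝ)) /
                      (((2 * ν₁).factorial : ℝ) * ((2 * ν₂).factorial : ℝ))) *
                    a n' l₁ * a n'' (l - l₁)))
          else 0)
      + (((n : ℝ) - 4) / ((n : ℝ) * ((n : ℝ) + 1) * mfc)) * a n l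
      + (2 / (((n : ℝ) + 1) * mfc)) * divSum1 n (fun ν n' =>
        (((n' : ℝ) - 4) / (2 * (n' : ℝ))) * ((-1 : ℝ) ^ ν / ((2 * ν + 1).factorial : ℝ))
          * a n' l)
      + (2 / ((n : ℝ) * ((n : ℝ) + 1) * mfc)) * a n (l + 1)
      + (2 / (((n : ℝ) + 1) * mfc)) * divSum1 n (fun ν n' =>
        (1 / (n' : ℝ)) * ((-1 : ℝ) ^ ν / ((2 * ν + 1).factorial : ℝ)) * a n' (l + 1))
      + (2 / (((n : ℝ) + 1) * mfc)) * divSum1 n (fun ν n' =>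
        (-1 : ℝ) ^ ν * ((ν : ℝ) / ((2 * ν + 1).factorial : ℝ)) * a n' l))

lemma Bweight_pos (n : ℕ) : 0 < Bweight n :=
  Finset.prod_pos fun _ hp =>
    Real.rpow_pos_of_pos (Nat.cast_pos.2 (Nat.prime_of_mem_primeFactors hp).pos) _

lemma Bweight_one : Bweight 1 = 1 := by simp [Bweight]

lemma Bweight_mul {m n : ℕ} (hm : m ≠ 0) (hn : n ≠ 0) :
    Bweight (m * n) = Bweight m * Bweight n := by
  unfold Bweight
  rw [Nat.factorization_mul hm hn]
  refine Finsupp.prod_add_index (fun _ _ => by simp) fun p hp k₁ k₂ => ?_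
  have hp : 0 < p := by
    rcases Finset.mem_union.1 hp with h | h <;> exact (Nat.prime_of_mem_primeFactors h).pos
  rw [← Real.rpow_add (Nat.cast_pos.2 hp)]
  congr 1
  push_cast
  ring

lemma Bweight_prime {p : ℕ} (hp : p.Prime) : Bweight p = (p : ℝ) ^ (-Bexp p) := by
  simp [Bweight, hp.factorization]

lemma Bexp_le (p : ℕ) : Bexp p ≤ 9 / 8 := by
  unfold Bexp; split_ifs <;> norm_num

lemma le_Bexp (p : ℕ) : 1 / 4 ≤ Bexp p := by
  unfold Bexp; split_ifs <;> norm_num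

lemma rpow_le_Bweight {n : ℕ} (hn : n ≠ 0) : (n : ℝ) ^ (-(9 / 8) : ℝ) ≤ Bweight n := by
  induction n using induction_on_primes with
  | zero => exact absurd rfl hn
  | one => simp [Bweight_one]
  | prime_mul p a hp ih =>
    have ha : a ≠ 0 := right_ne_zero_of_mul hn
    rw [Bweight_mul hp.ne_zero ha, Bweight_prime hp, Nat.cast_mul,
      Real.mul_rpow (Nat.cast_nonneg _) (Nat.cast_nonneg _)]
    have hp1 : (1 : ℝ) ≤ p := Nat.one_le_cast.2 hp.one_le
    gcongr
    · exact Bexp_le p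
    · exact ih ha

lemma Bweight_le_rpow {n : ℕ} (hn : n ≠ 0) : Bweight n ≤ (n : ℝ) ^ (-(1 / 4) : ℝ) := by
  induction n using induction_on_primes with
  | zero => exact absurd rfl hn
  | one => simp [Bweight_one]
  | prime_mul p a hp ih =>
    have ha : a ≠ 0 := right_ne_zero_of_mul hn
    rw [Bweight_mul hp.ne_zero ha, Bweight_prime hp, Nat.cast_mul,
      Real.mul_rpow (Nat.cast_nonneg _) (Nat.cast_nonneg _)]
    have hp1 : (1 : ℝ) ≤ p := Nat.one_le_cast.2 hp.one_le
    have := (Bweight_pos a).le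
    gcongr
    · exact le_Bexp p
    · exact ih ha

lemma Bweight_pow {n : ℕ} (hn : n ≠ 0) (k : ℕ) : Bweight (n ^ k) = Bweight n ^ k := by
  induction k with
  | zero => simp [Bweight_one]
  | succ k ih => rw [pow_succ, Bweight_mul (pow_ne_zero _ hn) hn, ih, pow_succ]

lemma Bweight_eq_rpow_of_not_dvd {n : ℕ} (h2 : ¬ 2 ∣ n) (h3 : ¬ 3 ∣ n) (h5 : ¬ 5 ∣ n) :
    Bweight n = (n : ℝ) ^ (-(9 / 8) : ℝ) := by
  induction n using induction_on_primes with
  | zero => simp at h2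
  | one => simp [Bweight_one]
  | prime_mul p a hp ih =>
    have ha : a ≠ 0 := by rintro rfl; simp at h2
    rw [Bweight_mul hp.ne_zero ha, Bweight_prime hp, Nat.cast_mul,
      Real.mul_rpow (Nat.cast_nonneg _) (Nat.cast_nonneg _),
      ih (fun h => h2 (h.mul_left _)) (fun h => h3 (h.mul_left _)) (fun h => h5 (h.mul_left _))]
    have h5' : p ≠ 5 := by rintro rfl; exact h5 (dvd_mul_right _ _)
    have h3' : ¬ p ≤ 3 := by
      intro h
      have := hp.two_le
      interval_cases p
      · exact h2 (dvd_mul_right _ _)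
      · exact h3 (dvd_mul_right _ _)
    simp [Bexp, h5', h3']

lemma Bweight_prime_lt_one {p : ℕ} (hp : p.Prime) : Bweight p < 1 := by
  rw [Bweight_prime hp]
  exact Real.rpow_lt_one_of_one_lt_of_neg (Nat.one_lt_cast.2 hp.one_lt)
    (by have := le_Bexp p; linarith)

lemma exists_eq_pow_two_three_five_mul {n : ℕ} (hn : n ≠ 0) :
    ∃ q : ((ℕ × ℕ) × ℕ) × ℕ, n = 2 ^ q.1.1.1 * 3 ^ q.1.1.2 * 5 ^ q.1.2 * q.2 ∧
      ¬ 2 ∣ q.2 ∧ ¬ 3 ∣ q.2 ∧ ¬ 5 ∣ q.2 := by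
  obtain ⟨i, u, hu, rfl⟩ := Nat.exists_eq_pow_mul_and_not_dvd hn 2 (by norm_num)
  have hu0 : u ≠ 0 := by rintro rfl; simp at hu
  obtain ⟨j, v, hv, rfl⟩ := Nat.exists_eq_pow_mul_and_not_dvd hu0 3 (by norm_num)
  have hv0 : v ≠ 0 := by rintro rfl; simp at hv
  obtain ⟨k, w, hw, rfl⟩ := Nat.exists_eq_pow_mul_and_not_dvd hv0 5 (by norm_num)
  exact ⟨(((i, j), k), w), by ring, fun h => hu ((h.mul_left _).mul_left _),
    fun h => hv (h.mul_left _), hw⟩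

lemma summable_Bweight : Summable Bweight := by
  rw [← summable_nat_add_iff 1]
  choose q hq h2 h3 h5 using fun n : ℕ => exists_eq_pow_two_three_five_mul n.succ_ne_zero
  have hinj : Function.Injective q := fun m n h => by
    have := hq m
    rw [h, ← hq n] at this
    omega
  have geom : ∀ p : ℕ, p.Prime → Summable fun k : ℕ => Bweight p ^ k := fun p hp =>
    summable_geometric_of_lt_one (Bweight_pos p).le (Bweight_prime_lt_one hp)
  have nng : ∀ p : ℕ, 0 ≤ fun k : ℕ => Bweight p ^ k := fun p k => pow_nonneg (Bweight_pos p).le k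
  have hz : Summable fun m : ℕ => (m : ℝ) ^ (-(9 / 8) : ℝ) :=
    Real.summable_nat_rpow.2 (by norm_num)
  have h23 := (geom 2 Nat.prime_two).mul_of_nonneg (geom 3 Nat.prime_three) (nng 2) (nng 3)
  have h235 := h23.mul_of_nonneg (geom 5 Nat.prime_five)
    (fun x => mul_nonneg (nng 2 _) (nng 3 _)) (nng 5)
  have hall := h235.mul_of_nonneg hz
    (fun x => mul_nonneg (mul_nonneg (nng 2 _) (nng 3 _)) (nng 5 _))
    (fun m => Real.rpow_nonneg (Nat.cast_nonneg _) _)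
  refine (hall.comp_injective hinj).congr fun n => ?_
  have hw : (q n).2 ≠ 0 := by intro h; simpa [h] using h2 n
  simp only [Function.comp]
  rw [← Bweight_eq_rpow_of_not_dvd (h2 n) (h3 n) (h5 n), ← Bweight_pow two_ne_zero,
    ← Bweight_pow three_ne_zero, ← Bweight_pow (by norm_num : (5 : ℕ) ≠ 0),
    ← Bweight_mul (by positivity) (by positivity), ← Bweight_mul (by positivity) (by positivity),
    ← Bweight_mul (by positivity) hw, ← hq n]

lemma sum_choose_mul_ascFactorial (x y l : ℕ) :
    ∑ j ∈ Finset.range (l + 1), (l.choose j : ℝ) * x.ascFactorial j * y.ascFactorial (l - j) =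
      (x + y).ascFactorial l := by
  induction l with
  | zero => simp
  | succ l ih =>
    have := Finset.sum_choose_succ_mul
      (fun i j => (x.ascFactorial i : ℝ) * y.ascFactorial j) l
    simp only [← mul_assoc] at this
    rw [this, ← Finset.sum_add_distrib, Nat.ascFactorial_succ, Nat.cast_mul, ← ih, Finset.mul_sum]
    refine Finset.sum_congr rfl fun j hj => ?_
    have hj : j ≤ l := Nat.lt_succ_iff.1 (Finset.mem_range.1 hj)
    rw [Nat.succ_sub hj, Nat.ascFactorial_succ, Nat.ascFactorial_succ]
    push_cast [Nat.cast_sub hj]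
    ring

lemma abs_divSum0_le {N : ℕ} {g : ℕ → ℕ → ℝ} {h : ℕ → ℝ} (h0 : ∀ ν, 0 ≤ h ν)
    (hg : ∀ ν m, Even m → 2 ≤ m → (1 + 2 * ν) * m = N → |g ν m| ≤ h ν) :
    |divSum0 N g| ≤ ∑ ν ∈ Finset.range (N + 1), h ν := by
  refine (Finset.abs_sum_le_sum_abs _ _).trans (Finset.sum_le_sum fun ν _ => ?_)
  by_cases hN : (1 + 2 * ν) ∣ N
  · obtain ⟨m, rfl⟩ := hN
    rw [Finset.sum_eq_single m]
    · split_ifs with hm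
      · exact hg ν m hm.1 hm.2.1 rfl
      · simpa using h0 ν
    · intro b _ hb
      refine if_neg fun hm => hb ?_
      exact Nat.eq_of_mul_eq_mul_left (by omega) hm.2.2
    · intro hm
      refine if_neg fun h => hm (Finset.mem_range.2 ?_)
      nlinarith
  · rw [Finset.sum_eq_zero]
    · simpa using h0 ν
    · intro m _
      exact if_neg fun hm => hN ⟨m, hm.2.2.symm⟩

lemma abs_divSum1_le {N : ℕ} {g : ℕ → ℕ → ℝ} {h : ℕ → ℝ} (h0 : ∀ ν, 0 ≤ h ν)
    (hg : ∀ ν m, 1 ≤ ν → Even m → 2 ≤ m → (1 + 2 * ν) * m = N → |g ν m| ≤ h ν) :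
    |divSum1 N g| ≤ ∑ ν ∈ Finset.Icc 1 N, h ν := by
  have heq : divSum1 N g = divSum0 N fun ν m => if 1 ≤ ν then g ν m else 0 := by
    refine Finset.sum_congr rfl fun ν _ => Finset.sum_congr rfl fun m _ => ?_
    by_cases hν : 1 ≤ ν <;> simp [hν]
  have hsum : ∑ ν ∈ Finset.Icc 1 N, h ν =
      ∑ ν ∈ Finset.range (N + 1), if 1 ≤ ν then h ν else 0 := by
    rw [← Finset.sum_filter]
    congr 1
    ext ν
    simp
    omega
  rw [heq, hsum]
  refine abs_divSum0_le (fun ν => ?_) fun ν m hm h2 hN => ?_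
  · split_ifs
    exacts [h0 ν, le_rfl]
  · split_ifs with hν
    exacts [hg ν m hν hm h2 hN, by simp]

lemma inv_Bweight_le {m : ℕ} (hm : m ≠ 0) : (Bweight m)⁻¹ ≤ (m : ℝ) ^ 2 := by
  have h1 : (1 : ℝ) ≤ m := Nat.one_le_cast.2 (Nat.pos_of_ne_zero hm)
  rw [← Real.rpow_natCast, ← inv_inv ((m : ℝ) ^ _), ← Real.rpow_neg (by positivity)]
  refine inv_anti₀ (by positivity) (le_trans ?_ (rpow_le_Bweight hm))
  exact Real.rpow_le_rpow_of_exponent_le h1 (by norm_num)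

lemma sq_mul_two_pow_le_factorial (k : ℕ) :
    (2 * k + 7) ^ 2 * 720 * 2 ^ k ≤ 49 * (2 * (k + 3)).factorial := by
  induction k with
  | zero => simp [Nat.factorial]
  | succ k ih =>
    have h : (2 * (k + 1 + 3)).factorial =
        (2 * k + 8) * ((2 * k + 7) * (2 * (k + 3)).factorial) := by
      rw [show 2 * (k + 1 + 3) = 2 * (k + 3) + 1 + 1 by ring, Nat.factorial_succ,
        Nat.factorial_succ]
      ring
    rw [h]
    calc (2 * (k + 1) + 7) ^ 2 * 720 * 2 ^ (k + 1)
        = 2 * (2 * k + 9) ^ 2 * (720 * 2 ^ k) := by ring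
      _ ≤ (2 * k + 8) * (2 * k + 7) * (2 * k + 7) ^ 2 * (720 * 2 ^ k) := by
          gcongr ?_ * _
          nlinarith [Nat.zero_le k, Nat.zero_le (k ^ 2), Nat.zero_le (k ^ 3), Nat.zero_le (k ^ 4)]
      _ = (2 * k + 8) * (2 * k + 7) * ((2 * k + 7) ^ 2 * 720 * 2 ^ k) := by ring
      _ ≤ (2 * k + 8) * (2 * k + 7) * (49 * (2 * (k + 3)).factorial) := by gcongr
      _ = _ := by ring

lemma cube_mul_two_pow_le_factorial (k : ℕ) :
    (1 + 2 * k) ^ 3 * 2 ^ k ≤ 27 * (2 * k).factorial := by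
  rcases k with _ | k
  · simp
  induction k with
  | zero => simp [Nat.factorial]
  | succ k ih =>
    have h : (2 * (k + 1 + 1)).factorial =
        (2 * k + 4) * ((2 * k + 3) * (2 * (k + 1)).factorial) := by
      rw [show 2 * (k + 1 + 1) = 2 * (k + 1) + 1 + 1 by ring, Nat.factorial_succ,
        Nat.factorial_succ]
      ring
    rw [h]
    calc (1 + 2 * (k + 1 + 1)) ^ 3 * 2 ^ (k + 1 + 1)
        = 2 * (2 * k + 5) ^ 3 * 2 ^ (k + 1) := by ring
      _ ≤ (2 * k + 4) * (2 * k + 3) * (2 * k + 3) ^ 3 * 2 ^ (k + 1) := by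
          gcongr ?_ * _
          ring_nf
          nlinarith [Nat.zero_le k, Nat.zero_le (k ^ 2), Nat.zero_le (k ^ 3), Nat.zero_le (k ^ 4)]
      _ = (2 * k + 4) * (2 * k + 3) * ((1 + 2 * (k + 1)) ^ 3 * 2 ^ (k + 1)) := by ring
      _ ≤ (2 * k + 4) * (2 * k + 3) * (27 * (2 * (k + 1)).factorial) := by gcongr
      _ = _ := by ring

lemma sum_inv_factorial_div_Bweight_le (N : ℕ) :
    ∑ ν ∈ Finset.Icc 1 N, (Bweight (1 + 2 * ν))⁻¹ / (2 * ν).factorial ≤ 9 / 10 := by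
  have h3 : (Bweight 3)⁻¹ ≤ 1.32 := by
    rw [Bweight_prime Nat.prime_three, Real.rpow_neg (by norm_num), inv_inv]
    have : Bexp 3 = 1 / 4 := by norm_num [Bexp]
    rw [this, one_div, Real.rpow_inv_le_iff_of_pos] <;> norm_num
  have h5 : (Bweight 5)⁻¹ ≤ 2.25 := by
    rw [Bweight_prime Nat.prime_five, Real.rpow_neg (by norm_num), inv_inv]
    have : Bexp 5 = 1 / 2 := by norm_num [Bexp]
    rw [this, one_div, Real.rpow_inv_le_iff_of_pos] <;> norm_num
  have key : ∀ k : ℕ, ∑ ν ∈ Finset.Icc 1 (k + 2), (Bweight (1 + 2 * ν))⁻¹ / (2 * ν).factorial ≤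
      9 / 10 - 49 / 360 * (1 / 2) ^ k := by
    intro k
    induction k with
    | zero =>
      simp only [zero_add, Finset.sum_Icc_succ_top (show 1 ≤ 1 + 1 by norm_num), Finset.Icc_self,
        Finset.sum_singleton]
      norm_num [Nat.factorial] at h3 h5 ⊢
      linarith
    | succ k ih =>
      rw [show k + 1 + 2 = k + 2 + 1 by ring, Finset.sum_Icc_succ_top (by omega)]
      have hterm : (Bweight (1 + 2 * (k + 2 + 1)))⁻¹ / (2 * (k + 2 + 1)).factorial ≤
          49 / 720 * (1 / 2) ^ k := by
        rw [div_le_iff₀ (by positivity)]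
        refine (inv_Bweight_le (by omega)).trans ?_
        have := sq_mul_two_pow_le_factorial k
        have hr : ((2 * k + 7 : ℝ)) ^ 2 * 720 * 2 ^ k ≤ 49 * (2 * (k + 3)).factorial := by
          exact_mod_cast this
        rw [one_div, inv_pow, ← div_eq_mul_inv, div_div, div_mul_eq_mul_div,
          le_div_iff₀ (by positivity)]
        push_cast
        calc _ = ((2 * k + 7 : ℝ)) ^ 2 * 720 * 2 ^ k := by ring
          _ ≤ _ := hr
      rw [pow_succ]
      linarith
  refine le_trans (Finset.sum_le_sum_of_subset_of_nonneg
    (Finset.Icc_subset_Icc_right (Nat.le_add_right N 2)) fun ν _ _ => ?_) ((key N).trans ?_)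
  · have := Bweight_pos (1 + 2 * ν)
    positivity
  · have : (0 : ℝ) < (1 / 2) ^ N := by positivity
    linarith

lemma sum_mul_inv_factorial_div_Bweight_le (N : ℕ) :
    ∑ ν ∈ Finset.range (N + 1), (1 + 2 * (ν : ℝ)) * ((Bweight (1 + 2 * ν))⁻¹ / (2 * ν).factorial) ≤
      54 := by
  have hterm : ∀ ν : ℕ, (1 + 2 * (ν : ℝ)) * ((Bweight (1 + 2 * ν))⁻¹ / (2 * ν).factorial) ≤
      27 * (1 / 2) ^ ν := by
    intro ν
    have hr : (1 + 2 * ν : ℝ) ^ 3 * 2 ^ ν ≤ 27 * (2 * ν).factorial := by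
      exact_mod_cast cube_mul_two_pow_le_factorial ν
    have hB := inv_Bweight_le (m := 1 + 2 * ν) (by omega)
    push_cast at hB
    rw [← mul_div_assoc, div_le_iff₀ (by positivity), one_div, inv_pow, ← div_eq_mul_inv 27,
      div_mul_eq_mul_div, le_div_iff₀ (by positivity)]
    refine le_trans ?_ hr
    rw [pow_succ' _ 2]
    gcongr
  refine (Finset.sum_le_sum fun ν _ => hterm ν).trans ?_
  rw [← Finset.mul_sum]
  have h : ∑ ν ∈ Finset.range (N + 1), (1 / 2 : ℝ) ^ ν ≤ 2 :=
    (summable_geometric_two.sum_le_tsum _ fun _ _ => by positivity).trans_eq tsum_geometric_two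
  linarith

lemma Bweight_mul_le {m n : ℕ} (hm : m ≠ 0) (hn : n ≠ 0) :
    Bweight m * Bweight n ≤
      2 * ((m + n : ℕ) : ℝ) ^ (-(1 / 4) : ℝ) * (Bweight m + Bweight n) := by
  wlog h : m ≤ n generalizing m n
  · rw [mul_comm, add_comm m, add_comm (Bweight m)]
    exact this hn hm (by omega)
  have hm0 := Bweight_pos m
  have hn0 := Bweight_pos n
  have hmn : (0 : ℝ) < (m + n : ℕ) := by positivity
  have h2 : (2 : ℝ)⁻¹ ^ (-(1 / 4) : ℝ) ≤ 2 := by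
    rw [Real.inv_rpow (by norm_num), ← Real.rpow_neg (by norm_num)]
    calc (2 : ℝ) ^ (- -(1 / 4) : ℝ) ≤ 2 ^ (1 : ℝ) :=
          Real.rpow_le_rpow_of_exponent_le (by norm_num) (by norm_num)
      _ = 2 := Real.rpow_one 2
  have hn1 : Bweight n ≤ 2 * ((m + n : ℕ) : ℝ) ^ (-(1 / 4) : ℝ) := by
    refine (Bweight_le_rpow hn).trans ?_
    calc (n : ℝ) ^ (-(1 / 4) : ℝ) ≤ (2⁻¹ * ((m + n : ℕ) : ℝ)) ^ (-(1 / 4) : ℝ) := by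
          refine Real.rpow_le_rpow_of_nonpos (by positivity) ?_ (by norm_num)
          have : (m : ℝ) ≤ n := Nat.cast_le.2 h
          push_cast
          linarith
      _ = 2⁻¹ ^ (-(1 / 4) : ℝ) * ((m + n : ℕ) : ℝ) ^ (-(1 / 4) : ℝ) :=
          Real.mul_rpow (by norm_num) hmn.le
      _ ≤ _ := by gcongr
  have : 0 < ((m + n : ℕ) : ℝ) ^ (-(1 / 4) : ℝ) := by positivity
  nlinarith

/-- The additive self-convolution of `Bweight` over even positive summands of `n + 2`. -/
def evenConv (n : ℕ) : ℝ :=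
  ∑ n₁ ∈ Finset.range (n + 1),
    if Even n₁ ∧ 2 ≤ n₁ then Bweight n₁ * Bweight (n + 2 - n₁) else 0

lemma evenConv_nonneg (n : ℕ) : 0 ≤ evenConv n :=
  Finset.sum_nonneg fun m _ => by
    split_ifs
    exacts [mul_nonneg (Bweight_pos _).le (Bweight_pos _).le, le_rfl]

lemma evenConv_le (n : ℕ) :
    evenConv n ≤ 4 * (∑' m, Bweight m) * ((n + 2 : ℕ) : ℝ) ^ (-(1 / 4) : ℝ) := by
  have hB := fun m => (Bweight_pos m).le
  have hS : ∑ m ∈ Finset.range (n + 3), Bweight m ≤ ∑' m, Bweight m :=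
    summable_Bweight.sum_le_tsum _ fun m _ => hB m
  calc evenConv n
      ≤ ∑ m ∈ Finset.range (n + 1), 2 * ((n + 2 : ℕ) : ℝ) ^ (-(1 / 4) : ℝ) *
          (Bweight m + Bweight (n + 2 - m)) := by
        refine Finset.sum_le_sum fun m hm => ?_
        have hm := Finset.mem_range.1 hm
        split_ifs with h
        · have := Bweight_mul_le (m := m) (n := n + 2 - m) (by omega) (by omega)
          rwa [Nat.add_sub_cancel' (by omega)] at this
        · have := hB m
          have := hB (n + 2 - m)
          positivity
    _ ≤ ∑ m ∈ Finset.range (n + 3), 2 * ((n + 2 : ℕ) : ℝ) ^ (-(1 / 4) : ℝ) *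
          (Bweight m + Bweight (n + 2 - m)) := by
        refine Finset.sum_le_sum_of_subset_of_nonneg
          (Finset.range_subset_range.2 (by omega)) fun m _ _ => ?_
        have := hB m
        have := hB (n + 2 - m)
        positivity
    _ = 2 * ((n + 2 : ℕ) : ℝ) ^ (-(1 / 4) : ℝ) * (2 * ∑ m ∈ Finset.range (n + 3), Bweight m) := by
        rw [← Finset.mul_sum, Finset.sum_add_distrib,
          show ∑ m ∈ Finset.range (n + 3), Bweight (n + 2 - m) = _ from
            Finset.sum_range_reflect Bweight (n + 3)]
        ring
    _ ≤ 2 * ((n + 2 : ℕ) : ℝ) ^ (-(1 / 4) : ℝ) * (2 * ∑' m, Bweight m) := by gcongr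
    _ = _ := by ring

lemma mfc_pos : 0 < mfc := by unfold mfc; positivity

lemma exists_forall_majorant_le (C : ℝ) (hC : 0 ≤ C) :
    ∃ N : ℕ, ∀ n : ℕ, N ≤ n →
      ((n : ℝ) + 2) / (n + 1) * (9 / 10) * Bweight (n + 2) +
        C / (n + 1) * (Bweight n + evenConv n) ≤ Bweight (n + 2) := by
  set S := ∑' m, Bweight m with hSdef
  have hS : 0 ≤ S := tsum_nonneg fun m => (Bweight_pos m).le
  have hlim : Filter.Tendsto (fun n : ℕ => (n : ℝ) ^ (1 / 8 : ℝ)) Filter.atTop Filter.atTop :=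
    (tendsto_rpow_atTop (by norm_num)).comp tendsto_natCast_atTop_atTop
  obtain ⟨N, hN⟩ := Filter.eventually_atTop.1
    (hlim.eventually_ge_atTop (40 * (C * (2 + 4 * S))))
  refine ⟨max N 20, fun n hn => ?_⟩
  have hn20 : 20 ≤ n := (le_max_right _ _).trans hn
  have hn20' : (20 : ℝ) ≤ n := by exact_mod_cast hn20
  have hNn := hN (n + 2) (by have := (le_max_left N 20).trans hn; omega)
  set x : ℝ := ((n + 2 : ℕ) : ℝ) with hx
  have hxn : x = n + 2 := by simp [hx]
  have hx0 : 0 < x := by positivity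
  have h1 : Bweight n ≤ 2 * x ^ (-(1 / 4) : ℝ) := by
    refine (Bweight_le_rpow (by omega)).trans ?_
    calc (n : ℝ) ^ (-(1 / 4) : ℝ) ≤ (2⁻¹ * x) ^ (-(1 / 4) : ℝ) := by
          refine Real.rpow_le_rpow_of_nonpos (by positivity) ?_ (by norm_num)
          linarith
      _ = 2⁻¹ ^ (-(1 / 4) : ℝ) * x ^ (-(1 / 4) : ℝ) := Real.mul_rpow (by norm_num) hx0.le
      _ ≤ _ := by
          gcongr
          rw [Real.inv_rpow (by norm_num), ← Real.rpow_neg (by norm_num)]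
          calc (2 : ℝ) ^ (- -(1 / 4) : ℝ) ≤ 2 ^ (1 : ℝ) :=
                Real.rpow_le_rpow_of_exponent_le (by norm_num) (by norm_num)
            _ = 2 := Real.rpow_one 2
  have h2 := evenConv_le n
  rw [← hSdef, ← hx] at h2
  have hB : x ^ (-(9 / 8) : ℝ) ≤ Bweight (n + 2) := rpow_le_Bweight (by omega)
  have hsplit : x ^ (-(1 / 4) : ℝ) = x ^ (-(9 / 8) : ℝ) * x / x ^ (1 / 8 : ℝ) := by
    rw [eq_div_iff (by positivity), ← Real.rpow_add hx0]
    nth_rw 3 [← Real.rpow_one x]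
    rw [← Real.rpow_add hx0]
    norm_num
  have hquad : C / (n + 1) * (Bweight n + evenConv n) ≤ 1 / 20 * Bweight (n + 2) := by
    have hy : 0 < x ^ (1 / 8 : ℝ) := by positivity
    have hz : 0 < x ^ (-(9 / 8) : ℝ) := by positivity
    calc C / (n + 1) * (Bweight n + evenConv n)
        ≤ C / (n + 1) * ((2 + 4 * S) * (x ^ (-(9 / 8) : ℝ) * x / x ^ (1 / 8 : ℝ))) := by
          rw [← hsplit]
          gcongr
          linarith
      _ = (C * (2 + 4 * S) / x ^ (1 / 8 : ℝ)) * (x / (n + 1)) * x ^ (-(9 / 8) : ℝ) := by ring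
      _ ≤ (1 / 40) * 2 * Bweight (n + 2) := by
          have hS' : 0 ≤ C * (2 + 4 * S) := by positivity
          have hc : C * (2 + 4 * S) / x ^ (1 / 8 : ℝ) ≤ 1 / 40 := by
            rw [div_le_iff₀ hy]
            linarith
          have hd : x / (n + 1) ≤ 2 := by
            rw [div_le_iff₀ (by positivity)]
            linarith
          exact mul_le_mul (mul_le_mul hc hd (by positivity) (by norm_num)) hB hz.le (by norm_num)
      _ = _ := by ring
  have hlin : ((n : ℝ) + 2) / (n + 1) * (9 / 10) ≤ 19 / 20 := by
    rw [div_mul_eq_mul_div, div_le_iff₀ (by positivity)]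
    linarith
  have := mul_le_mul_of_nonneg_right hlin (Bweight_pos (n + 2)).le
  linarith

lemma Bweight_eq_of_mul_eq {ν m N : ℕ} (hm : 2 ≤ m) (h : (1 + 2 * ν) * m = N) :
    Bweight m = (Bweight (1 + 2 * ν))⁻¹ * Bweight N := by
  rw [← h, Bweight_mul (by omega) (by omega), inv_mul_cancel_left₀ (Bweight_pos _).ne']

/-- The weight picked up by a term of the recursion through a divisor `1 + 2ν`. -/
def divWeight (ν : ℕ) : ℝ := (Bweight (1 + 2 * ν))⁻¹ / (2 * ν).factorial

lemma divWeight_nonneg (ν : ℕ) : 0 ≤ divWeight ν := by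
  have := Bweight_pos (1 + 2 * ν)
  unfold divWeight
  positivity

lemma abs_divSum1_le_of_le_divWeight {N : ℕ} {g : ℕ → ℕ → ℝ} {E : ℝ} (hE : 0 ≤ E)
    (hg : ∀ ν m, 1 ≤ ν → Even m → 2 ≤ m → (1 + 2 * ν) * m = N → |g ν m| ≤ divWeight ν * E) :
    |divSum1 N g| ≤ E := by
  refine (abs_divSum1_le (fun ν => mul_nonneg (divWeight_nonneg ν) hE) hg).trans ?_
  rw [← Finset.sum_mul]
  have : ∑ ν ∈ Finset.Icc 1 N, divWeight ν ≤ 9 / 10 := sum_inv_factorial_div_Bweight_le N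
  nlinarith

lemma abs_divSum0_le_of_le_divWeight {N : ℕ} {g : ℕ → ℕ → ℝ} {E : ℝ} (hE : 0 ≤ E)
    (hg : ∀ ν m, Even m → 2 ≤ m → (1 + 2 * ν) * m = N →
      |g ν m| ≤ (1 + 2 * (ν : ℝ)) * divWeight ν * E) :
    |divSum0 N g| ≤ 54 * E := by
  refine (abs_divSum0_le (fun ν => ?_) hg).trans ?_
  · have := divWeight_nonneg ν
    positivity
  rw [← Finset.sum_mul]
  exact mul_le_mul_of_nonneg_right (sum_mul_inv_factorial_div_Bweight_le N) hE

lemma inv_factorial_succ_le (ν : ℕ) :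
    (1 : ℝ) / (2 * ν + 1).factorial ≤ 1 / (2 * ν).factorial := by
  gcongr
  exact Nat.le_succ _

section Majorant

variable {a : ℕ → ℕ → ℝ} {K η : ℝ} {n : ℕ}

/-- The bound `|a(m,j)| ≤ K·B(m)·m(m+1)⋯(m+j-1)·η^{j+1}` for all even `2 ≤ m ≤ n` and all `j`. -/
def BoundedUpTo (a : ℕ → ℕ → ℝ) (K η : ℝ) (n : ℕ) : Prop :=
  ∀ m j : ℕ, Even m → 2 ≤ m → m ≤ n →
    |a m j| ≤ K * Bweight m * m.ascFactorial j * η ^ (j + 1)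

lemma BoundedUpTo.abs_le (H : BoundedUpTo a K η n) (hK : 0 ≤ K) (hη : 0 ≤ η) {ν m N : ℕ}
    (hm : Even m) (h2 : 2 ≤ m) (hmn : m ≤ n) (hN : (1 + 2 * ν) * m = N) (l : ℕ) :
    |a m l| ≤ (Bweight (1 + 2 * ν))⁻¹ *
      (K * Bweight N * ((n + 2).ascFactorial l * η ^ (l + 1))) := by
  have hB := Bweight_pos (1 + 2 * ν)
  have hBN := Bweight_pos N
  refine (H m l hm h2 hmn).trans ?_
  rw [Bweight_eq_of_mul_eq h2 hN]
  calc _ ≤ K * ((Bweight (1 + 2 * ν))⁻¹ * Bweight N) * (n + 2).ascFactorial l * η ^ (l + 1) := by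
        gcongr
        omega
    _ = _ := by ring

lemma BoundedUpTo.abs_succ_le (H : BoundedUpTo a K η n) (hK : 0 ≤ K) (hη : 0 ≤ η) (hη1 : η ≤ 1)
    {ν m N : ℕ} (hm : Even m) (h2 : 2 ≤ m) (hmn : m ≤ n) (hN : (1 + 2 * ν) * m = N) (l : ℕ) :
    |a m (l + 1)| ≤ m * ((Bweight (1 + 2 * ν))⁻¹ *
      (K * Bweight N * ((n + 2).ascFactorial l * η ^ (l + 1)))) := by
  have hB := Bweight_pos (1 + 2 * ν)
  have hBN := Bweight_pos N
  refine (H m (l + 1) hm h2 hmn).trans ?_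
  rw [Bweight_eq_of_mul_eq h2 hN, Nat.ascFactorial_succ, ← Nat.succ_ascFactorial, Nat.cast_mul]
  calc _ ≤ K * ((Bweight (1 + 2 * ν))⁻¹ * Bweight N) * (m * (n + 2).ascFactorial l)
          * η ^ (l + 1) := by
        have h := pow_le_pow_of_le_one hη hη1 (Nat.le_succ (l + 1))
        gcongr
        omega
    _ = _ := by ring

lemma BoundedUpTo.abs_same_order_le (H : BoundedUpTo a K η n) (hK : 0 ≤ K) (hη : 0 ≤ η) (l : ℕ) :
    |divSum1 (n + 2) (fun ν m =>
        ((m : ℝ) - 1) * ((-1 : ℝ) ^ (ν - 1) / ((2 * ν).factorial : ℝ)) * a m l)| +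
      |divSum1 (n + 2) (fun ν m =>
        (m : ℝ) * ((-1 : ℝ) ^ (ν - 1) / ((2 * ν - 1).factorial : ℝ)) * a m l)| ≤
    ((n : ℝ) + 2) * (9 / 10) *
      (K * Bweight (n + 2) * ((n + 2).ascFactorial l * η ^ (l + 1))) := by
  set E := K * Bweight (n + 2) * ((n + 2).ascFactorial l * η ^ (l + 1)) with hE
  have hE0 : 0 ≤ E := by
    have := Bweight_pos (n + 2)
    positivity
  have hsize : ∀ {ν m : ℕ}, (1 + 2 * ν) * m = n + 2 → (m : ℝ) = (n + 2) / (1 + 2 * ν) := by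
    intro ν m h
    rw [eq_div_iff (by positivity)]
    have : (1 + 2 * (ν : ℝ)) * m = n + 2 := by exact_mod_cast h
    linarith
  have hle : ∀ {ν m : ℕ}, 1 ≤ ν → 2 ≤ m → (1 + 2 * ν) * m = n + 2 → m ≤ n := by
    intro ν m hν hm h
    nlinarith
  have h1 := abs_divSum1_le (N := n + 2) (g := fun ν m =>
      ((m : ℝ) - 1) * ((-1 : ℝ) ^ (ν - 1) / ((2 * ν).factorial : ℝ)) * a m l)
    (h := fun ν => (n + 2) / (1 + 2 * ν) * divWeight ν * E)
    (fun ν => by have := divWeight_nonneg ν; positivity)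
    (fun ν m hν hm h2 hN => by
      have hm1 : (2 : ℝ) ≤ m := by exact_mod_cast h2
      rw [abs_mul, abs_mul, abs_div, abs_pow, abs_neg, abs_one, one_pow, Nat.abs_cast,
        abs_of_nonneg (by linarith : (0 : ℝ) ≤ m - 1), ← hsize hN]
      calc _ ≤ (m : ℝ) * (1 / (2 * ν).factorial) * ((Bweight (1 + 2 * ν))⁻¹ * E) := by
            gcongr
            · linarith
            · exact H.abs_le hK hη hm h2 (hle hν h2 hN) hN l
        _ = _ := by unfold divWeight; ring)
  have h2 := abs_divSum1_le (N := n + 2) (g := fun ν m =>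
      (m : ℝ) * ((-1 : ℝ) ^ (ν - 1) / ((2 * ν - 1).factorial : ℝ)) * a m l)
    (h := fun ν => (n + 2) / (1 + 2 * ν) * (2 * ν) * divWeight ν * E)
    (fun ν => by have := divWeight_nonneg ν; positivity)
    (fun ν m hν hm h2 hN => by
      have hf : (1 : ℝ) / (2 * ν - 1).factorial = 2 * ν / (2 * ν).factorial := by
        rw [← Nat.mul_factorial_pred (show 2 * ν ≠ 0 by omega)]
        have : (ν : ℝ) ≠ 0 := by positivity
        push_cast
        field_simp
      rw [abs_mul, abs_mul, abs_div, abs_pow, abs_neg, abs_one, one_pow, Nat.abs_cast,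
        Nat.abs_cast, hf, ← hsize hN]
      calc _ ≤ (m : ℝ) * (2 * ν / (2 * ν).factorial) * ((Bweight (1 + 2 * ν))⁻¹ * E) := by
            gcongr
            exact H.abs_le hK hη hm h2 (hle hν h2 hN) hN l
        _ = _ := by unfold divWeight; ring)
  refine (add_le_add h1 h2).trans ?_
  rw [← Finset.sum_add_distrib]
  calc _ = ((n : ℝ) + 2) * (∑ ν ∈ Finset.Icc 1 (n + 2), divWeight ν) * E := by
        rw [Finset.mul_sum, Finset.sum_mul]
        refine Finset.sum_congr rfl fun ν _ => ?_
        have : (1 + 2 * (ν : ℝ)) ≠ 0 := by positivity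
        field_simp
    _ ≤ _ := by
        have : ∑ ν ∈ Finset.Icc 1 (n + 2), divWeight ν ≤ 9 / 10 :=
          sum_inv_factorial_div_Bweight_le (n + 2)
        gcongr

lemma BoundedUpTo.abs_convolution_le (H : BoundedUpTo a K η n) (hK : 0 ≤ K) (hη : 0 ≤ η)
    {ν₁ ν₂ m₁ m₂ n₁ n₂ : ℕ} (hm₁ : Even m₁) (hm₂ : Even m₂) (h₁ : 2 ≤ m₁) (h₂ : 2 ≤ m₂)
    (hN₁ : (1 + 2 * ν₁) * m₁ = n₁) (hN₂ : (1 + 2 * ν₂) * m₂ = n₂) (hn : n₁ + n₂ = n + 2) (l : ℕ) :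
    |∑ l₁ ∈ Finset.range (l + 1), (l.choose l₁ : ℝ) * (-1 : ℝ) ^ (ν₁ + ν₂) *
        ((1 + 2 * (ν₁ : ℝ)) * (1 + 2 * (ν₂ : ℝ)) /
          (((2 * ν₁).factorial : ℝ) * ((2 * ν₂).factorial : ℝ))) * a m₁ l₁ * a m₂ (l - l₁)| ≤
      (1 + 2 * (ν₂ : ℝ)) * divWeight ν₂ * ((1 + 2 * (ν₁ : ℝ)) * divWeight ν₁ *
        (K ^ 2 * (Bweight n₁ * Bweight n₂) * ((n + 2).ascFactorial l * η ^ (l + 2)))) := by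
  have hB₁ := Bweight_pos m₁
  have hB₂ := Bweight_pos m₂
  have hle₁ : m₁ ≤ n₁ := by nlinarith
  have hle₂ : m₂ ≤ n₂ := by nlinarith
  set c : ℝ := (1 + 2 * (ν₁ : ℝ)) * (1 + 2 * (ν₂ : ℝ)) /
    (((2 * ν₁).factorial : ℝ) * ((2 * ν₂).factorial : ℝ)) with hc
  have hc0 : 0 ≤ c := by positivity
  calc _ ≤ ∑ j ∈ Finset.range (l + 1), c * K ^ 2 * (Bweight m₁ * Bweight m₂) * η ^ (l + 2) *
          ((l.choose j : ℝ) * m₁.ascFactorial j * m₂.ascFactorial (l - j)) := by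
        refine (Finset.abs_sum_le_sum_abs _ _).trans (Finset.sum_le_sum fun j hj => ?_)
        have hj : j ≤ l := Nat.lt_succ_iff.1 (Finset.mem_range.1 hj)
        rw [abs_mul, abs_mul, abs_mul, abs_mul, abs_pow, abs_neg, abs_one, one_pow, Nat.abs_cast,
          abs_of_nonneg hc0]
        calc _ ≤ (l.choose j : ℝ) * 1 * c * (K * Bweight m₁ * m₁.ascFactorial j * η ^ (j + 1)) *
              (K * Bweight m₂ * m₂.ascFactorial (l - j) * η ^ (l - j + 1)) := by
              gcongr
              · exact H m₁ j hm₁ h₁ (by omega)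
              · exact H m₂ (l - j) hm₂ h₂ (by omega)
          _ = _ := by
              rw [show l + 2 = (j + 1) + (l - j + 1) by omega, pow_add η (j + 1)]
              ring
    _ = c * K ^ 2 * (Bweight m₁ * Bweight m₂) * η ^ (l + 2) * (m₁ + m₂).ascFactorial l := by
        rw [← Finset.mul_sum, sum_choose_mul_ascFactorial]
    _ ≤ c * K ^ 2 * (Bweight m₁ * Bweight m₂) * η ^ (l + 2) * (n + 2).ascFactorial l := by
        have h : m₁ + m₂ ≤ n + 2 := by omega
        gcongr ?_ * ?_
        exact_mod_cast Nat.ascFactorial_le l h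
    _ = _ := by
        rw [Bweight_eq_of_mul_eq h₁ hN₁, Bweight_eq_of_mul_eq h₂ hN₂, hc]
        unfold divWeight
        field_simp

lemma BoundedUpTo.abs_quadratic_le (H : BoundedUpTo a K η n) (hK : 0 ≤ K) (hη : 0 ≤ η) (l : ℕ) :
    |∑ n₁ ∈ Finset.range (n + 1),
        if Even n₁ ∧ 2 ≤ n₁ then
          divSum0 n₁ (fun ν₁ n' =>
            divSum0 (n + 2 - n₁) (fun ν₂ n'' =>
              ∑ l₁ ∈ Finset.range (l + 1),
                (l.choose l₁ : ℝ) * (-1 : ℝ) ^ (ν₁ + ν₂) *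
                  ((1 + 2 * (ν₁ : ℝ)) * (1 + 2 * (ν₂ : ℝ)) /
                    (((2 * ν₁).factorial : ℝ) * ((2 * ν₂).factorial : ℝ))) *
                  a n' l₁ * a n'' (l - l₁)))
        else 0| ≤
      2916 * (K ^ 2 * evenConv n * ((n + 2).ascFactorial l * η ^ (l + 2))) := by
  refine (Finset.abs_sum_le_sum_abs _ _).trans ?_
  unfold evenConv
  rw [Finset.mul_sum, Finset.sum_mul, Finset.mul_sum]
  refine Finset.sum_le_sum fun n₁ hn₁ => ?_
  have hn₁ := Finset.mem_range.1 hn₁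
  have hB := Bweight_pos n₁
  have hB' := Bweight_pos (n + 2 - n₁)
  split_ifs
  · set E := K ^ 2 * (Bweight n₁ * Bweight (n + 2 - n₁)) *
      ((n + 2).ascFactorial l * η ^ (l + 2)) with hE
    calc _ ≤ 54 * (54 * E) := by
          refine abs_divSum0_le_of_le_divWeight (by positivity) fun ν₁ m₁ hm₁ h₁ hN₁ => ?_
          have := divWeight_nonneg ν₁
          refine (abs_divSum0_le_of_le_divWeight
            (E := (1 + 2 * (ν₁ : ℝ)) * divWeight ν₁ * E) (by positivity)
            fun ν₂ m₂ hm₂ h₂ hN₂ => ?_).trans_eq (by ring)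
          exact H.abs_convolution_le hK hη hm₁ hm₂ h₁ h₂ hN₁ hN₂ (by omega) l
      _ = _ := by ring
  · simp

lemma BoundedUpTo.abs_next_le (ha : SineMFRecursion a) (H : BoundedUpTo a K η n)
    (hK : 0 ≤ K) (hη : 0 ≤ η) (hη1 : η ≤ 1) (hn : Even n) (h4 : 4 ≤ n) (l : ℕ) :
    |a (n + 2) l| ≤
      (((n : ℝ) + 2) / (n + 1) * (9 / 10) * (K * Bweight (n + 2)) +
        3000 / mfc / (n + 1) * (K * Bweight n + K ^ 2 * evenConv n)) *
      ((n + 2).ascFactorial l * η ^ (l + 1)) := by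
  set e : ℝ := (n + 2).ascFactorial l * η ^ (l + 1) with he
  have he0 : 0 ≤ e := by positivity
  have hB := Bweight_pos n
  have hc := mfc_pos
  have hconv := evenConv_nonneg n
  have hn4 : (4 : ℝ) ≤ n := by exact_mod_cast h4
  set E : ℝ := K * Bweight n * e with hE
  have hE0 : 0 ≤ E := by positivity
  have h12 := H.abs_same_order_le hK hη l
  have h3 : _ ≤ 2916 * (K ^ 2 * evenConv n * e) := (H.abs_quadratic_le hK hη l).trans (by
    rw [he]
    have hpow : η ^ (l + 2) ≤ η ^ (l + 1) := pow_le_pow_of_le_one hη hη1 (Nat.le_succ (l + 1))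
    gcongr)
  have hself : |a n l| ≤ E := by
    simpa [Bweight_one] using H.abs_le hK hη (ν := 0) hn (by omega) le_rfl (by ring) l
  have hself' : |a n (l + 1)| ≤ n * E := by
    simpa [Bweight_one] using H.abs_succ_le hK hη hη1 (ν := 0) hn (by omega) le_rfl (by ring) l
  have hle : ∀ {ν m : ℕ}, (1 + 2 * ν) * m = n → m ≤ n := by
    intro ν m h
    nlinarith
  have h5 : |divSum1 n (fun ν n' => (((n' : ℝ) - 4) / (2 * (n' : ℝ))) *
      ((-1 : ℝ) ^ ν / ((2 * ν + 1).factorial : ℝ)) * a n' l)| ≤ E := by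
    refine abs_divSum1_le_of_le_divWeight hE0 fun ν m _ hm h2 hN => ?_
    have hm1 : (2 : ℝ) ≤ m := by exact_mod_cast h2
    have hfrac : |((m : ℝ) - 4) / (2 * m)| ≤ 1 := by
      rw [abs_div, abs_of_pos (show (0 : ℝ) < 2 * m by positivity), div_le_one (by positivity),
        _root_.abs_le]
      constructor <;> linarith
    rw [abs_mul, abs_mul, abs_div ((-1) ^ ν), abs_pow, abs_neg, abs_one, one_pow, Nat.abs_cast]
    calc _ ≤ 1 * (1 / ((2 * ν).factorial : ℝ)) * ((Bweight (1 + 2 * ν))⁻¹ * E) := by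
          have := inv_factorial_succ_le ν
          gcongr
          exact H.abs_le hK hη hm h2 (hle hN) hN l
      _ = _ := by unfold divWeight; ring
  have h7 : |divSum1 n (fun ν n' => (1 / (n' : ℝ)) *
      ((-1 : ℝ) ^ ν / ((2 * ν + 1).factorial : ℝ)) * a n' (l + 1))| ≤ E := by
    refine abs_divSum1_le_of_le_divWeight hE0 fun ν m _ hm h2 hN => ?_
    have hm1 : (0 : ℝ) < m := by exact_mod_cast (by omega : 0 < m)
    rw [abs_mul, abs_mul, abs_div ((-1) ^ ν), abs_pow, abs_neg, abs_one, one_pow, Nat.abs_cast,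
      abs_of_pos (by positivity : 0 < 1 / (m : ℝ))]
    calc _ ≤ 1 / (m : ℝ) * (1 / ((2 * ν).factorial : ℝ)) *
            (m * ((Bweight (1 + 2 * ν))⁻¹ * E)) := by
          have := inv_factorial_succ_le ν
          gcongr
          exact H.abs_succ_le hK hη hη1 hm h2 (hle hN) hN l
      _ = _ := by unfold divWeight; field_simp
  have h8 : |divSum1 n (fun ν n' => (-1 : ℝ) ^ ν *
      ((ν : ℝ) / ((2 * ν + 1).factorial : ℝ)) * a n' l)| ≤ E := by
    refine abs_divSum1_le_of_le_divWeight hE0 fun ν m _ hm h2 hN => ?_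
    have hf : (ν : ℝ) / (2 * ν + 1).factorial ≤ 1 / (2 * ν).factorial := by
      rw [Nat.factorial_succ, div_le_div_iff₀ (by positivity) (by positivity)]
      push_cast
      have : (0 : ℝ) < (2 * ν).factorial := by positivity
      have : (0 : ℝ) ≤ ν := Nat.cast_nonneg _
      nlinarith
    rw [abs_mul, abs_mul, abs_pow, abs_neg, abs_one, one_pow, abs_div, Nat.abs_cast, Nat.abs_cast]
    calc _ ≤ 1 * (1 / ((2 * ν).factorial : ℝ)) * ((Bweight (1 + 2 * ν))⁻¹ * E) := by
          gcongr
          exact H.abs_le hK hη hm h2 (hle hN) hN l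
      _ = _ := by unfold divWeight; ring
  have h4' : |(((n : ℝ) - 4) / ((n : ℝ) * ((n : ℝ) + 1) * mfc)) * a n l| ≤
      1 / ((n + 1) * mfc) * E := by
    rw [abs_mul, abs_of_nonneg (div_nonneg (by linarith) (by positivity))]
    gcongr ?_ * ?_
    rw [div_le_div_iff₀ (by positivity) (by positivity)]
    have : 0 < ((n : ℝ) + 1) * mfc := by positivity
    nlinarith
  have h6 : |2 / ((n : ℝ) * ((n : ℝ) + 1) * mfc) * a n (l + 1)| ≤
      2 / ((n + 1) * mfc) * E := by
    rw [abs_mul, abs_of_nonneg (by positivity)]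
    calc _ ≤ 2 / ((n : ℝ) * ((n : ℝ) + 1) * mfc) * (n * E) := by gcongr
      _ = _ := by field_simp
  have scale : ∀ {r x y : ℝ}, 0 ≤ r → |x| ≤ y → |r * x| ≤ r * y := by
    intro r x y hr h
    rw [abs_mul, abs_of_nonneg hr]
    gcongr
  have hp1 : 0 ≤ 1 / ((n : ℝ) + 1) := by positivity
  have hp2 : 0 ≤ 1 / (((n : ℝ) + 1) * mfc) := by positivity
  have hp3 : 0 ≤ 2 / (((n : ℝ) + 1) * mfc) := by positivity
  rw [ha.2 n l hn h4]
  refine (abs_add_le _ _).trans ((add_le_add ((abs_add_le _ _).trans (add_le_add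
    ((abs_add_le _ _).trans (add_le_add ((abs_add_le _ _).trans (add_le_add
    ((abs_add_le _ _).trans (add_le_add ((abs_add_le _ _).trans (add_le_add
    ((abs_add_le _ _).trans_eq (by rw [abs_mul, abs_mul, ← mul_add])) (scale hp2 h3))) h4'))
    (scale hp3 h5))) h6)) (scale hp3 h7))) (scale hp3 h8)).trans ?_)
  rw [abs_of_nonneg hp1]
  have h12' := mul_le_mul_of_nonneg_left h12 hp1
  calc _ ≤ 1 / ((n : ℝ) + 1) * (((n : ℝ) + 2) * (9 / 10) * (K * Bweight (n + 2) * e)) +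
        1 / (((n : ℝ) + 1) * mfc) * (2916 * (K ^ 2 * evenConv n * e) + 9 * E) := by
        have : 2 / (((n : ℝ) + 1) * mfc) = 2 * (1 / (((n : ℝ) + 1) * mfc)) := by ring
        rw [this]
        linarith
    _ ≤ 1 / ((n : ℝ) + 1) * (((n : ℝ) + 2) * (9 / 10) * (K * Bweight (n + 2) * e)) +
        1 / (((n : ℝ) + 1) * mfc) * (3000 * (K ^ 2 * evenConv n * e) + 3000 * E) := by
        have : 0 ≤ K ^ 2 * evenConv n * e := by positivity
        gcongr <;> norm_num
    _ = _ := by rw [hE]; field_simp; ring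

end Majorant

lemma abs_a_four_le {a : ℕ → ℕ → ℝ} (ha : SineMFRecursion a) {K η : ℝ} (hK : 0 ≤ K) (hη : 0 ≤ η)
    (hη1 : η ≤ 1) (H : BoundedUpTo a K η 2) (l : ℕ) :
    |a 4 l| ≤ 1 / (3 * mfc) * (K ^ 2 * Bweight 2 ^ 2 + 3 * K * Bweight 2) *
      ((4 : ℕ).ascFactorial l * η ^ (l + 1)) := by
  have hB := Bweight_pos 2
  have hc := mfc_pos
  have hconv := H.abs_convolution_le hK hη (ν₁ := 0) (ν₂ := 0) even_two even_two le_rfl le_rfl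
    rfl rfl rfl l
  have h1 := H.abs_le hK hη (ν := 0) even_two le_rfl le_rfl rfl l
  have h2 := H.abs_succ_le hK hη hη1 (ν := 0) even_two le_rfl le_rfl rfl l
  simp only [Bweight_one, divWeight, Nat.cast_zero, mul_zero, add_zero, pow_zero, mul_one, one_mul,
    Nat.factorial_zero, Nat.cast_one, div_one, inv_one, Nat.reduceAdd, Nat.cast_ofNat] at hconv h1 h2
  have hpow := pow_le_pow_of_le_one hη hη1 (Nat.le_succ (l + 1))
  have hconv' := hconv.trans (b := _)
    (c := K ^ 2 * (Bweight 2 * Bweight 2) * ((4 : ℕ).ascFactorial l * η ^ (l + 1)))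
    (by gcongr)
  rw [ha.1 l, abs_mul, abs_of_pos (by positivity : 0 < 1 / (3 * mfc)), mul_assoc]
  gcongr
  refine (abs_add_le _ _).trans ((add_le_add_left (abs_sub _ _) _).trans ?_)
  linarith

lemma exists_boundedUpTo (N : ℕ) : ∃ K : ℝ, 1 ≤ K ∧ ∀ (a : ℕ → ℕ → ℝ) (η : ℝ),
    SineMFRecursion a → 0 ≤ η → η ≤ 1 → BoundedUpTo a 1 η 2 → BoundedUpTo a K η N := by
  induction N using Nat.strong_induction_on with
  | _ N ih =>
  rcases Nat.lt_or_ge N 3 with hN | hN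
  · exact ⟨1, le_rfl, fun a η _ _ _ H m j hm h2 hmN => H m j hm h2 (by omega)⟩
  obtain ⟨n, rfl⟩ : ∃ n, N = n + 1 := ⟨N - 1, by omega⟩
  obtain ⟨K, hK1, hK⟩ := ih n (by omega)
  have hK0 : 0 ≤ K := by linarith
  suffices h : ∃ M : ℝ, ∀ (a : ℕ → ℕ → ℝ) (η : ℝ), SineMFRecursion a → 0 ≤ η → η ≤ 1 →
      BoundedUpTo a 1 η 2 → Even (n + 1) → ∀ l, |a (n + 1) l| ≤
        M * ((n + 1).ascFactorial l * η ^ (l + 1)) by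
    obtain ⟨M, hM⟩ := h
    refine ⟨max K (M / Bweight (n + 1)), le_max_of_le_left hK1,
      fun a η ha hη hη1 H m j hm h2 hmN => ?_⟩
    have hB := Bweight_pos m
    rcases Nat.lt_or_ge n m with h | h
    · obtain rfl : m = n + 1 := by omega
      refine (hM a η ha hη hη1 H hm j).trans ?_
      calc _ = M / Bweight (n + 1) * Bweight (n + 1) * (n + 1).ascFactorial j * η ^ (j + 1) := by
            field_simp
        _ ≤ _ := by
            gcongr
            exact le_max_right _ _
    · refine (hK a η ha hη hη1 H m j hm h2 h).trans ?_
      gcongr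
      exact le_max_left _ _
  rcases Nat.lt_or_ge n 5 with h5 | h5
  · rcases eq_or_ne n 3 with rfl | h3
    · exact ⟨_, fun a η ha hη hη1 H _ l => abs_a_four_le ha zero_le_one hη hη1 H l⟩
    · refine ⟨0, fun a η _ _ _ _ he => absurd he ?_⟩
      have : n = 2 ∨ n = 4 := by omega
      rcases this with rfl | rfl <;> decide
  · obtain ⟨k, rfl⟩ : ∃ k, n = k + 1 := ⟨n - 1, by omega⟩
    refine ⟨_, fun a η ha hη hη1 H he l => BoundedUpTo.abs_next_le (K := K) ha
      (fun m j hm h2 hmk => hK a η ha hη hη1 H m j hm h2 (by omega)) hK0 hη hη1 ?_ (by omega) l⟩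
    simpa [Nat.even_add_one] using he

lemma boundedUpTo_two {a : ℕ → ℕ → ℝ} {δ : ℝ} (hδ : 0 ≤ δ)
    (h : ∀ l : ℕ, |a 2 l| ≤
      Bweight 2 * (((2 + l).factorial : ℝ) / ((2 : ℕ).factorial : ℝ)) * δ ^ (l + 1)) :
    BoundedUpTo a 1 (2 * δ) 2 := by
  intro m j _ h2 hm
  obtain rfl : m = 2 := by omega
  have hB := Bweight_pos 2
  refine (h j).trans ?_
  have h3 : (2 : ℝ) * (2 + 1 : ℕ).ascFactorial j = (2 + j) * (2 : ℕ).ascFactorial j := by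
    exact_mod_cast Nat.succ_ascFactorial 2 j
  have hj : ((2 + j : ℕ) : ℝ) ≤ 2 ^ (j + 1) * 2 := by
    rw [← pow_succ]
    exact_mod_cast (by have := (j + 1 + 1).lt_two_pow_self; omega : 2 + j ≤ 2 ^ (j + 1 + 1))
  push_cast at hj
  have hA : (0 : ℝ) ≤ (2 : ℕ).ascFactorial j := by positivity
  have h4 : ((2 + 1 : ℕ).ascFactorial j : ℝ) ≤ 2 ^ (j + 1) * (2 : ℕ).ascFactorial j := by
    nlinarith
  rw [← Nat.factorial_mul_ascFactorial, Nat.cast_mul, mul_div_cancel_left₀ _ (by positivity),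
    mul_pow]
  calc _ ≤ Bweight 2 * (2 ^ (j + 1) * (2 : ℕ).ascFactorial j) * δ ^ (j + 1) := by gcongr
    _ = _ := by ring

/-- existence of bounds for solutions of the sine-resummed mean field
recursion with sufficiently small initial data. -/
theorem stmt3 : ∃ ε₀ > (0 : ℝ), ∀ ε : ℝ, 0 < ε → ε ≤ ε₀ →
    ∃ ε' : ℝ, 0 < ε' ∧ ε' ≤ ε ∧
      ∀ a : ℕ → ℕ → ℝ, SineMFRecursion a →
        (∀ l : ℕ, |a 2 l| ≤
          Bweight 2 * (((2 + l).factorial : ℝ) / ((2 : ℕ).factorial : ℝ)) * ε' ^ (l + 1)) →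
        ∀ n l : ℕ, Even n → 2 ≤ n →
          |a n l| ≤ Bweight n * (((n + l).factorial : ℝ) / (n.factorial : ℝ)) * ε ^ (l + 1) := by
  refine ⟨1, one_pos, fun ε hε hε1 => ?_⟩
  obtain ⟨N, hN⟩ := exists_forall_majorant_le (3000 / mfc) (by have := mfc_pos; positivity)
  obtain ⟨K, hK1, hK⟩ := exists_boundedUpTo (max N 4 + 2)
  have hK0 : 0 < K := by linarith
  have hδ : 2 * (ε / (2 * K)) = ε / K := by field_simp
  have hεK : ε / K ≤ ε := div_le_self hε.le hK1
  refine ⟨ε / (2 * K), by positivity, div_le_self hε.le (by linarith), fun a ha h0 => ?_⟩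
  have h2 := boundedUpTo_two (by positivity) h0
  rw [hδ] at h2
  have hinit := hK a (ε / K) ha (by positivity) (by linarith) h2
  have main : ∀ n, BoundedUpTo a 1 ε n := by
    intro n
    induction n with
    | zero => intro m j _ h2 h; omega
    | succ n ih =>
      intro m j hm h2 hmn
      have hB := Bweight_pos m
      rcases Nat.lt_or_ge n m with h | h
      swap
      · exact ih m j hm h2 h
      rcases Nat.lt_or_ge (max N 4 + 2) m with hlarge | hsmall
      · obtain ⟨k, rfl⟩ : ∃ k, m = k + 2 := ⟨m - 2, by omega⟩
        have hk : N ≤ k ∧ 4 ≤ k := by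
          have := le_max_left N 4
          have := le_max_right N 4
          omega
        have hnext := BoundedUpTo.abs_next_le (K := 1) (n := k) ha
          (fun m j hm h2 hmk => ih m j hm h2 (by omega)) zero_le_one hε.le hε1
          ((Nat.even_add.1 hm).2 even_two) hk.2 j
        refine hnext.trans ?_
        rw [mul_assoc (1 * Bweight (k + 2))]
        refine mul_le_mul_of_nonneg_right ?_ (by have := hε.le; positivity)
        simpa using hN k hk.1
      · refine (hinit m j hm h2 hsmall).trans ?_
        have hpow : K * (ε / K) ^ (j + 1) ≤ ε ^ (j + 1) := by
          calc K * (ε / K) ^ (j + 1) = (ε / K) ^ j * ε := by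
                rw [pow_succ]
                field_simp
            _ ≤ ε ^ j * ε :=
                mul_le_mul_of_nonneg_right (pow_le_pow_left₀ (by positivity) hεK j) hε.le
            _ = _ := (pow_succ _ _).symm
        calc _ = Bweight m * m.ascFactorial j * (K * (ε / K) ^ (j + 1)) := by ring
          _ ≤ Bweight m * m.ascFactorial j * ε ^ (j + 1) := by gcongr
          _ = _ := by ring
  intro n l hn hn2
  have hB := Bweight_pos n
  refine (main n n l hn hn2 le_rfl).trans ?_
  rw [← Nat.factorial_mul_ascFactorial, Nat.cast_mul, mul_div_cancel_left₀ _ (by positivity),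
    one_mul]
  gcongr
  omega

end
end

section
/- Suppose the smooth functions (f_n) form a mean field flow hierarchy generated by a smooth f₂ and satisfy the pure φ⁴ boundary conditions f_n(0) = 0 for all even n ≥ 6. Then ∂_μ^l f_n(0) = 0 for all even n ≥ 6 and all integers l with 0 ≤ l ≤ n/2 − 3. -/
open Finset in
theorem iteratedDeriv_mul_eq_zero_of_forall {l : ℕ} {g h : ℝ → ℝ} {x : ℝ}
    (hg : ContDiff ℝ (⊤ : ℕ∞) g) (hh : ContDiff ℝ (⊤ : ℕ∞) h)
    (H : ∀ j ≤ l, iteratedDeriv j g x = 0 ∨ iteratedDeriv (l - j) h x = 0) :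
    iteratedDeriv l (fun μ => g μ * h μ) x = 0 := by
  have hl : ((l : ℕ∞) : WithTop ℕ∞) ≤ ((⊤ : ℕ∞) : WithTop ℕ∞) := by exact_mod_cast le_top
  have key := iteratedDeriv_mul (n := l) (x := x) (hg.of_le hl).contDiffAt (hh.of_le hl).contDiffAt
  refine key.trans (sum_eq_zero fun j hj => ?_)
  rcases H j (by simpa [Nat.lt_succ_iff] using hj) with h0 | h0 <;> simp [h0]

theorem iteratedDeriv_eq_of_eqOn_Icc {l : ℕ} {a b : ℝ} (hab : a < b) {g h : ℝ → ℝ}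
    (hg : ContDiff ℝ (⊤ : ℕ∞) g) (hh : ContDiff ℝ (⊤ : ℕ∞) h)
    (H : Set.EqOn g h (Set.Icc a b)) : iteratedDeriv l g a = iteratedDeriv l h a := by
  have hl : ((l : ℕ∞) : WithTop ℕ∞) ≤ ((⊤ : ℕ∞) : WithTop ℕ∞) := by exact_mod_cast le_top
  have ha : a ∈ Set.Icc a b := Set.left_mem_Icc.2 hab.le
  rw [← iteratedDerivWithin_eq_iteratedDeriv (uniqueDiffOn_Icc hab) (hg.of_le hl).contDiffAt ha,
    ← iteratedDerivWithin_eq_iteratedDeriv (uniqueDiffOn_Icc hab) (hh.of_le hl).contDiffAt ha]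
  exact iteratedDerivWithin_congr H ha

/-- If `∂^j f m` vanishes at `0` for all `j ≤ l` and even `m ≥ 2 j + 6`, then
so does `∂^l` of the pair sum of index `n ≥ 2 l + 8`. -/
theorem iteratedDeriv_mfPairSum_eq_zero {f : ℕ → ℝ → ℝ} (hf : ∀ n, ContDiff ℝ (⊤ : ℕ∞) (f n))
    {l n : ℕ} (hn : Even n) (hln : 2 * l + 8 ≤ n)
    (H : ∀ j ≤ l, ∀ m, Even m → 2 * j + 6 ≤ m → iteratedDeriv j (f m) 0 = 0) :
    iteratedDeriv l (mfPairSum f n) 0 = 0 := by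
  have hl : ((l : ℕ∞) : WithTop ℕ∞) ≤ ((⊤ : ℕ∞) : WithTop ℕ∞) := by exact_mod_cast le_top
  unfold mfPairSum
  rw [iteratedDeriv_fun_sum]
  · refine Finset.sum_eq_zero fun n₁ _ => ?_
    split_ifs with h
    · obtain ⟨he, h4, hle⟩ := h
      refine iteratedDeriv_mul_eq_zero_of_forall (hf _) (hf _) fun j hj => ?_
      obtain ⟨a, rfl⟩ := hn
      obtain ⟨b, rfl⟩ := he
      by_cases hjb : 2 * j + 6 ≤ b + b
      · exact .inl (H j hj _ ⟨b, rfl⟩ hjb)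
      · exact .inr (H (l - j) (by omega) _ ⟨a + 1 - b, by omega⟩ (by omega))
    · simp
  · intro n₁ _
    split_ifs
    · exact (((hf _).mul (hf _)).of_le hl).contDiffAt
    · exact contDiffAt_const

theorem contDiff_mfPairSum {f : ℕ → ℝ → ℝ} (hf : ∀ n, ContDiff ℝ (⊤ : ℕ∞) (f n)) (n : ℕ) :
    ContDiff ℝ (⊤ : ℕ∞) (mfPairSum f n) := by
  unfold mfPairSum
  refine ContDiff.sum fun n₁ _ => ?_
  split_ifs
  · exact (hf _).mul (hf _)
  · exact contDiff_const

/-- with the pure `φ⁴` boundary conditions `f_n(0) = 0` for even `n ≥ 6`,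
the derivatives `∂_μ^l f_n(0)` vanish for all `0 ≤ l ≤ n/2 − 3` (i.e. `2l + 6 ≤ n`). -/
theorem stmt4 (μmax : ℝ) (hμmax : 0 < μmax)
    (f : ℕ → ℝ → ℝ) (hf : MeanFieldHierarchy μmax f)
    (hbc : ∀ n : ℕ, Even n → 6 ≤ n → f n 0 = 0) :
    ∀ n l : ℕ, Even n → 6 ≤ n → 2 * l + 6 ≤ n → iteratedDeriv l (f n) 0 = 0 := by
  obtain ⟨hsm, -, hrec⟩ := hf
  suffices H : ∀ l m : ℕ, Even m → 2 * l + 6 ≤ m → iteratedDeriv l (f m) 0 = 0 from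
    fun n l hn _ hln => H l n hn hln
  intro l
  induction l using Nat.strong_induction_on with
  | _ l ih =>
  intro n hn hln
  rcases l with _ | l
  · simpa using hbc n hn (by omega)
  have hl : ((l : ℕ∞) : WithTop ℕ∞) ≤ ((⊤ : ℕ∞) : WithTop ℕ∞) := by exact_mod_cast le_top
  have ih' : ∀ j ≤ l, ∀ m, Even m → 2 * j + 6 ≤ m → iteratedDeriv j (f m) 0 = 0 :=
    fun j hj => ih j (by omega)
  have hP := contDiff_mfPairSum hsm n
  have hD : ContDiff ℝ (⊤ : ℕ∞) (deriv (f n)) := (contDiff_infty_iff_deriv.1 (hsm n)).2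
  have hG : ContDiff ℝ (⊤ : ℕ∞) fun μ => 2 * f 2 μ + 1 - 4 / (n : ℝ) :=
    ((contDiff_const.mul (hsm 2)).add contDiff_const).sub contDiff_const
  have hM := (hsm n).mul hG
  have hsucc : iteratedDeriv (l + 1) (f n) 0 = iteratedDeriv l (deriv (f n)) 0 := by
    rw [iteratedDeriv_succ']
  have hMzero : iteratedDeriv l (fun μ => f n μ * (2 * f 2 μ + 1 - 4 / (n : ℝ))) 0 = 0 :=
    iteratedDeriv_mul_eq_zero_of_forall (hsm n) hG
      fun j hj => .inl (ih' j hj n hn (by omega))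
  have hn0 : (n : ℝ) ≠ 0 := by
    have : n ≠ 0 := by omega
    exact_mod_cast this
  have hn1 : (n : ℝ) + 1 ≠ 0 := by positivity
  have heq : Set.EqOn (deriv (f n))
      (fun μ => (n : ℝ) * (n + 1) / 2 * f (n + 2) μ -
        ((n : ℝ) / 2 * mfPairSum f n μ +
          (n : ℝ) / 2 * (f n μ * (2 * f 2 μ + 1 - 4 / (n : ℝ))))) (Set.Icc 0 μmax) := by
    intro μ hμ
    simp only [hrec n hn (by omega) μ hμ]
    field_simp
    ring
  have hA := contDiff_const (c := (n : ℝ) * (n + 1) / 2) |>.mul (hsm (n + 2))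
  have hB := contDiff_const (c := (n : ℝ) / 2) |>.mul hP
  have hC := contDiff_const (c := (n : ℝ) / 2) |>.mul hM
  rw [hsucc, iteratedDeriv_eq_of_eqOn_Icc hμmax hD (hA.sub (hB.add hC)) heq,
    iteratedDeriv_fun_sub (hA.of_le hl).contDiffAt ((hB.add hC).of_le hl).contDiffAt,
    iteratedDeriv_fun_add (hB.of_le hl).contDiffAt (hC.of_le hl).contDiffAt,
    iteratedDeriv_const_mul_field, iteratedDeriv_const_mul_field, iteratedDeriv_const_mul_field,
    hMzero, ih' l le_rfl (n + 2) (hn.add even_two) (by omega),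
    iteratedDeriv_mfPairSum_eq_zero hsm hn (by omega) ih']
  simp
end

section
/- Let 0 < ε ≤ 10⁻² and suppose the coefficients of the mean field Taylor recursion satisfy |f_{2,0}| ≤ ε/4 and 0 ≤ g_{4,0} ≤ ε/32. Then |f_{2,1}| ≤ ε/2, |g_{4,1}| ≤ ε²/32, and for every even n ≥ 6 one has |g_{n,0}| ≤ ε^{n/2−1}/(2·n²) and |g_{n,1}| ≤ ε^{n/2−1}/n². Moreover the numbers g_{n,0} alternate in sign: g_{n,0} = (−1)^{n/2}·|g_{n,0}| for every even n ≥ 4. -/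
/-- Sum over ordered pairs `(n₁, n₂)` of even integers `≥ 4` with `n₁ + n₂ = n + 2`
of `t n₁ n₂`. -/
noncomputable def gPairSum (n : ℕ) (t : ℕ → ℕ → ℝ) : ℝ :=
  ∑ n₁ ∈ Finset.range (n + 3),
    if Even n₁ ∧ 4 ≤ n₁ ∧ n₁ + 2 ≤ n then t n₁ (n + 2 - n₁) else 0

/-- The mean field Taylor recursion for the coefficients `f2 k` and `g n k`
(`n` even `≥ 4`), arising from the Taylor expansion at `μ = 0` of smooth mean field
solutions with pure `φ⁴` boundary conditions. -/
def MFTaylor (f2 : ℕ → ℝ) (g : ℕ → ℕ → ℝ) : Prop :=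
  (∀ k : ℕ, g 4 k = (1 / 3) * (((k : ℝ) + 1) * f2 (k + 1) - f2 k +
      ∑ ν ∈ Finset.range (k + 1), f2 ν * f2 (k - ν))) ∧
  (∀ n k : ℕ, Even n → 4 ≤ n →
    g (n + 2) k =
      (1 / ((n : ℝ) + 1)) *
          gPairSum n (fun n₁ n₂ => ∑ ν ∈ Finset.range (k + 3), g n₁ ν * g n₂ (k + 2 - ν))
        + (2 / ((n : ℝ) + 1)) * (∑ ν ∈ Finset.range (k + 2), g n ν * f2 (k + 1 - ν))
        + (1 / ((n : ℝ) + 1)) * (1 - 4 / (n : ℝ)) * g n (k + 1)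
        + (((n : ℝ) + 2 * (k : ℝ)) / ((n : ℝ) * ((n : ℝ) + 1))) * g n (k + 2)) ∧
  (∀ n : ℕ, Even n → 4 ≤ n →
    (((n : ℝ) - 4) / (n : ℝ)) * g n 0 + gPairSum n (fun n₁ n₂ => g n₁ 0 * g n₂ 0) = 0 ∧
    (2 / (n : ℝ)) * g n 1 + (((n : ℝ) - 4) / (n : ℝ)) * g n 1
        + 2 * gPairSum n (fun n₁ n₂ => g n₁ 0 * g n₂ 1)
        + g n 0 * (2 * f2 0 + 1 - 4 / (n : ℝ)) = 0)

/-- The pair sum at an even index, written as a sum over half-indices. -/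
theorem gPairSum_two_mul (m : ℕ) (t : ℕ → ℕ → ℝ) :
    gPairSum (2 * m) t = ∑ i ∈ Finset.Ico 2 m, t (2 * i) (2 * (m + 1 - i)) := by
  rw [gPairSum, ← Finset.sum_filter]
  refine Finset.sum_nbij' (fun n => n / 2) (fun i => 2 * i) ?_ ?_ ?_ ?_ ?_
  · intro n hn
    simp only [Finset.mem_filter, Finset.mem_range, Finset.mem_Ico] at hn ⊢
    omega
  · intro i hi
    simp only [Finset.mem_filter, Finset.mem_range, Finset.mem_Ico] at hi ⊢
    exact ⟨by omega, even_two_mul i, by omega, by omega⟩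
  · intro n hn
    simp only [Finset.mem_filter] at hn
    exact Nat.two_mul_div_two_of_even hn.2.1
  · intro i _
    simp
  · intro n hn
    simp only [Finset.mem_filter] at hn
    obtain ⟨_, ⟨r, rfl⟩, _, _⟩ := hn
    congr 1 <;> omega

theorem inv_sq_le_inv_sub_inv {x : ℝ} (hx : 1 < x) : 1 / x ^ 2 ≤ 1 / (x - 1) - 1 / x := by
  have h1 : 0 < x - 1 := by linarith
  have h2 : 0 < x := by linarith
  rw [div_sub_div _ _ h1.ne' h2.ne', div_le_div_iff₀ (by positivity) (by positivity)]
  nlinarith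

/-- Discrete convolution of inverse squares. -/
theorem sum_inv_sq_mul_inv_sq_le {m : ℕ} (hm : 3 ≤ m) :
    ∑ i ∈ Finset.Ico 2 m, 1 / (i : ℝ) ^ 2 * (1 / ((m + 1 - i : ℕ) : ℝ) ^ 2) ≤
      4 * ((m : ℝ) - 2) / (((m : ℝ) + 1) ^ 2 * ((m : ℝ) - 1)) := by
  have hm' : (3 : ℝ) ≤ m := by exact_mod_cast hm
  set F : ℕ → ℝ := fun i => 1 / ((m : ℝ) + 1 - i) - 1 / ((i : ℝ) - 1) with hF
  have key : ∀ i ∈ Finset.Ico 2 m, 1 / (i : ℝ) ^ 2 * (1 / ((m + 1 - i : ℕ) : ℝ) ^ 2) ≤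
      2 / ((m : ℝ) + 1) ^ 2 * (F (i + 1) - F i) := by
    intro i hi
    rw [Finset.mem_Ico] at hi
    obtain ⟨j, hj⟩ : ∃ j, m + 1 - i = j := ⟨_, rfl⟩
    have hj2 : 2 ≤ j := by omega
    have hsum : (m : ℝ) + 1 = i + j := by exact_mod_cast (by omega : m + 1 = i + j)
    have hi' : (2 : ℝ) ≤ i := by exact_mod_cast hi.1
    have hj' : (2 : ℝ) ≤ j := by exact_mod_cast hj2
    have e1 : F (i + 1) - F i =
        (1 / ((i : ℝ) - 1) - 1 / i) + (1 / ((j : ℝ) - 1) - 1 / j) := by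
      simp only [hF]
      rw [hsum]
      push_cast
      have a1 : (i : ℝ) + j - (i + 1) = j - 1 := by ring
      have a2 : (i : ℝ) + j - i = j := by ring
      have a3 : (i : ℝ) + 1 - 1 = i := by ring
      rw [a1, a2, a3]
      ring
    rw [hj, e1, hsum]
    have b1 := inv_sq_le_inv_sub_inv (x := (i : ℝ)) (by linarith)
    have b2 := inv_sq_le_inv_sub_inv (x := (j : ℝ)) (by linarith)
    calc 1 / (i : ℝ) ^ 2 * (1 / (j : ℝ) ^ 2)
        ≤ 2 / ((i : ℝ) + j) ^ 2 * (1 / (i : ℝ) ^ 2 + 1 / (j : ℝ) ^ 2) := by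
          rw [← sub_nonneg]
          have : 2 / ((i : ℝ) + j) ^ 2 * (1 / (i : ℝ) ^ 2 + 1 / (j : ℝ) ^ 2)
              - 1 / (i : ℝ) ^ 2 * (1 / (j : ℝ) ^ 2)
              = ((i : ℝ) - j) ^ 2 / (((i : ℝ) + j) ^ 2 * i ^ 2 * j ^ 2) := by
            field_simp
            ring
          rw [this]
          positivity
      _ ≤ _ := by gcongr
  refine (Finset.sum_le_sum key).trans ?_
  rw [← Finset.mul_sum, Finset.sum_Ico_sub F (by omega)]
  apply le_of_eq
  have h1 : (m : ℝ) - 1 ≠ 0 := by linarith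
  have e : F m - F 2 = 2 * ((m : ℝ) - 2) / ((m : ℝ) - 1) := by
    simp only [hF]
    push_cast
    have a1 : (m : ℝ) + 1 - m = 1 := by ring
    have a2 : (m : ℝ) + 1 - 2 = m - 1 := by ring
    rw [a1, a2]
    field_simp
    ring
  rw [e]
  field_simp
  ring

/-- Alternation of signs for a sequence determined by a quadratic convolution. -/
theorem alternating_of_convolution {a : ℕ → ℝ} (h2 : 0 ≤ a 2)
    (hrec : ∀ m, 3 ≤ m → a m =
      -((m : ℝ) / (m - 2) * ∑ i ∈ Finset.Ico 2 m, a i * a (m + 1 - i)))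
    (m : ℕ) (hm : 2 ≤ m) : 0 ≤ (-1 : ℝ) ^ m * a m := by
  induction m using Nat.strong_induction_on with
  | _ m ih =>
    rcases hm.eq_or_lt with rfl | hm3
    · simpa using h2
    have hm' : (3 : ℝ) ≤ m := by exact_mod_cast hm3
    have e : (-1 : ℝ) ^ m * a m = (m : ℝ) / (m - 2) *
        ∑ i ∈ Finset.Ico 2 m, ((-1) ^ i * a i) * ((-1) ^ (m + 1 - i) * a (m + 1 - i)) := by
      have : ∑ i ∈ Finset.Ico 2 m, ((-1) ^ i * a i) * ((-1) ^ (m + 1 - i) * a (m + 1 - i))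
          = (-1 : ℝ) ^ (m + 1) * ∑ i ∈ Finset.Ico 2 m, a i * a (m + 1 - i) := by
        rw [Finset.mul_sum]
        refine Finset.sum_congr rfl fun i hi => ?_
        rw [Finset.mem_Ico] at hi
        have : (-1 : ℝ) ^ (m + 1) = (-1) ^ i * (-1) ^ (m + 1 - i) := by
          rw [← pow_add]
          congr 1
          omega
        rw [this]
        ring
      rw [this, hrec m hm3, pow_succ]
      ring
    rw [e]
    refine mul_nonneg (div_nonneg (by linarith) (by linarith)) (Finset.sum_nonneg fun i hi => ?_)
    rw [Finset.mem_Ico] at hi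
    exact mul_nonneg (ih i (by omega) (by omega)) (ih (m + 1 - i) (by omega) (by omega))

/-- Geometric decay for a sequence determined by a quadratic convolution. -/
theorem abs_le_of_convolution {a : ℕ → ℝ} {δ : ℝ} (hδ : 0 ≤ δ) (h2 : |a 2| ≤ δ / 16)
    (hrec : ∀ m, 3 ≤ m → a m =
      -((m : ℝ) / (m - 2) * ∑ i ∈ Finset.Ico 2 m, a i * a (m + 1 - i)))
    (m : ℕ) (hm : 2 ≤ m) : |a m| ≤ δ ^ (m - 1) / 4 * (1 / (m : ℝ) ^ 2) := by
  induction m using Nat.strong_induction_on with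
  | _ m ih =>
    rcases hm.eq_or_lt with rfl | hm3
    · norm_num
      linarith
    have hm' : (3 : ℝ) ≤ m := by exact_mod_cast hm3
    have hm2 : 0 < (m : ℝ) - 2 := by linarith
    have hm1 : 0 < (m : ℝ) - 1 := by linarith
    have hsum : |∑ i ∈ Finset.Ico 2 m, a i * a (m + 1 - i)| ≤
        δ ^ (m - 1) / 16 * (4 * ((m : ℝ) - 2) / (((m : ℝ) + 1) ^ 2 * ((m : ℝ) - 1))) := by
      refine (Finset.abs_sum_le_sum_abs _ _).trans ?_
      refine le_trans ?_ (mul_le_mul_of_nonneg_left (sum_inv_sq_mul_inv_sq_le hm3)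
        (by positivity))
      rw [Finset.mul_sum]
      refine Finset.sum_le_sum fun i hi => ?_
      rw [Finset.mem_Ico] at hi
      have hp : δ ^ (m - 1) = δ ^ (i - 1) * δ ^ (m + 1 - i - 1) := by
        rw [← pow_add]
        congr 1
        omega
      rw [abs_mul, hp]
      refine (mul_le_mul (ih i (by omega) (by omega)) (ih (m + 1 - i) (by omega) (by omega))
        (abs_nonneg _) (by positivity)).trans (le_of_eq ?_)
      ring
    rw [hrec m hm3, abs_neg, abs_mul, abs_of_nonneg (div_nonneg (by linarith) hm2.le)]
    refine (mul_le_mul_of_nonneg_left hsum (div_nonneg (by linarith) hm2.le)).trans ?_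
    have e : (m : ℝ) / (m - 2) *
        (δ ^ (m - 1) / 16 * (4 * ((m : ℝ) - 2) / (((m : ℝ) + 1) ^ 2 * ((m : ℝ) - 1)))) =
        δ ^ (m - 1) / 4 * ((m : ℝ) / (((m : ℝ) + 1) ^ 2 * ((m : ℝ) - 1))) := by
      field_simp
      ring
    rw [e]
    refine mul_le_mul_of_nonneg_left ?_ (by positivity)
    rw [div_le_div_iff₀ (by positivity) (by positivity)]
    nlinarith

/-- Geometric decay for a sequence determined by a linear convolution with a kernel which
decays twice as fast. -/
theorem abs_le_of_linear_convolution {a b : ℕ → ℝ} {ε c : ℝ} (hε0 : 0 ≤ ε)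
    (hc : |c| ≤ 1 / 50) (h2 : |b 2| ≤ ε / 16)
    (ha : ∀ m, 2 ≤ m → |a m| ≤ (ε / 2) ^ (m - 1) / 4 * (1 / (m : ℝ) ^ 2))
    (hrec : ∀ m, 3 ≤ m → b m = -((m : ℝ) / (m - 1) *
      (2 * ∑ i ∈ Finset.Ico 2 m, a i * b (m + 1 - i) + a m * (c + ((m : ℝ) - 2) / m))))
    (m : ℕ) (hm : 2 ≤ m) : |b m| ≤ ε ^ (m - 1) / 4 * (1 / (m : ℝ) ^ 2) := by
  have ha3 : ∀ m, 3 ≤ m → |a m| ≤ ε ^ (m - 1) / 16 * (1 / (m : ℝ) ^ 2) := by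
    intro m hm
    refine (ha m (by omega)).trans (mul_le_mul_of_nonneg_right ?_ (by positivity))
    rw [div_pow]
    have : (4 : ℝ) ≤ 2 ^ (m - 1) := by
      calc (4 : ℝ) = 2 ^ 2 := by norm_num
        _ ≤ 2 ^ (m - 1) := pow_le_pow_right₀ (by norm_num) (by omega)
    rw [div_div]
    exact div_le_div_of_nonneg_left (by positivity) (by norm_num) (by linarith)
  induction m using Nat.strong_induction_on with
  | _ m ih =>
    rcases hm.eq_or_lt with rfl | hm3
    · norm_num
      linarith
    have hm' : (3 : ℝ) ≤ m := by exact_mod_cast hm3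
    have hm1 : 0 < (m : ℝ) - 1 := by linarith
    have hm2 : 0 < (m : ℝ) - 2 := by linarith
    have hsum : |∑ i ∈ Finset.Ico 2 m, a i * b (m + 1 - i)| ≤
        ε ^ (m - 1) / 64 * (4 * ((m : ℝ) - 2) / (((m : ℝ) + 1) ^ 2 * ((m : ℝ) - 1))
          + 1 / (4 * ((m : ℝ) - 1) ^ 2)) := by
      refine (Finset.abs_sum_le_sum_abs _ _).trans ?_
      refine le_trans ?_ (mul_le_mul_of_nonneg_left
        (add_le_add_left (sum_inv_sq_mul_inv_sq_le hm3) _) (by positivity))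
      have hite : ∑ i ∈ Finset.Ico 2 m, (if i = 2 then 1 / (4 * ((m : ℝ) - 1) ^ 2) else 0)
          = 1 / (4 * ((m : ℝ) - 1) ^ 2) := by
        rw [Finset.sum_ite_eq', if_pos (Finset.mem_Ico.2 ⟨le_rfl, hm3⟩)]
      rw [← hite, ← Finset.sum_add_distrib, Finset.mul_sum]
      refine Finset.sum_le_sum fun i hi => ?_
      rw [Finset.mem_Ico] at hi
      have hp : ε ^ (m - 1) = ε ^ (i - 1) * ε ^ (m + 1 - i - 1) := by
        rw [← pow_add]
        congr 1
        omega
      have hb := ih (m + 1 - i) (by omega) (by omega)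
      rw [abs_mul, hp]
      split_ifs with hi2
      · subst hi2
        refine (mul_le_mul (ha 2 le_rfl) hb (abs_nonneg _) (by positivity)).trans (le_of_eq ?_)
        have : ((m + 1 - 2 : ℕ) : ℝ) = m - 1 := by
          rw [Nat.cast_sub (by omega)]
          push_cast
          ring
        rw [this]
        field_simp
        norm_num
        ring
      · refine (mul_le_mul (ha3 i (by omega)) hb (abs_nonneg _) (by positivity)).trans
          (le_of_eq ?_)
        ring
    have hlin : |a m * (c + ((m : ℝ) - 2) / m)| ≤
        ε ^ (m - 1) / 16 * (1 / (m : ℝ) ^ 2) * (1 / 50 + ((m : ℝ) - 2) / m) := by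
      rw [abs_mul]
      refine mul_le_mul (ha3 m hm3) ?_ (abs_nonneg _) (by positivity)
      refine (abs_add_le _ _).trans (add_le_add hc (le_of_eq (abs_of_nonneg ?_)))
      positivity
    rw [hrec m hm3, abs_neg, abs_mul, abs_of_nonneg (div_nonneg (by linarith) hm1.le)]
    have htot := (abs_add_le (2 * ∑ i ∈ Finset.Ico 2 m, a i * b (m + 1 - i))
      (a m * (c + ((m : ℝ) - 2) / m))).trans (add_le_add
        ((abs_mul _ _).trans_le (mul_le_mul_of_nonneg_left hsum (abs_nonneg _))) hlin)
    refine (mul_le_mul_of_nonneg_left htot (div_nonneg (by linarith) hm1.le)).trans ?_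
    rw [abs_two]
    set x : ℝ := (m : ℝ) with hx
    have e : x / (x - 1) * (2 * (ε ^ (m - 1) / 64 *
          (4 * (x - 2) / ((x + 1) ^ 2 * (x - 1)) + 1 / (4 * (x - 1) ^ 2))) +
        ε ^ (m - 1) / 16 * (1 / x ^ 2) * (1 / 50 + (x - 2) / x)) =
        ε ^ (m - 1) / 4 * (1 / x ^ 2) *
          ((x ^ 3 * (x - 2)) / (2 * ((x - 1) ^ 2 * (x + 1) ^ 2)) + x ^ 3 / (32 * (x - 1) ^ 3)
            + (1 / 200 * (x / (x - 1)) + 1 / 4 * ((x - 2) / (x - 1)))) := by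
      field_simp
      ring
    rw [e]
    refine mul_le_of_le_one_right (by positivity) ?_
    have t1 : (x ^ 3 * (x - 2)) / (2 * ((x - 1) ^ 2 * (x + 1) ^ 2)) ≤ 1 / 2 := by
      rw [div_le_div_iff₀ (by positivity) (by positivity)]
      nlinarith [sq_nonneg x, mul_pos hm1 hm2, pow_pos hm2 3, pow_pos hm2 2,
        mul_nonneg (sq_nonneg x) hm2.le]
    have t3 : x / (x - 1) ≤ 3 / 2 := by
      rw [div_le_div_iff₀ hm1 (by norm_num)]
      linarith
    have t2 : x ^ 3 / (32 * (x - 1) ^ 3) ≤ 27 / 256 := by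
      have : x ^ 3 / (32 * (x - 1) ^ 3) = (x / (x - 1)) ^ 3 / 32 := by
        field_simp
      rw [this]
      have := pow_le_pow_left₀ (by positivity : 0 ≤ x / (x - 1)) t3 3
      norm_num at this ⊢
      linarith
    have t4 : (x - 2) / (x - 1) ≤ 1 := by
      rw [div_le_one hm1]
      linarith
    linarith

/-- first-order bounds and sign alternation for the mean field Taylor
recursion with small pure `φ⁴` data. -/
theorem stmt5 (ε : ℝ) (hε0 : 0 < ε) (hε : ε ≤ 1 / 100)
    (f2 : ℕ → ℝ) (g : ℕ → ℕ → ℝ) (h : MFTaylor f2 g)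
    (h20 : |f2 0| ≤ ε / 4) (h40 : 0 ≤ g 4 0 ∧ g 4 0 ≤ ε / 32) :
    |f2 1| ≤ ε / 2 ∧ |g 4 1| ≤ ε ^ 2 / 32 ∧
    (∀ n : ℕ, Even n → 6 ≤ n →
      |g n 0| ≤ ε ^ (n / 2 - 1) / (2 * (n : ℝ) ^ 2) ∧
      |g n 1| ≤ ε ^ (n / 2 - 1) / (n : ℝ) ^ 2) ∧
    (∀ n : ℕ, Even n → 4 ≤ n → g n 0 = (-1 : ℝ) ^ (n / 2) * |g n 0|) := by
  obtain ⟨hi, -, hreg⟩ := h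
  have hf := abs_le.1 h20
  have hf21 : |f2 1| ≤ ε / 2 := by
    have h0 := hi 0
    norm_num at h0
    rw [abs_le]
    constructor <;> nlinarith
  have hg41 : |g 4 1| ≤ ε ^ 2 / 32 := by
    have h4 := (hreg (2 * 2) (by decide) (by norm_num)).2
    rw [gPairSum_two_mul] at h4
    norm_num at h4
    have e : g 4 1 = -(4 * (g 4 0 * f2 0)) := by linarith
    rw [e, abs_neg, abs_mul, abs_mul, abs_of_nonneg h40.1, abs_of_nonneg (by norm_num : (0:ℝ) ≤ 4)]
    have := mul_le_mul h40.2 h20 (abs_nonneg _) (by positivity)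
    linarith
  have hrec0 : ∀ m : ℕ, 3 ≤ m → g (2 * m) 0 = -((m : ℝ) / (m - 2) *
      ∑ i ∈ Finset.Ico 2 m, g (2 * i) 0 * g (2 * (m + 1 - i)) 0) := by
    intro m hm
    have h0 := (hreg (2 * m) (even_two_mul m) (by omega)).1
    rw [gPairSum_two_mul] at h0
    have hm' : (3 : ℝ) ≤ m := by exact_mod_cast hm
    have hm2 : (m : ℝ) - 2 ≠ 0 := by linarith
    push_cast at h0
    have e : (2 * (m : ℝ) - 4) / (2 * m) = (m - 2) / m := by
      field_simp
      ring
    rw [e] at h0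
    rw [eq_neg_of_add_eq_zero_right h0]
    field_simp
  have hrec1 : ∀ m : ℕ, 3 ≤ m → g (2 * m) 1 = -((m : ℝ) / (m - 1) *
      (2 * ∑ i ∈ Finset.Ico 2 m, g (2 * i) 0 * g (2 * (m + 1 - i)) 1
        + g (2 * m) 0 * (2 * f2 0 + ((m : ℝ) - 2) / m))) := by
    intro m hm
    have h1 := (hreg (2 * m) (even_two_mul m) (by omega)).2
    rw [gPairSum_two_mul] at h1
    have hm' : (3 : ℝ) ≤ m := by exact_mod_cast hm
    have hm1 : (m : ℝ) - 1 ≠ 0 := by linarith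
    push_cast at h1
    have e : 2 * f2 0 + 1 - 4 / (2 * (m : ℝ)) = 2 * f2 0 + ((m : ℝ) - 2) / m := by
      field_simp
      ring
    rw [e] at h1
    set T := 2 * ∑ i ∈ Finset.Ico 2 m, g (2 * i) 0 * g (2 * (m + 1 - i)) 1
    set U := g (2 * m) 0 * (2 * f2 0 + ((m : ℝ) - 2) / m)
    have e2 : T + U = -(((m : ℝ) - 1) / m * g (2 * m) 1) := by
      have : ((m : ℝ) - 1) / m * g (2 * m) 1 = 2 / (2 * (m : ℝ)) * g (2 * m) 1
          + (2 * (m : ℝ) - 4) / (2 * m) * g (2 * m) 1 := by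
        field_simp
        ring
      linarith
    rw [e2]
    field_simp
  have habs0 := abs_le_of_convolution (a := fun m => g (2 * m) 0) (δ := ε / 2) (by positivity)
    (by
      show |g 4 0| ≤ _
      rw [abs_of_nonneg h40.1]
      linarith [h40.2]) hrec0
  have habs1 := abs_le_of_linear_convolution (a := fun m => g (2 * m) 0)
    (b := fun m => g (2 * m) 1) (ε := ε) (c := 2 * f2 0) hε0.le
    (by
      rw [abs_mul, abs_two]
      linarith)
    (by
      show |g 4 1| ≤ _
      nlinarith) habs0 hrec1
  have halt := alternating_of_convolution (a := fun m => g (2 * m) 0) h40.1 hrec0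
  refine ⟨hf21, hg41, ?_, ?_⟩
  · intro n hn hn6
    obtain ⟨m, rfl⟩ := hn.exists_two_nsmul
    simp only [smul_eq_mul] at hn6 ⊢
    rw [Nat.mul_div_cancel_left m (by norm_num)]
    have hm : 2 ≤ m := by omega
    constructor
    · refine (habs0 m hm).trans ?_
      have : (ε / 2) ^ (m - 1) ≤ ε ^ (m - 1) / 2 := by
        rw [div_pow]
        refine div_le_div_of_nonneg_left (by positivity) (by norm_num) ?_
        exact le_self_pow₀ (by norm_num) (by omega)
      calc (ε / 2) ^ (m - 1) / 4 * (1 / (m : ℝ) ^ 2)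
          ≤ ε ^ (m - 1) / 2 / 4 * (1 / (m : ℝ) ^ 2) := by gcongr
        _ = _ := by
          push_cast
          ring
    · refine (habs1 m hm).trans (le_of_eq ?_)
      push_cast
      ring
  · intro n hn hn4
    obtain ⟨m, rfl⟩ := hn.exists_two_nsmul
    simp only [smul_eq_mul] at hn4 ⊢
    rw [Nat.mul_div_cancel_left m (by norm_num)]
    have := abs_of_nonneg (halt m (by omega))
    rw [abs_mul, abs_pow, abs_neg, abs_one, one_pow, one_mul] at this
    rw [this, ← mul_assoc, ← mul_pow]
    norm_num
end

section
/- Let 0 < ε ≤ 10⁻² and suppose the coefficients of the mean field Taylor recursion satisfy |f_{2,0}| ≤ ε/4 and 0 ≤ g_{4,0} ≤ ε/32. Then |g_{n,k}| ≤ 2^{k−2}·ε^{n/2−1}·(k + (n−4)/2)! for all even n ≥ 4 and all k ≥ 0, and |f_{2,k}| ≤ 2^{k}·ε·(|k−1|)! for all k ≥ 0. -/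
open Finset in
theorem gPairSum_two_mul_add_four (m : ℕ) (t : ℕ → ℕ → ℝ) :
    gPairSum (2 * m + 4) t = ∑ i ∈ range m, t (2 * i + 4) (2 * (m - 1 - i) + 4) := by
  rw [gPairSum, ← sum_filter]
  symm
  refine sum_nbij' (fun i => 2 * i + 4) (fun n => (n - 4) / 2) ?_ ?_ ?_ ?_ ?_
  · intro i hi
    simp only [mem_range, mem_filter] at hi ⊢
    exact ⟨by omega, ⟨i + 2, by ring⟩, by omega, by omega⟩
  · intro n hn
    simp only [mem_range, mem_filter] at hn ⊢
    omega
  · intro i _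
    simp
  · intro n hn
    simp only [mem_range, mem_filter, Nat.even_iff] at hn ⊢
    omega
  · intro i hi
    simp only [mem_range] at hi
    congr 1
    omega

/-- The factorial form of `choose (a + b) a * choose (c + d) c ≤ choose (a + b + c + d) (a + c)`. -/
theorem factorial_mul_factorial_le_of_vandermonde (a b c d : ℕ) :
    (a + c).factorial * (b + d).factorial * ((a + b).factorial * (c + d).factorial) ≤
      (a + b + (c + d)).factorial *
        ((a.factorial * b.factorial) * (c.factorial * d.factorial)) := by
  have h1 := Nat.choose_mul_factorial_mul_factorial (Nat.le_add_right a b)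
  have h2 := Nat.choose_mul_factorial_mul_factorial (Nat.le_add_right c d)
  have h3 := Nat.choose_mul_factorial_mul_factorial (Nat.le_add_right (a + c) (b + d))
  have hv : (a + b).choose a * (c + d).choose c ≤ (a + b + (c + d)).choose (a + c) := by
    rw [Nat.add_choose_eq (a + b) (c + d) (a + c)]
    exact Finset.single_le_sum
      (f := fun ij : ℕ × ℕ => (a + b).choose ij.1 * (c + d).choose ij.2)
      (fun _ _ => Nat.zero_le _) (a := (a, c)) (by simp)
  rw [Nat.add_sub_cancel_left] at h1 h2 h3
  rw [show a + c + (b + d) = a + b + (c + d) by ring] at h3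
  rw [← h1, ← h2, ← h3]
  calc _ = (a + b).choose a * (c + d).choose c * ((a + c).factorial * (b + d).factorial *
        (a.factorial * b.factorial * (c.factorial * d.factorial))) := by ring
    _ ≤ (a + b + (c + d)).choose (a + c) * ((a + c).factorial * (b + d).factorial *
        (a.factorial * b.factorial * (c.factorial * d.factorial))) :=
      Nat.mul_le_mul_right _ hv
    _ = _ := by ring

theorem factorial_succ_mul_factorial_succ_le (a b : ℕ) :
    (a + 1).factorial * (b + 1).factorial ≤ (a + b + 1).factorial := by
  induction b with
  | zero => simp
  | succ b ih =>
    rw [Nat.factorial_succ (b + 1), show a + (b + 1) + 1 = (a + b + 1) + 1 by ring,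
      Nat.factorial_succ (a + b + 1)]
    calc _ = (b + 1 + 1) * ((a + 1).factorial * (b + 1).factorial) := by ring
      _ ≤ _ := Nat.mul_le_mul (by omega) ih

theorem sum_factorial_mul_factorial_le (K : ℕ) :
    ∑ ν ∈ Finset.range (K + 1), ν.factorial * (K - ν).factorial ≤ 3 * K.factorial := by
  cases K with
  | zero => simp
  | succ k =>
    rw [Finset.sum_range_succ, Finset.sum_range_succ']
    have h : ∑ i ∈ Finset.range k, (i + 1).factorial * (k + 1 - (i + 1)).factorial ≤
        ∑ _i ∈ Finset.range k, k.factorial := by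
      refine Finset.sum_le_sum fun i hi => ?_
      have hi := Finset.mem_range.1 hi
      obtain ⟨j, rfl⟩ : ∃ j, k = i + j + 1 := ⟨k - i - 1, by omega⟩
      rw [show i + j + 1 + 1 - (i + 1) = j + 1 by omega]
      exact factorial_succ_mul_factorial_succ_le i j
    simp only [Finset.sum_const, Finset.card_range, smul_eq_mul] at h
    simp only [Nat.factorial_zero, Nat.sub_self, Nat.sub_zero, one_mul, mul_one]
    have := Nat.factorial_succ k
    nlinarith

theorem sum_sum_factorial_mul_factorial_le (M K : ℕ) :
    ∑ i ∈ Finset.range (M + 1), ∑ ν ∈ Finset.range (K + 1),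
      (ν + i).factorial * ((K - ν) + (M - i)).factorial ≤ 9 * (K + M).factorial := by
  have hpos : 0 < K.factorial * M.factorial :=
    Nat.mul_pos (Nat.factorial_pos _) (Nat.factorial_pos _)
  refine Nat.le_of_mul_le_mul_right ?_ hpos
  calc _ = ∑ i ∈ Finset.range (M + 1), ∑ ν ∈ Finset.range (K + 1),
        (ν + i).factorial * ((K - ν) + (M - i)).factorial * (K.factorial * M.factorial) := by
        simp only [Finset.sum_mul]
    _ ≤ ∑ i ∈ Finset.range (M + 1), ∑ ν ∈ Finset.range (K + 1), (K + M).factorial *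
        ((ν.factorial * (K - ν).factorial) * (i.factorial * (M - i).factorial)) := by
        refine Finset.sum_le_sum fun i hi => Finset.sum_le_sum fun ν hν => ?_
        have hi := Finset.mem_range.1 hi
        have hν := Finset.mem_range.1 hν
        have := factorial_mul_factorial_le_of_vandermonde ν (K - ν) i (M - i)
        rwa [show ν + (K - ν) = K by omega, show i + (M - i) = M by omega] at this
    _ = (K + M).factorial * ((∑ ν ∈ Finset.range (K + 1), ν.factorial * (K - ν).factorial) *
        ∑ i ∈ Finset.range (M + 1), i.factorial * (M - i).factorial) := by
        simp only [← Finset.mul_sum, ← Finset.sum_mul]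
    _ ≤ (K + M).factorial * ((3 * K.factorial) * (3 * M.factorial)) := by
        gcongr <;> exact sum_factorial_mul_factorial_le _
    _ = _ := by ring

theorem sum_factorial_mul_le {s : Finset ℕ} {a b : ℕ → ℕ} {N : ℕ}
    (h : ∀ i ∈ s, a i + b i ≤ N) :
    ∑ i ∈ s, (a i).factorial * (b i).factorial ≤ s.card * N.factorial := by
  refine Finset.sum_le_card_nsmul _ _ _ fun i hi => ?_
  exact (Nat.le_of_dvd (Nat.factorial_pos _) (Nat.factorial_mul_factorial_dvd_factorial_add _ _)).trans
    (Nat.factorial_le (h i hi))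

/-- The recursion with `n = 2 m + 4` and denominators cleared. -/
theorem MFTaylor.reindex {f2 : ℕ → ℝ} {g : ℕ → ℕ → ℝ} (h : MFTaylor f2 g) :
    (∀ k : ℕ, ((k : ℝ) + 1) * f2 (k + 1) =
      3 * g 4 k + f2 k - ∑ ν ∈ Finset.range (k + 1), f2 ν * f2 (k - ν)) ∧
    (∀ m k : ℕ, ((m : ℝ) + 2 + k) * g (2 * m + 4) (k + 2) =
      (m + 2) * (2 * m + 5) * g (2 * (m + 1) + 4) k
        - (m + 2) * (∑ i ∈ Finset.range m, ∑ ν ∈ Finset.range (k + 3),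
            g (2 * i + 4) ν * g (2 * (m - 1 - i) + 4) (k + 2 - ν))
        - (2 * m + 4) * (∑ ν ∈ Finset.range (k + 2), g (2 * m + 4) ν * f2 (k + 1 - ν))
        - m * g (2 * m + 4) (k + 1)) ∧
    (∀ m : ℕ, m * g (2 * m + 4) 0 =
      -((m + 2) * ∑ i ∈ Finset.range m, g (2 * i + 4) 0 * g (2 * (m - 1 - i) + 4) 0)) ∧
    (∀ m : ℕ, ((m : ℝ) + 1) * g (2 * m + 4) 1 =
      -(2 * (m + 2) * ∑ i ∈ Finset.range m, g (2 * i + 4) 0 * g (2 * (m - 1 - i) + 4) 1)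
        - g (2 * m + 4) 0 * (2 * (m + 2) * f2 0 + m)) := by
  obtain ⟨h1, h2, h3⟩ := h
  have hev (m : ℕ) : Even (2 * m + 4) := ⟨m + 2, by ring⟩
  refine ⟨fun k => ?_, fun m k => ?_, fun m => ?_, fun m => ?_⟩
  · rw [h1 k]; ring
  · have := h2 (2 * m + 4) k (hev m) (by omega)
    rw [gPairSum_two_mul_add_four] at this
    rw [show 2 * (m + 1) + 4 = 2 * m + 4 + 2 by ring, this]
    push_cast
    have hm : (2 * (m : ℝ) + 4) ≠ 0 := by positivity
    have hm' : (2 * (m : ℝ) + 4 + 1) ≠ 0 := by positivity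
    field_simp
    ring
  · have := (h3 (2 * m + 4) (hev m) (by omega)).1
    rw [gPairSum_two_mul_add_four] at this
    push_cast at this
    have hm : (2 * (m : ℝ) + 4) ≠ 0 := by positivity
    field_simp at this
    linarith
  · have := (h3 (2 * m + 4) (hev m) (by omega)).2
    rw [gPairSum_two_mul_add_four] at this
    push_cast at this
    have hm : (2 * (m : ℝ) + 4) ≠ 0 := by positivity
    field_simp at this
    linarith

/-- The claimed bound for `g (2 * m + 4) k`. -/
noncomputable def gBound (ε : ℝ) (m k : ℕ) : ℝ :=
  1 / 4 * 2 ^ k * ε ^ (m + 1) * ((k + m).factorial : ℝ)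

/-- The claimed bound for `f2 k`. -/
noncomputable def fBound (ε : ℝ) (k : ℕ) : ℝ :=
  2 ^ k * ε * ((((k : ℤ) - 1).natAbs.factorial : ℝ))

theorem natAbs_pred_factorial_le (k : ℕ) : ((k : ℤ) - 1).natAbs.factorial ≤ k.factorial := by
  cases k with
  | zero => simp
  | succ k => exact Nat.factorial_le (by omega)

theorem abs_sum_mul_le {ι : Type*} (s : Finset ι) {a b a' b' : ι → ℝ}
    (ha : ∀ i ∈ s, |a i| ≤ a' i) (hb : ∀ i ∈ s, |b i| ≤ b' i) :
    |∑ i ∈ s, a i * b i| ≤ ∑ i ∈ s, a' i * b' i := by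
  refine (Finset.abs_sum_le_sum_abs _ _).trans (Finset.sum_le_sum fun i hi => ?_)
  rw [abs_mul]
  exact mul_le_mul (ha i hi) (hb i hi) (abs_nonneg _) ((abs_nonneg _).trans (ha i hi))

theorem sum_fBound_mul_fBound_le {ε : ℝ} (hε : 0 < ε) (k : ℕ) :
    ∑ ν ∈ Finset.range (k + 1), fBound ε ν * fBound ε (k - ν) ≤
      2 ^ k * ε ^ 2 * ((k + 1) * (k.factorial : ℝ)) := by
  have key : ∑ ν ∈ Finset.range (k + 1), ν.factorial * (k - ν).factorial ≤
      (k + 1) * k.factorial := by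
    simpa using sum_factorial_mul_le (s := Finset.range (k + 1)) (a := fun ν => ν)
      (b := fun ν => k - ν) (N := k) (fun i hi => by
        have := Finset.mem_range.1 hi
        omega)
  have key' : ∑ ν ∈ Finset.range (k + 1), (ν.factorial : ℝ) * ((k - ν).factorial : ℝ) ≤
      (k + 1) * (k.factorial : ℝ) := by exact_mod_cast key
  refine le_trans ?_ (mul_le_mul_of_nonneg_left key' (by positivity))
  rw [Finset.mul_sum]
  refine Finset.sum_le_sum fun ν hν => ?_
  have hν := Finset.mem_range.1 hν
  have e : (2 : ℝ) ^ k = 2 ^ ν * 2 ^ (k - ν) := by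
    rw [← pow_add]; congr 1; omega
  have h1 : ((((ν : ℕ) : ℤ) - 1).natAbs.factorial : ℝ) ≤ ν.factorial := by
    exact_mod_cast natAbs_pred_factorial_le ν
  have h2 : (((((k - ν : ℕ) : ℕ) : ℤ) - 1).natAbs.factorial : ℝ) ≤ (k - ν).factorial := by
    exact_mod_cast natAbs_pred_factorial_le (k - ν)
  calc fBound ε ν * fBound ε (k - ν) = 2 ^ k * ε ^ 2 *
        (((((ν : ℕ) : ℤ) - 1).natAbs.factorial : ℝ) *
          (((((k - ν : ℕ) : ℕ) : ℤ) - 1).natAbs.factorial : ℝ)) := by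
        rw [e, fBound, fBound]; ring
    _ ≤ _ := by gcongr

theorem sum_gBound_mul_fBound_le {ε : ℝ} (hε : 0 < ε) (m k : ℕ) :
    ∑ ν ∈ Finset.range (k + 2), gBound ε m ν * fBound ε (k + 1 - ν) ≤
      2 ^ k * ε ^ (m + 2) * ((k + m + 1).factorial : ℝ) := by
  have key : ∑ ν ∈ Finset.range (k + 1), (ν + m).factorial * (k - ν).factorial ≤
      (k + m + 1).factorial := by
    have := sum_factorial_mul_le (s := Finset.range (k + 1)) (a := fun ν => ν + m)
      (b := fun ν => k - ν) (N := k + m) (fun i hi => by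
        have := Finset.mem_range.1 hi
        omega)
    rw [Finset.card_range] at this
    refine this.trans ?_
    rw [Nat.factorial_succ]
    gcongr
    omega
  have key' : ∑ ν ∈ Finset.range (k + 1), ((ν + m).factorial : ℝ) * ((k - ν).factorial : ℝ) ≤
      ((k + m + 1).factorial : ℝ) := by exact_mod_cast key
  rw [Finset.sum_range_succ]
  have e : ∑ ν ∈ Finset.range (k + 1), gBound ε m ν * fBound ε (k + 1 - ν) =
      1 / 2 * 2 ^ k * ε ^ (m + 2) *
        ∑ ν ∈ Finset.range (k + 1), ((ν + m).factorial : ℝ) * ((k - ν).factorial : ℝ) := by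
    rw [Finset.mul_sum]
    refine Finset.sum_congr rfl fun ν hν => ?_
    have hν := Finset.mem_range.1 hν
    obtain ⟨j, rfl⟩ : ∃ j, k = ν + j := ⟨k - ν, by omega⟩
    have e1 : ν + j + 1 - ν = j + 1 := by omega
    have e2 : ν + j - ν = j := by omega
    rw [e1, e2, gBound, fBound]
    have e3 : (((j + 1 : ℕ) : ℤ) - 1).natAbs = j := by omega
    rw [e3]
    ring
  have e' : gBound ε m (k + 1) * fBound ε (k + 1 - (k + 1)) =
      1 / 2 * 2 ^ k * ε ^ (m + 2) * ((k + m + 1).factorial : ℝ) := by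
    rw [gBound, fBound, show k + 1 + m = k + m + 1 by ring]
    simp
    ring
  rw [e, e']
  have : 1 / 2 * 2 ^ k * ε ^ (m + 2) *
      (∑ ν ∈ Finset.range (k + 1), ((ν + m).factorial : ℝ) * ((k - ν).factorial : ℝ)) ≤
      1 / 2 * 2 ^ k * ε ^ (m + 2) * ((k + m + 1).factorial : ℝ) := by gcongr
  linarith

theorem gBound_mul_gBound (ε : ℝ) {M K i ν : ℕ} (hi : i ≤ M) (hν : ν ≤ K) :
    gBound ε i ν * gBound ε (M - i) (K - ν) = 1 / 16 * 2 ^ K * ε ^ (M + 2) *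
      (((ν + i).factorial * ((K - ν) + (M - i)).factorial : ℕ) : ℝ) := by
  obtain ⟨j, rfl⟩ : ∃ j, M = i + j := ⟨M - i, by omega⟩
  obtain ⟨l, rfl⟩ : ∃ l, K = ν + l := ⟨K - ν, by omega⟩
  simp only [gBound, Nat.add_sub_cancel_left]
  push_cast
  ring

theorem sum_sum_gBound_mul_gBound_le {ε : ℝ} (hε : 0 < ε) (M K : ℕ) :
    ∑ i ∈ Finset.range (M + 1), ∑ ν ∈ Finset.range (K + 1),
      gBound ε i ν * gBound ε (M - i) (K - ν) ≤
      9 / 16 * 2 ^ K * ε ^ (M + 2) * ((K + M).factorial : ℝ) := by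
  have key : ((∑ i ∈ Finset.range (M + 1), ∑ ν ∈ Finset.range (K + 1),
      (ν + i).factorial * ((K - ν) + (M - i)).factorial : ℕ) : ℝ) ≤
      9 * ((K + M).factorial : ℝ) := by
    exact_mod_cast sum_sum_factorial_mul_factorial_le M K
  have e : ∑ i ∈ Finset.range (M + 1), ∑ ν ∈ Finset.range (K + 1),
      gBound ε i ν * gBound ε (M - i) (K - ν) = 1 / 16 * 2 ^ K * ε ^ (M + 2) *
      ((∑ i ∈ Finset.range (M + 1), ∑ ν ∈ Finset.range (K + 1),
      (ν + i).factorial * ((K - ν) + (M - i)).factorial : ℕ) : ℝ) := by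
    rw [Nat.cast_sum, Finset.mul_sum]
    refine Finset.sum_congr rfl fun i hi => ?_
    rw [Nat.cast_sum, Finset.mul_sum]
    refine Finset.sum_congr rfl fun ν hν => ?_
    exact gBound_mul_gBound ε (Nat.lt_succ_iff.1 (Finset.mem_range.1 hi))
      (Nat.lt_succ_iff.1 (Finset.mem_range.1 hν))
  rw [e]
  have := mul_le_mul_of_nonneg_left key (show 0 ≤ 1 / 16 * 2 ^ K * ε ^ (M + 2) by positivity)
  linarith

theorem sum_gBound_zero_mul_gBound_le {ε : ℝ} (hε : 0 < ε) (M l : ℕ) :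
    ∑ i ∈ Finset.range (M + 1), gBound ε i 0 * gBound ε (M - i) l ≤
      1 / 16 * 2 ^ l * ε ^ (M + 2) * ((M + 1) * ((l + M).factorial : ℝ)) := by
  have key : ∑ i ∈ Finset.range (M + 1), (0 + i).factorial * (l - 0 + (M - i)).factorial ≤
      (M + 1) * (l + M).factorial := by
    simpa using sum_factorial_mul_le (s := Finset.range (M + 1)) (a := fun i => 0 + i)
      (b := fun i => l - 0 + (M - i)) (N := l + M) (fun i hi => by
        have := Finset.mem_range.1 hi
        omega)
  have key' : ((∑ i ∈ Finset.range (M + 1),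
      (0 + i).factorial * (l - 0 + (M - i)).factorial : ℕ) : ℝ) ≤
      (M + 1) * ((l + M).factorial : ℝ) := by exact_mod_cast key
  refine le_trans (le_of_eq ?_) (mul_le_mul_of_nonneg_left key' (by positivity))
  rw [Nat.cast_sum, Finset.mul_sum]
  refine Finset.sum_congr rfl fun i hi => ?_
  exact gBound_mul_gBound ε (Nat.lt_succ_iff.1 (Finset.mem_range.1 hi)) (Nat.zero_le l)

section Bounds

variable {ε : ℝ} {f2 : ℕ → ℝ} {g : ℕ → ℕ → ℝ}

theorem MFTaylor.abs_f2_succ_le (h : MFTaylor f2 g) (hε0 : 0 < ε) (hε : ε ≤ 1 / 100) {k : ℕ}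
    (hg : |g 4 k| ≤ gBound ε 0 k) (hf : ∀ j ≤ k, |f2 j| ≤ fBound ε j) :
    |f2 (k + 1)| ≤ fBound ε (k + 1) := by
  have hrec := h.reindex.1 k
  have hsum := (abs_sum_mul_le (Finset.range (k + 1))
    (fun ν hν => hf ν (Nat.lt_succ_iff.1 (Finset.mem_range.1 hν)))
    (fun ν _ => hf (k - ν) (Nat.sub_le _ _))).trans (sum_fBound_mul_fBound_le hε0 k)
  have hk := hf k le_rfl
  have hk' : fBound ε k ≤ 2 ^ k * ε * (k.factorial : ℝ) := by
    have : ((((k : ℕ) : ℤ) - 1).natAbs.factorial : ℝ) ≤ k.factorial := by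
      exact_mod_cast natAbs_pred_factorial_le k
    rw [fBound]
    gcongr
  have e : fBound ε (k + 1) = 2 * (2 ^ k * ε * (k.factorial : ℝ)) := by
    rw [fBound, show (((k + 1 : ℕ) : ℤ) - 1).natAbs = k by omega]
    ring
  have eg : gBound ε 0 k = 1 / 4 * (2 ^ k * ε * (k.factorial : ℝ)) := by
    simp [gBound]
    ring
  have es : 2 ^ k * ε ^ 2 * ((k + 1) * (k.factorial : ℝ)) =
      (k + 1) * (ε * (2 ^ k * ε * (k.factorial : ℝ))) := by ring
  rw [es] at hsum
  rw [e]
  rw [eg] at hg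
  set X := 2 ^ k * ε * (k.factorial : ℝ) with hX
  have hX0 : 0 < X := by positivity
  have hεX : ε * X ≤ 1 / 100 * X := by gcongr
  have hk0 : (0 : ℝ) ≤ k := Nat.cast_nonneg k
  have hkX : (0 : ℝ) ≤ k * X := by positivity
  have hsum' := hsum.trans (mul_le_mul_of_nonneg_left hεX (by positivity : (0 : ℝ) ≤ k + 1))
  have : ((k : ℝ) + 1) * |f2 (k + 1)| ≤ (k + 1) * (2 * X) := by
    rw [← abs_of_nonneg (by positivity : (0 : ℝ) ≤ k + 1), ← abs_mul,
      abs_of_nonneg (by positivity : (0 : ℝ) ≤ k + 1), hrec]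
    rw [abs_le] at *
    constructor <;> linarith
  exact le_of_mul_le_mul_left this (by positivity)

theorem MFTaylor.abs_g_zero_le (h : MFTaylor f2 g) (hε0 : 0 < ε)
    (h40 : |g 4 0| ≤ gBound ε 0 0) (m : ℕ) : |g (2 * m + 4) 0| ≤ gBound ε m 0 := by
  induction m using Nat.strong_induction_on with
  | _ m ih =>
    cases m with
    | zero => exact h40
    | succ M =>
      have hrec := h.reindex.2.2.1 (M + 1)
      have hsum := (abs_sum_mul_le (Finset.range (M + 1))
        (fun i hi => ih i (Finset.mem_range.1 hi))
        (fun i _ => ih (M - i) (by omega))).trans (sum_gBound_zero_mul_gBound_le hε0 M 0)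
      have e : gBound ε (M + 1) 0 = 1 / 4 * (ε ^ (M + 2) * ((M + 1) * (M.factorial : ℝ))) := by
        simp [gBound, Nat.factorial_succ]
        ring
      have e' : 1 / 16 * 2 ^ 0 * ε ^ (M + 2) * ((M + 1) * ((0 + M).factorial : ℝ)) =
          1 / 16 * (ε ^ (M + 2) * ((M + 1) * (M.factorial : ℝ))) := by
        simp
        ring
      rw [e'] at hsum
      rw [e]
      set X := ε ^ (M + 2) * ((M + 1) * (M.factorial : ℝ)) with hX
      have hX0 : 0 < X := by positivity
      have : ((M : ℝ) + 1) * |g (2 * (M + 1) + 4) 0| ≤ (M + 1) * (1 / 4 * X) := by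
        rw [← abs_of_nonneg (by positivity : (0 : ℝ) ≤ M + 1), ← abs_mul,
          abs_of_nonneg (by positivity : (0 : ℝ) ≤ M + 1)]
        push_cast at hrec
        rw [hrec, abs_neg, abs_mul, abs_of_nonneg (by positivity : (0 : ℝ) ≤ M + 1 + 2)]
        refine (mul_le_mul_of_nonneg_left hsum (by positivity)).trans ?_
        have : 0 ≤ M * X := by positivity
        linarith
      exact le_of_mul_le_mul_left this (by positivity)

theorem MFTaylor.abs_g_one_le (h : MFTaylor f2 g) (hε0 : 0 < ε) (hε : ε ≤ 1 / 100)
    (h20 : |f2 0| ≤ ε / 4) (h0 : ∀ m, |g (2 * m + 4) 0| ≤ gBound ε m 0) (m : ℕ) :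
    |g (2 * m + 4) 1| ≤ gBound ε m 1 := by
  induction m using Nat.strong_induction_on with
  | _ m ih =>
    have hrec := h.reindex.2.2.2 m
    have hsum : |∑ i ∈ Finset.range m, g (2 * i + 4) 0 * g (2 * (m - 1 - i) + 4) 1| ≤
        1 / 8 * m * (ε ^ (m + 1) * (m.factorial : ℝ)) := by
      cases m with
      | zero => simp
      | succ M =>
        refine ((abs_sum_mul_le (Finset.range (M + 1)) (fun i _ => h0 i)
          (fun i _ => ih (M + 1 - 1 - i) (by omega))).trans
            (sum_gBound_zero_mul_gBound_le hε0 M 1)).trans (le_of_eq ?_)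
        rw [add_comm 1 M]
        push_cast
        ring
    have e : gBound ε m 1 = 1 / 2 * (m + 1) * (ε ^ (m + 1) * (m.factorial : ℝ)) := by
      rw [gBound, add_comm 1 m, Nat.factorial_succ]
      push_cast
      ring
    have hg0 : |g (2 * m + 4) 0| ≤ 1 / 4 * (ε ^ (m + 1) * (m.factorial : ℝ)) := by
      refine (h0 m).trans (le_of_eq ?_)
      simp [gBound]
      ring
    rw [e]
    set X := ε ^ (m + 1) * (m.factorial : ℝ) with hX
    have hX0 : 0 < X := by positivity
    have hlin : |2 * ((m : ℝ) + 2) * f2 0 + m| ≤ 1 / 200 * (m + 2) + m := by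
      refine (abs_add_le _ _).trans ?_
      rw [abs_mul, abs_of_nonneg (by positivity : (0 : ℝ) ≤ 2 * (m + 2)), Nat.abs_cast]
      have : |f2 0| ≤ 1 / 400 := by linarith
      have := mul_le_mul_of_nonneg_left this (by positivity : (0 : ℝ) ≤ 2 * (m + 2))
      linarith
    have : ((m : ℝ) + 1) * |g (2 * m + 4) 1| ≤ (m + 1) * (1 / 2 * (m + 1) * X) := by
      rw [← abs_of_nonneg (by positivity : (0 : ℝ) ≤ m + 1), ← abs_mul,
        abs_of_nonneg (by positivity : (0 : ℝ) ≤ m + 1), hrec]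
      refine (abs_sub _ _).trans ?_
      rw [abs_neg, abs_mul, abs_mul (g (2 * m + 4) 0),
        abs_of_nonneg (by positivity : (0 : ℝ) ≤ 2 * (m + 2))]
      have b1 := mul_le_mul_of_nonneg_left hsum (by positivity : (0 : ℝ) ≤ 2 * (m + 2))
      have b2 := mul_le_mul hg0 hlin (abs_nonneg _) (by positivity)
      have : 0 ≤ m * X := by positivity
      have : 0 ≤ m * m * X := by positivity
      linarith
    exact le_of_mul_le_mul_left this (by positivity)

theorem MFTaylor.abs_g_add_two_le (h : MFTaylor f2 g) (hε0 : 0 < ε) (hε : ε ≤ 1 / 100) {k : ℕ}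
    (hg : ∀ m, ∀ j ≤ k + 1, |g (2 * m + 4) j| ≤ gBound ε m j)
    (hf : ∀ j ≤ k + 1, |f2 j| ≤ fBound ε j) (m : ℕ) :
    |g (2 * m + 4) (k + 2)| ≤ gBound ε m (k + 2) := by
  induction m using Nat.strong_induction_on with
  | _ m ih =>
    have hrec := h.reindex.2.1 m k
    set X := 1 / 4 * 2 ^ k * ε ^ (m + 1) * ((k + m + 1).factorial : ℝ) with hX
    have hX0 : 0 < X := by positivity
    have hA : |g (2 * (m + 1) + 4) k| ≤ 1 / 100 * X := by
      calc _ ≤ gBound ε (m + 1) k := hg (m + 1) k (by omega)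
        _ = ε * X := by rw [gBound, hX, ← add_assoc]; ring
        _ ≤ _ := by gcongr
    have hH : |g (2 * m + 4) (k + 1)| ≤ 2 * X := by
      refine (hg m (k + 1) le_rfl).trans (le_of_eq ?_)
      rw [gBound, hX, show k + 1 + m = k + m + 1 by ring]
      ring
    have hL : |∑ ν ∈ Finset.range (k + 2), g (2 * m + 4) ν * f2 (k + 1 - ν)| ≤ 1 / 25 * X := by
      calc _ ≤ _ := abs_sum_mul_le (Finset.range (k + 2))
            (fun ν hν => hg m ν (Nat.lt_succ_iff.1 (Finset.mem_range.1 hν)))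
            (fun ν _ => hf (k + 1 - ν) (Nat.sub_le _ _))
        _ ≤ _ := sum_gBound_mul_fBound_le hε0 m k
        _ = 4 * (ε * X) := by rw [hX]; ring
        _ ≤ 4 * (1 / 100 * X) := by gcongr
        _ = _ := by ring
    have hQ : ((m : ℝ) + 2) * |∑ i ∈ Finset.range m, ∑ ν ∈ Finset.range (k + 3),
        g (2 * i + 4) ν * g (2 * (m - 1 - i) + 4) (k + 2 - ν)| ≤
        (4 * ((m : ℝ) + 2) ^ 2 - 2 * m - 1 / 50 * (m + 2) ^ 2 - 1 / 5 * (m + 2)) * X := by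
      cases m with
      | zero =>
        simp
        positivity
      | succ M =>
        have hall : ∀ i < M + 1, ∀ j ≤ k + 2, |g (2 * i + 4) j| ≤ gBound ε i j := by
          intro i hi j hj
          rcases hj.lt_or_eq with hj | rfl
          · exact hg i j (by omega)
          · exact ih i hi
        have hsum : |∑ i ∈ Finset.range (M + 1), ∑ ν ∈ Finset.range (k + 3),
            g (2 * i + 4) ν * g (2 * (M + 1 - 1 - i) + 4) (k + 2 - ν)| ≤ 9 * X := by
          calc _ ≤ ∑ i ∈ Finset.range (M + 1), ∑ ν ∈ Finset.range (k + 2 + 1),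
                gBound ε i ν * gBound ε (M - i) (k + 2 - ν) := by
                refine (Finset.abs_sum_le_sum_abs _ _).trans (Finset.sum_le_sum fun i hi => ?_)
                exact abs_sum_mul_le (Finset.range (k + 3))
                  (fun ν hν => hall i (Finset.mem_range.1 hi) ν
                    (Nat.lt_succ_iff.1 (Finset.mem_range.1 hν)))
                  (fun ν _ => hall (M - i) (by omega) (k + 2 - ν) (Nat.sub_le _ _))
            _ ≤ _ := sum_sum_gBound_mul_gBound_le hε0 M (k + 2)
            _ = _ := by
                rw [hX, show k + 2 + M = k + (M + 1) + 1 by ring]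
                ring
        refine (mul_le_mul_of_nonneg_left hsum (by positivity)).trans ?_
        rw [← mul_assoc]
        refine mul_le_mul_of_nonneg_right ?_ hX0.le
        push_cast
        nlinarith [(Nat.cast_nonneg M : (0 : ℝ) ≤ M)]
    have e : gBound ε m (k + 2) = 4 * (m + 2 + k) * X := by
      rw [gBound, hX, show k + 2 + m = (k + m + 1) + 1 by ring, Nat.factorial_succ]
      push_cast
      ring
    rw [e]
    have : ((m : ℝ) + 2 + k) * |g (2 * m + 4) (k + 2)| ≤
        (m + 2 + k) * (4 * (m + 2 + k) * X) := by
      rw [← abs_of_nonneg (by positivity : (0 : ℝ) ≤ m + 2 + k), ← abs_mul,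
        abs_of_nonneg (by positivity : (0 : ℝ) ≤ m + 2 + k), hrec]
      refine (abs_sub _ _).trans ((add_le_add_left ((abs_sub _ _).trans
        (add_le_add_left (abs_sub _ _) _)) _).trans ?_)
      rw [abs_mul (((m : ℝ) + 2) * (2 * m + 5)),
        abs_of_nonneg (by positivity : (0 : ℝ) ≤ (m + 2) * (2 * m + 5)),
        abs_mul ((m : ℝ) + 2), abs_mul (2 * (m : ℝ) + 4), abs_mul (m : ℝ),
        abs_of_nonneg (by positivity : (0 : ℝ) ≤ m + 2),
        abs_of_nonneg (by positivity : (0 : ℝ) ≤ 2 * m + 4), Nat.abs_cast]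
      have b1 := mul_le_mul_of_nonneg_left hA
        (by positivity : (0 : ℝ) ≤ (m + 2) * (2 * m + 5))
      have b2 := mul_le_mul_of_nonneg_left hL (by positivity : (0 : ℝ) ≤ 2 * m + 4)
      have b3 := mul_le_mul_of_nonneg_left hH (Nat.cast_nonneg m : (0 : ℝ) ≤ m)
      have : 0 ≤ m * X := by positivity
      have : 0 ≤ k * X := by positivity
      have : 0 ≤ k * k * X := by positivity
      have : 0 ≤ m * k * X := by positivity
      linarith
    exact le_of_mul_le_mul_left this (by positivity)

end Bounds

/-- factorial bounds for the mean field Taylor recursion with small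
pure `φ⁴` data: `|g_{n,k}| ≤ 2^{k−2}·ε^{n/2−1}·(k+(n−4)/2)!` and
`|f_{2,k}| ≤ 2^k·ε·(|k−1|)!`. -/
theorem stmt6 (ε : ℝ) (hε0 : 0 < ε) (hε : ε ≤ 1 / 100)
    (f2 : ℕ → ℝ) (g : ℕ → ℕ → ℝ) (h : MFTaylor f2 g)
    (h20 : |f2 0| ≤ ε / 4) (h40 : 0 ≤ g 4 0 ∧ g 4 0 ≤ ε / 32) :
    (∀ n k : ℕ, Even n → 4 ≤ n →
      |g n k| ≤ (2 : ℝ) ^ ((k : ℤ) - 2) * ε ^ (n / 2 - 1) *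
        (((k + (n - 4) / 2).factorial : ℝ))) ∧
    (∀ k : ℕ, |f2 k| ≤ 2 ^ k * ε * ((((k : ℤ) - 1).natAbs.factorial : ℝ))) := by
  have hg0 : |g 4 0| ≤ gBound ε 0 0 := by
    rw [abs_of_nonneg h40.1]
    simp only [gBound, pow_zero, zero_add, pow_one, Nat.factorial_zero, Nat.cast_one]
    linarith [h40.2]
  have hf0 : |f2 0| ≤ fBound ε 0 := by
    refine h20.trans ?_
    simp only [fBound, pow_zero, one_mul, Nat.cast_zero, zero_sub, Int.natAbs_neg,
      Int.natAbs_one, Nat.factorial_one, Nat.cast_one]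
    linarith
  have main (k : ℕ) :
      (∀ m, |g (2 * m + 4) k| ≤ gBound ε m k) ∧ |f2 k| ≤ fBound ε k := by
    induction k using Nat.strong_induction_on with
    | _ k ih =>
      constructor
      · match k, ih with
        | 0, _ => exact h.abs_g_zero_le hε0 hg0
        | 1, ih => exact h.abs_g_one_le hε0 hε h20 (ih 0 one_pos).1
        | k + 2, ih =>
          exact h.abs_g_add_two_le hε0 hε (fun m j hj => (ih j (by omega)).1 m)
            fun j hj => (ih j (by omega)).2
      · match k, ih with
        | 0, _ => exact hf0
        | k + 1, ih =>
          exact h.abs_f2_succ_le hε0 hε ((ih k (by omega)).1 0)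
            fun j hj => (ih j (by omega)).2
  refine ⟨fun n k hn hn4 => ?_, fun k => (main k).2⟩
  obtain ⟨m, rfl⟩ : ∃ m, n = 2 * m + 4 := by
    obtain ⟨r, rfl⟩ := hn
    exact ⟨r - 2, by omega⟩
  refine ((main k).1 m).trans (le_of_eq ?_)
  rw [gBound, show (2 * m + 4) / 2 - 1 = m + 1 by omega, show (2 * m + 4 - 4) / 2 = m by omega,
    zpow_sub₀ two_ne_zero, zpow_natCast]
  ring
end
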